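/- Let f:U→ℝ^n be of the Monge form on an open set U⊂ℝ^d with n=d+m, and suppose f is nondegenerate at x_0∈U. Let 0<κ<1. Then there exist a sufficiently small neighbourhood V⊂U of x_0 and constants 0<v<1 and K_0>0 such that for every ball B⊂V there exists t_0=t_0(B,n,f,κ) such that for all t≥t_0 and all ε with K_0 e^{−ηt} < ε < 1, where η=η(n,d), one has L_d(B ∖ 𝔊(v,t,ε)) ≤ κ·L_d(B). -/

import Mathlib

open MeasureTheory Filter Set
open scoped ENNReal NNReal

noncomputable section

/-- The set `S_n^θ(ψ)` of `(ψ,θ)`-approximable points of `ℝ^n` (sup norm on `Fin n → ℝ`):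
points `x` with `‖x - (p+θ)/q‖ ≤ ψ q / q` for infinitely many `(p,q) ∈ ℤ^n × ℕ`. -/
def SApprox (n : ℕ) (θ : Fin n → ℝ) (ψ : ℝ → ℝ) : Set (Fin n → ℝ) :=
  {x | {pq : (Fin n → ℤ) × ℕ | 0 < pq.2 ∧
    ‖(fun i => x i - ((pq.1 i : ℝ) + θ i) / (pq.2 : ℝ) : Fin n → ℝ)‖ ≤
      ψ (pq.2 : ℝ) / (pq.2 : ℝ)}.Infinite}

/-- Iterated partial derivatives along a list of coordinate directions. -/
def listPDeriv {d n : ℕ} : List (Fin d) → ((Fin d → ℝ) → (Fin n → ℝ)) → ((Fin d → ℝ) → (Fin n → ℝ))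
  | [], f => f
  | i :: is, f => fun x => fderiv ℝ (listPDeriv is f) x (Pi.single i 1)

/-- `f` is `l`-nondegenerate at `x`: `f` is `C^l` near `x` and the partial derivatives of `f`
at `x` of orders `1,…,l` span `ℝ^n`. -/
def IsLNondegenerateAt {d n : ℕ} (l : ℕ) (f : (Fin d → ℝ) → (Fin n → ℝ)) (x : Fin d → ℝ) : Prop :=
  (∃ V ∈ nhds x, ContDiffOn ℝ l f V) ∧
  Submodule.span ℝ {v : Fin n → ℝ | ∃ β : List (Fin d),
    1 ≤ β.length ∧ β.length ≤ l ∧ v = listPDeriv β f x} = ⊤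

def IsNondegenerateAt {d n : ℕ} (f : (Fin d → ℝ) → (Fin n → ℝ)) (x : Fin d → ℝ) : Prop :=
  ∃ l : ℕ, IsLNondegenerateAt l f x

/-- `f` is nondegenerate in `U`: nondegenerate at almost every point of `U`. -/
def IsNondegenerateIn {d n : ℕ} (f : (Fin d → ℝ) → (Fin n → ℝ)) (U : Set (Fin d → ℝ)) : Prop :=
  ∀ᵐ x ∂(volume : Measure (Fin d → ℝ)), x ∈ U → IsNondegenerateAt f x

/-- `f` is nonsingular on `U`: its Jacobian has rank `d` at every point of `U`. -/
def IsNonsingularOn {d n : ℕ} (f : (Fin d → ℝ) → (Fin n → ℝ)) (U : Set (Fin d → ℝ)) : Prop :=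
  ∀ x ∈ U, LinearMap.rank (fderiv ℝ f x).toLinearMap = (d : Cardinal)

/-- `η(n,d)`. -/
def etaND (n d : ℕ) : ℝ := if 1 < d then 1 / ((n : ℝ) - 1) else 3 / (2 * (n : ℝ) - 1)

/-- The set counted by `N*_θ(Δ;ε,t)`. -/
def NstarSet {d n : ℕ} (f : (Fin d → ℝ) → Fin n → ℝ) (θ : Fin n → ℝ)
    (Δ : Set (Fin d → ℝ)) (ε t : ℝ) : Set ((Fin n → ℤ) × ℤ) :=
  {pq | Real.exp (t - 1) ≤ (pq.2 : ℝ) ∧ (pq.2 : ℝ) ≤ Real.exp t ∧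
    sInf ((fun x => ‖(fun i => f x i - ((pq.1 i : ℝ) + θ i) / (pq.2 : ℝ) : Fin n → ℝ)‖) '' Δ)
      ≤ ε / Real.exp t}

/-- `N*_θ(Δ;ε,t)`. -/
def Nstar {d n : ℕ} (f : (Fin d → ℝ) → Fin n → ℝ) (θ : Fin n → ℝ)
    (Δ : Set (Fin d → ℝ)) (ε t : ℝ) : ℕ := (NstarSet f θ Δ ε t).ncard

/-- The set counted by `N_θ(Δ;ε,t)` (with `1 ≤ q ≤ e^t`). -/
def NfullSet {d n : ℕ} (f : (Fin d → ℝ) → Fin n → ℝ) (θ : Fin n → ℝ)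
    (Δ : Set (Fin d → ℝ)) (ε t : ℝ) : Set ((Fin n → ℤ) × ℤ) :=
  {pq | 1 ≤ pq.2 ∧ (pq.2 : ℝ) ≤ Real.exp t ∧
    sInf ((fun x => ‖(fun i => f x i - ((pq.1 i : ℝ) + θ i) / (pq.2 : ℝ) : Fin n → ℝ)‖) '' Δ)
      ≤ ε / Real.exp t}

/-- `N_θ(Δ;ε,t)`. -/
def Nfull {d n : ℕ} (f : (Fin d → ℝ) → Fin n → ℝ) (θ : Fin n → ℝ)
    (Δ : Set (Fin d → ℝ)) (ε t : ℝ) : ℕ := (NfullSet f θ Δ ε t).ncard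

/-- Sup norm of the gradient of a scalar function on `ℝ^d`. -/
def gradSupNorm {d : ℕ} (g : (Fin d → ℝ) → ℝ) (x : Fin d → ℝ) : ℝ :=
  ‖(fun j : Fin d => fderiv ℝ g x (Pi.single j 1) : Fin d → ℝ)‖

/-- The set `𝔖_f(δ,K,T)`. -/
def SfrakSet {d n : ℕ} (U : Set (Fin d → ℝ)) (f : (Fin d → ℝ) → Fin n → ℝ)
    (δ K : ℝ) (T : Fin n → ℝ) : Set (Fin d → ℝ) :=
  {x | x ∈ U ∧ ∃ a₀ : ℤ, ∃ a : Fin n → ℤ, a ≠ 0 ∧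
    |(a₀ : ℝ) + ∑ i, f x i * (a i : ℝ)| < δ ∧
    gradSupNorm (fun y => ∑ i, f y i * (a i : ℝ)) x < K ∧
    ∀ i, |(a i : ℝ)| < T i}

/-- First-order partial derivative `∂_i f_j` (0-based indices as naturals; junk value 0
out of range). -/
def pd1 {d m : ℕ} (f : (Fin d → ℝ) → Fin m → ℝ) (i j : ℕ) (x : Fin d → ℝ) : ℝ :=
  if h : i < d ∧ j < m then
    fderiv ℝ (fun y => f y ⟨j, h.2⟩) x (Pi.single (⟨i, h.1⟩ : Fin d) 1)
  else 0

/-- Second-order partial derivative `∂_{i'} ∂_i f_j`. -/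
def pd2 {d m : ℕ} (f : (Fin d → ℝ) → Fin m → ℝ) (i i' j : ℕ) (x : Fin d → ℝ) : ℝ :=
  if h : i' < d then fderiv ℝ (fun y => pd1 f i j y) x (Pi.single (⟨i', h⟩ : Fin d) 1) else 0

/-- The Monge map `x ↦ (x, f(x)) : ℝ^d → ℝ^{d+m}`. -/
def fullMap (d m : ℕ) (f : (Fin d → ℝ) → Fin m → ℝ) : (Fin d → ℝ) → Fin (d + m) → ℝ :=
  fun x i => if h : (i : ℕ) < d then x ⟨(i : ℕ), h⟩
    else f x ⟨(i : ℕ) - d, by have := i.isLt; omega⟩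

/-- The `i`-th Minkowski successive minimum (w.r.t. the closed unit Euclidean ball) of the
lattice `g ℤ^k`. -/
def succMin {k : ℕ} (i : ℕ) (g : Matrix (Fin k) (Fin k) ℝ) : ℝ :=
  sInf {r : ℝ | 0 ≤ r ∧ i ≤ Module.finrank ℝ
    (Submodule.span ℝ {w : Fin k → ℝ | (∃ v : Fin k → ℤ, v ≠ 0 ∧
      w = g.mulVec (fun j => (v j : ℝ))) ∧ Real.sqrt (∑ j, w j ^ 2) ≤ r})}

/-- The unipotent matrix `u₁(x) ∈ SL_{n+1}(ℝ)`, `n = d+m`. -/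
def u1Mat {d m : ℕ} (f : (Fin d → ℝ) → Fin m → ℝ) (x : Fin d → ℝ) :
    Matrix (Fin (d + m + 1)) (Fin (d + m + 1)) ℝ := fun r c =>
  if (r : ℕ) = (c : ℕ) then 1
  else if (r : ℕ) < m ∧ m ≤ (c : ℕ) ∧ (c : ℕ) < d + m then
    - pd1 f (d + m - 1 - (c : ℕ)) (m - 1 - (r : ℕ)) x
  else if (r : ℕ) < m ∧ (c : ℕ) = d + m then
    (if h : m - 1 - (r : ℕ) < m then f x ⟨m - 1 - (r : ℕ), h⟩ else 0)
      - ∑ i : Fin d, x i * pd1 f (i : ℕ) (m - 1 - (r : ℕ)) x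
  else if m ≤ (r : ℕ) ∧ (r : ℕ) < d + m ∧ (c : ℕ) = d + m then
    (if h : d + m - 1 - (r : ℕ) < d then x ⟨d + m - 1 - (r : ℕ), h⟩ else 0)
  else 0

/-- The inverse `a_{ε,t,v}⁻¹` of the diagonal matrix `a_{ε,t,v}`. -/
def aInvMat (d m : ℕ) (ε t v : ℝ) : Matrix (Fin (d + m + 1)) (Fin (d + m + 1)) ℝ :=
  Matrix.diagonal (fun i => v * (if (i : ℕ) < m then ε⁻¹
    else if (i : ℕ) < d + m then (ε ^ m * Real.exp t) ^ ((1 : ℝ) / d)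
    else (v ^ (d + m + 1) * Real.exp t)⁻¹))

/-- The set `𝔊(v,t,ε)`. -/
def Gfrak {d m : ℕ} (U : Set (Fin d → ℝ)) (f : (Fin d → ℝ) → Fin m → ℝ)
    (v t ε : ℝ) : Set (Fin d → ℝ) :=
  {x | x ∈ U ∧ v ≤ succMin 1 (aInvMat d m ε t v * u1Mat f x)}

/-- The set `𝒩_θ(t,ε,B)`. -/
def NCal {d m : ℕ} (f : (Fin d → ℝ) → Fin m → ℝ) (θ : Fin (d + m) → ℝ)
    (t : ℕ) (ε : ℝ) (B : Set (Fin d → ℝ)) : Set (ℕ × (Fin d → ℤ) × (Fin m → ℤ)) :=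
  {q | 0 < q.1 ∧
    (fun i => ((q.2.1 i : ℝ) + θ (Fin.castAdd m i)) / (q.1 : ℝ)) ∈ B ∧
    Real.exp ((t : ℝ) - 1) ≤ (q.1 : ℝ) ∧ (q.1 : ℝ) ≤ Real.exp t ∧
    ‖(fun j => (q.1 : ℝ) * f (fun i => ((q.2.1 i : ℝ) + θ (Fin.castAdd m i)) / (q.1 : ℝ)) j
        - θ (Fin.natAdd d j) - (q.2.2 j : ℝ) : Fin m → ℝ)‖ ≤ ε}

/-- The set `Δ_θ(t,ε,B,ρ)`. -/
def DeltaCal {d m : ℕ} (f : (Fin d → ℝ) → Fin m → ℝ) (θ : Fin (d + m) → ℝ)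
    (t : ℕ) (ε : ℝ) (B : Set (Fin d → ℝ)) (ρ : ℝ) : Set (Fin d → ℝ) :=
  ⋃ q ∈ NCal f θ t ε B,
    Metric.ball (fun i => ((q.2.1 i : ℝ) + θ (Fin.castAdd m i)) / (q.1 : ℝ)) ρ

/-- `φ = (ε^n e^t)^{1/(n+1)}`, `n = d+m`. -/
def phiC (d m : ℕ) (ε t : ℝ) : ℝ := (ε ^ (d + m) * Real.exp t) ^ ((1 : ℝ) / (d + m + 1))

/-- `h = dt/(2(n+1))`. -/
def hC (d m : ℕ) (t : ℝ) : ℝ := (d : ℝ) * t / (2 * ((d : ℝ) + m + 1))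

def gMat (d m : ℕ) (ε t : ℝ) : Matrix (Fin (d + m + 1)) (Fin (d + m + 1)) ℝ :=
  Matrix.diagonal (fun i => phiC d m ε t *
    (if (i : ℕ) < d + m then ε⁻¹ else Real.exp (-t)))

def bMat (d m : ℕ) (t : ℝ) : Matrix (Fin (d + m + 1)) (Fin (d + m + 1)) ℝ :=
  Matrix.diagonal (fun i => if (i : ℕ) < m then Real.exp (hC d m t)
    else if (i : ℕ) < d + m then Real.exp (-(((m : ℝ) + 1) * t) / (2 * ((d : ℝ) + m + 1)))
    else Real.exp (hC d m t))

def dMat (d m : ℕ) (ε : ℝ) : Matrix (Fin (d + m + 1)) (Fin (d + m + 1)) ℝ :=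
  Matrix.diagonal (fun i => if (i : ℕ) < m then 1
    else if (i : ℕ) < d + m then Real.sqrt ε else 1)

/-- The raw nongeneric set `𝔐₀(ε,t)`. -/
def M0frak {d m : ℕ} (U : Set (Fin d → ℝ)) (f : (Fin d → ℝ) → Fin m → ℝ)
    (ε t : ℝ) : Set (Fin d → ℝ) :=
  {x | x ∈ U ∧ phiC d m ε t * Real.exp (hC d m t) <
    succMin (d + m + 1) (dMat d m ε * bMat d m t * gMat d m ε t * u1Mat f x)}

/-- The nongeneric (special) set `𝔐(ε,t)`. -/
def Mfrak {d m : ℕ} (U : Set (Fin d → ℝ)) (f : (Fin d → ℝ) → Fin m → ℝ)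
    (ε t : ℝ) : Set (Fin d → ℝ) :=
  (⋃ x ∈ M0frak U f ε t, Metric.ball x (Real.sqrt ε * Real.exp (-t / 2))) ∩ U

/-- The inhomogeneous Diophantine exponent `λ_n^θ(x)` of `(x,x²,…,x^n)`, as a value
in `[0,∞]`. -/
def lambdaN (n : ℕ) (θ : Fin n → ℝ) (x : ℝ) : ℝ≥0∞ :=
  sSup {lam : ℝ≥0∞ | ∃ τ : ℝ, lam = ENNReal.ofReal τ ∧
    (fun i : Fin n => x ^ ((i : ℕ) + 1)) ∈ SApprox n θ (fun q => q ^ (-τ))}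

end

notation "cb" => Metric.closedBall
notation "oR" => ENNReal.ofReal
notation "Rv" d:max => Fin d → ℝ
notation "Mp" d:max m:max => (Fin d → ℝ) → Fin m → ℝ

noncomputable section P3

theorem p3_vol_cb {d : ℕ} (y : Rv d) {ρ : ℝ} (hρ : 0 ≤ ρ) :
    volume (cb y ρ) = oR ((2 * ρ) ^ d) := by
  rw [Real.volume_pi_closedBall _ hρ]; simp

theorem p3_vol_child {d : ℕ} (y y' : Rv d) {ρ : ℝ} (hρ : 0 ≤ ρ) :
    volume (cb y ρ) = 2 ^ d * volume (cb y' (ρ / 2)) := by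
  rw [p3_vol_cb _ hρ, p3_vol_cb _ (by positivity)]
  rw [show ((2:ℝ≥0∞) ^ d) = oR ((2:ℝ) ^ d) by
    rw [ENNReal.ofReal_pow (by norm_num)]; simp]
  rw [← ENNReal.ofReal_mul (by positivity), ← mul_pow]
  congr 2; ring

def p3ctr {d : ℕ} (y : Rv d) (ρ : ℝ) (e : Fin d → Bool) : Fin d → ℝ :=
  fun i => y i + (if e i then ρ / 2 else -(ρ / 2))

theorem p3_child_sub {d : ℕ} (y : Rv d) {ρ : ℝ} (hρ : 0 ≤ ρ) (e : Fin d → Bool) :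
    cb (p3ctr y ρ e) (ρ / 2) ⊆ cb y ρ := by
  intro x hx
  rw [Metric.mem_closedBall, dist_pi_le_iff (by positivity)] at hx ⊢
  intro i
  have := hx i
  rw [Real.dist_eq, abs_le] at this ⊢
  simp only [p3ctr] at this
  split_ifs at this <;> constructor <;> linarith [this.1, this.2]

theorem p3_cover {d : ℕ} (y : Rv d) {ρ : ℝ} (hρ : 0 ≤ ρ) :
    cb y ρ ⊆ ⋃ e : Fin d → Bool, cb (p3ctr y ρ e) (ρ / 2) := by
  intro x hx
  rw [Set.mem_iUnion]
  refine ⟨fun i => decide (y i ≤ x i), ?_⟩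
  rw [Metric.mem_closedBall, dist_pi_le_iff (by positivity)] at hx ⊢
  intro i
  have := hx i
  rw [Real.dist_eq, abs_le] at this ⊢
  simp only [p3ctr, decide_eq_true_eq]
  split_ifs with h <;> constructor <;> linarith [this.1, this.2]

def p3c (d : ℕ) : ℕ → ℝ≥0∞
  | 0 => 0
  | k + 1 => 2 ^ d * (1 + 2 * p3c d k)

theorem p3c_ne_top (d k : ℕ) : p3c d k ≠ ⊤ := by
  induction k with
  | zero => simp [p3c]
  | succ k ih =>
    simp only [p3c]
    apply ENNReal.mul_ne_top (by simp)
    apply ENNReal.add_ne_top.2 ⟨by simp, ENNReal.mul_ne_top (by simp) ih⟩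

variable {d : ℕ} {V : Type*} [AddCommGroup V] [Module ℚ V]

def p3T (Z : Set V) (N : (Rv d) → V → ℝ)
    (ψ : Submodule ℚ V → (Rv d) → ℝ) (C1 C2 c3 : ℝ) (Δ Δ' : Submodule ℚ V)
    (y : Rv d) (ρ : ℝ) : Set (Rv d) :=
  {x | x ∈ cb y ρ ∧ ψ Δ x ≤ C2 ∧ c3 ≤ ψ Δ' x ∧
    ∃ v ∈ Z, v ∈ Δ' ∧ v ∉ Δ ∧ C1 * C2 * N x v < c3}

theorem p3_main [FiniteDimensional ℚ V] (Z : Set V) (N : (Rv d) → V → ℝ)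
    (ψ : Submodule ℚ V → (Rv d) → ℝ)
    (Big : (Rv d) → ℝ → Submodule ℚ V → Prop) (C1 C2 c3 : ℝ) (κ : ℝ≥0∞)
    (z : Rv d) (r : ℝ) (hC1 : 0 ≤ C1)
    (hN : ∀ x v, 0 ≤ N x v)
    (H1 : ∀ x ∈ cb z r, ∀ W : Submodule ℚ V, ∀ v ∈ Z, v ∉ W →
      ψ (W ⊔ Submodule.span ℚ {v}) x ≤ C1 * ψ W x * N x v)
    (H2 : ∀ y ρ y' W, 0 < ρ → cb y ρ ⊆ cb z r →
      cb y' (ρ / 2) ⊆ cb y ρ → W ≠ ⊥ → W ≠ ⊤ →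
      Big y ρ W → ¬ Big y' (ρ / 2) W →
      (∀ x ∈ cb y' (ρ / 2), ψ W x ≤ C2) ∧
      volume {x | x ∈ cb y ρ ∧ ψ W x < c3} ≤ κ * volume (cb y ρ))
    (H3 : ∀ x ∈ cb z r, ∀ W, W ≠ ⊥ → W ≠ ⊤ → ψ W x < c3 →
      ∃ s > 0, ∀ y ρ, 0 < ρ → ρ ≤ s → x ∈ cb y ρ →
        cb y ρ ⊆ cb z r → ¬ Big y ρ W)
    (k : ℕ) : ∀ (Δ Δ' : Submodule ℚ V), Δ < Δ' →
      Module.finrank ℚ Δ' ≤ Module.finrank ℚ Δ + k →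
      ∀ y ρ, 0 < ρ → cb y ρ ⊆ cb z r →
      (∀ Γ, Δ < Γ → Γ < Δ' → Big y ρ Γ) →
      volume (p3T Z N ψ C1 C2 c3 Δ Δ' y ρ) ≤ p3c d k * κ * volume (cb y ρ) := by
  induction k with
  | zero =>
    intro Δ Δ' h hr
    exact absurd (Submodule.finrank_lt_finrank_of_lt h) (by omega)
  | succ k ih =>
    intro Δ Δ' hlt hr
    let X : ℝ → Set (Rv d) := fun s => {x | ∃ Γ, Δ < Γ ∧ Γ < Δ' ∧
      ∀ y ρ, 0 < ρ → ρ ≤ s → x ∈ cb y ρ →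
        cb y ρ ⊆ cb z r → ¬ Big y ρ Γ}
    have key : ∀ s : ℝ, 0 < s → ∀ n : ℕ, ∀ y ρ, 0 < ρ → ρ ≤ 2 ^ n * s →
        cb y ρ ⊆ cb z r →
        (∀ Γ, Δ < Γ → Γ < Δ' → Big y ρ Γ) →
        volume (p3T Z N ψ C1 C2 c3 Δ Δ' y ρ ∩ X s) ≤
          p3c d (k+1) * κ * volume (cb y ρ) := by
      intro s hs n
      induction n with
      | zero =>
        intro y ρ hρ hρs hQ hB
        have : p3T Z N ψ C1 C2 c3 Δ Δ' y ρ ∩ X s = ∅ := by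
          ext x
          simp only [Set.mem_inter_iff, Set.mem_empty_iff_false, iff_false, not_and]
          rintro hx ⟨Γ, h1, h2, h3⟩
          exact h3 y ρ hρ (by simpa using hρs) hx.1 hQ (hB Γ h1 h2)
        rw [this]; simp
      | succ n ihn =>
        intro y ρ hρ hρs hQ hB
        have hchild : ∀ e : Fin d → Bool,
            volume ((p3T Z N ψ C1 C2 c3 Δ Δ' y ρ ∩ X s) ∩
              cb (p3ctr y ρ e) (ρ / 2)) ≤
            p3c d (k+1) * κ * volume (cb (p3ctr y ρ e) (ρ / 2)) := by
          intro e
          have hsub := p3_child_sub y hρ.le e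
          by_cases hall : ∀ Γ, Δ < Γ → Γ < Δ' → Big (p3ctr y ρ e) (ρ / 2) Γ
          · refine le_trans (measure_mono ?_) (ihn (p3ctr y ρ e) (ρ / 2) (by positivity)
              (by rw [pow_succ] at hρs; linarith) (hsub.trans hQ) hall)
            rintro x ⟨⟨hx, hxX⟩, hxc⟩
            exact ⟨⟨hxc, hx.2⟩, hxX⟩
          · push Not at hall
            obtain ⟨Γ, h1, h2, h3⟩ := hall
            have hΓb : Γ ≠ ⊥ := (lt_of_le_of_lt bot_le h1).ne'
            have hΓt : Γ ≠ ⊤ := (lt_of_lt_of_le h2 le_top).ne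
            obtain ⟨ha, hb⟩ := H2 y ρ (p3ctr y ρ e) Γ hρ hQ hsub hΓb hΓt (hB Γ h1 h2) h3
            have f1 := Submodule.finrank_lt_finrank_of_lt h1
            have f2 := Submodule.finrank_lt_finrank_of_lt h2
            have g1 := ih Δ Γ h1 (by omega) y ρ hρ hQ
              (fun G hG hG' => hB G hG (hG'.trans h2))
            have g2 := ih Γ Δ' h2 (by omega) y ρ hρ hQ
              (fun G hG hG' => hB G (h1.trans hG) hG')
            have hsubset : (p3T Z N ψ C1 C2 c3 Δ Δ' y ρ ∩ X s) ∩
                cb (p3ctr y ρ e) (ρ / 2) ⊆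
                {x | x ∈ cb y ρ ∧ ψ Γ x < c3} ∪
                (p3T Z N ψ C1 C2 c3 Δ Γ y ρ ∪ p3T Z N ψ C1 C2 c3 Γ Δ' y ρ) := by
              rintro x ⟨⟨⟨hxq, hx2, hx3, v, hvZ, hv1, hv2, hv3⟩, -⟩, hxc⟩
              by_cases hlt3 : ψ Γ x < c3
              · exact Or.inl ⟨hxq, hlt3⟩
              · right
                push Not at hlt3
                by_cases hvΓ : v ∈ Γ
                · exact Or.inl ⟨hxq, hx2, hlt3, v, hvZ, hvΓ, hv2, hv3⟩
                · exact Or.inr ⟨hxq, ha x hxc, hx3, v, hvZ, hv1, hvΓ, hv3⟩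
            calc _ ≤ κ * volume (cb y ρ) +
                (p3c d k * κ * volume (cb y ρ) +
                  p3c d k * κ * volume (cb y ρ)) := by
                  refine (measure_mono hsubset).trans ((measure_union_le _ _).trans ?_)
                  exact add_le_add hb ((measure_union_le _ _).trans (add_le_add g1 g2))
              _ = p3c d (k+1) * κ * volume (cb (p3ctr y ρ e) (ρ / 2)) := by
                  rw [p3_vol_child y (p3ctr y ρ e) hρ.le]
                  simp only [p3c]; ring
        calc _ ≤ volume (⋃ e : Fin d → Bool, (p3T Z N ψ C1 C2 c3 Δ Δ' y ρ ∩ X s) ∩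
              cb (p3ctr y ρ e) (ρ / 2)) := by
              apply measure_mono
              intro x hx
              have := p3_cover y hρ.le hx.1.1
              rw [Set.mem_iUnion] at this ⊢
              obtain ⟨e, he⟩ := this
              exact ⟨e, hx, he⟩
          _ ≤ ∑ e : Fin d → Bool, volume ((p3T Z N ψ C1 C2 c3 Δ Δ' y ρ ∩ X s) ∩
              cb (p3ctr y ρ e) (ρ / 2)) := measure_iUnion_fintype_le _ _
          _ ≤ ∑ e : Fin d → Bool, p3c d (k+1) * κ *
              volume (cb y (ρ / 2)) := by
              apply Finset.sum_le_sum
              intro e _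
              refine (hchild e).trans (le_of_eq ?_)
              rw [p3_vol_cb _ (by positivity), p3_vol_cb _ (by positivity)]
          _ = _ := by
              rw [p3_vol_child y y hρ.le]
              simp; ring
    intro y ρ hρ hQ hB
    have hU : p3T Z N ψ C1 C2 c3 Δ Δ' y ρ ⊆
        ⋃ j : ℕ, (p3T Z N ψ C1 C2 c3 Δ Δ' y ρ ∩ X (1 / ((j:ℝ) + 1))) := by
      intro x hx
      obtain ⟨hxq, hx2, hx3, v, hvZ, hv1, hv2, hv3⟩ := hx
      have hC2 : ψ (Δ ⊔ Submodule.span ℚ {v}) x < c3 := by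
        refine lt_of_le_of_lt (H1 x (hQ hxq) Δ v hvZ hv2) (lt_of_le_of_lt ?_ hv3)
        gcongr
        exact hN _ _
      have hl : Δ < Δ ⊔ Submodule.span ℚ {v} := by
        refine lt_of_le_of_ne le_sup_left ?_
        intro h
        apply hv2
        rw [h]
        exact Submodule.mem_sup_right (Submodule.mem_span_singleton_self v)
      have hl2 : Δ ⊔ Submodule.span ℚ {v} < Δ' := by
        refine lt_of_le_of_ne (sup_le hlt.le ?_) ?_
        · rw [Submodule.span_singleton_le_iff_mem]; exact hv1
        · intro h
          rw [h] at hC2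
          linarith
      obtain ⟨s, hs, hs'⟩ := H3 x (hQ hxq) _ (lt_of_le_of_lt bot_le hl).ne'
        (lt_of_lt_of_le hl2 le_top).ne hC2
      obtain ⟨j, hj⟩ := exists_nat_one_div_lt hs
      rw [Set.mem_iUnion]
      refine ⟨j, ⟨hxq, hx2, hx3, v, hvZ, hv1, hv2, hv3⟩, _, hl, hl2, ?_⟩
      intro y' ρ' h1 h2
      exact hs' y' ρ' h1 (h2.trans hj.le)
    have hmono : Monotone fun j : ℕ => (p3T Z N ψ C1 C2 c3 Δ Δ' y ρ ∩ X (1 / ((j:ℝ) + 1))) := by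
      intro i j hij x hx
      obtain ⟨hx, Γ, h1, h2, h3⟩ := hx
      refine ⟨hx, Γ, h1, h2, fun y' ρ' g1 g2 => h3 y' ρ' g1 (g2.trans ?_)⟩
      have : (i:ℝ) ≤ j := by exact_mod_cast hij
      apply one_div_le_one_div_of_le (by positivity); linarith
    refine (measure_mono hU).trans ?_
    rw [hmono.measure_iUnion]
    apply iSup_le
    intro j
    obtain ⟨n, hn⟩ := pow_unbounded_of_one_lt (ρ / (1 / ((j:ℝ) + 1))) (one_lt_two)
    refine key _ (by positivity) n y ρ hρ ?_ hQ hB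
    rw [div_lt_iff₀ (by positivity)] at hn
    exact hn.le

theorem p3_nondiv [FiniteDimensional ℚ V] (Z : Set V) (N : (Rv d) → V → ℝ)
    (ψ : Submodule ℚ V → (Rv d) → ℝ)
    (Big : (Rv d) → ℝ → Submodule ℚ V → Prop) (C1 C2 c3 : ℝ) (κ : ℝ≥0∞)
    (z : Rv d) (r : ℝ) (hr : 0 < r) (hC1 : 0 ≤ C1)
    (hN : ∀ x v, 0 ≤ N x v)
    (H1 : ∀ x ∈ cb z r, ∀ W : Submodule ℚ V, ∀ v ∈ Z, v ∉ W →
      ψ (W ⊔ Submodule.span ℚ {v}) x ≤ C1 * ψ W x * N x v)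
    (H2 : ∀ y ρ y' W, 0 < ρ → cb y ρ ⊆ cb z r →
      cb y' (ρ / 2) ⊆ cb y ρ → W ≠ ⊥ → W ≠ ⊤ →
      Big y ρ W → ¬ Big y' (ρ / 2) W →
      (∀ x ∈ cb y' (ρ / 2), ψ W x ≤ C2) ∧
      volume {x | x ∈ cb y ρ ∧ ψ W x < c3} ≤ κ * volume (cb y ρ))
    (H3 : ∀ x ∈ cb z r, ∀ W, W ≠ ⊥ → W ≠ ⊤ → ψ W x < c3 →
      ∃ s > 0, ∀ y ρ, 0 < ρ → ρ ≤ s → x ∈ cb y ρ →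
        cb y ρ ⊆ cb z r → ¬ Big y ρ W)
    (H4 : ∀ W, W ≠ ⊥ → W ≠ ⊤ → Big z r W)
    (Hbot : ∀ x ∈ cb z r, ψ ⊥ x ≤ C2)
    (Htop : ∀ x ∈ cb z r, c3 ≤ ψ ⊤ x) :
    volume {x | x ∈ cb z r ∧ ∃ v ∈ Z, v ≠ 0 ∧ C1 * C2 * N x v < c3} ≤
      p3c d (Module.finrank ℚ V) * κ * volume (cb z r) := by
  by_cases hbt : (⊥ : Submodule ℚ V) = ⊤
  · have : {x | x ∈ cb z r ∧ ∃ v ∈ Z, v ≠ 0 ∧ C1 * C2 * N x v < c3} = ∅ := by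
      ext x
      simp only [Set.mem_ofPred_eq, Set.mem_empty_iff_false, iff_false]
      rintro ⟨-, v, -, hv, -⟩
      apply hv
      have : v ∈ (⊤ : Submodule ℚ V) := trivial
      rw [← hbt] at this
      simpa using this
    rw [this]; simp
  · refine le_trans (measure_mono ?_) (p3_main Z N ψ Big C1 C2 c3 κ z r hC1 hN H1 H2 H3
      (Module.finrank ℚ V) ⊥ ⊤ (lt_of_le_of_ne bot_le hbt) (by simp) z r hr subset_rfl
      (fun Γ h1 h2 => H4 Γ h1.ne' h2.ne))
    rintro x ⟨hx, v, hvZ, hv, hv'⟩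
    exact ⟨hx, Hbot x hx, Htop x hx, v, hvZ, trivial, by simpa using hv, hv'⟩

end P3

noncomputable section P4

set_option linter.unusedSectionVars false

variable {ι : Type*} [Fintype ι] [DecidableEq ι]

def psi {r : ℕ} (X : Matrix ι (Fin r) ℝ) : ℝ :=
  ∑ σ : Fin r → ι, |(X.submatrix σ id).det|

theorem psi_nonneg {r : ℕ} (X : Matrix ι (Fin r) ℝ) : 0 ≤ psi X :=
  Finset.sum_nonneg fun _ _ => abs_nonneg _

theorem minor_le_psi {r : ℕ} (X : Matrix ι (Fin r) ℝ) (σ : Fin r → ι) :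
    |(X.submatrix σ id).det| ≤ psi X :=
  Finset.single_le_sum (f := fun σ : Fin r → ι => |(X.submatrix σ id).det|)
    (fun _ _ => abs_nonneg _) (Finset.mem_univ σ)

theorem psi_le {r : ℕ} (X : Matrix ι (Fin r) ℝ) (c : ℝ)
    (h : ∀ σ, |(X.submatrix σ id).det| ≤ c) : psi X ≤ (Fintype.card ι : ℝ) ^ r * c := by
  unfold psi
  refine (Finset.sum_le_sum fun σ _ => h σ).trans ?_
  simp

theorem exists_minor_of_psi {r : ℕ} (X : Matrix ι (Fin r) ℝ) (c : ℝ)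
    (h : (Fintype.card ι : ℝ) ^ r * c < psi X) :
    ∃ σ, c < |(X.submatrix σ id).det| := by
  by_contra hh
  push Not at hh
  exact absurd (psi_le X c hh) (by linarith)

theorem psi_mul_right {r : ℕ} (X : Matrix ι (Fin r) ℝ) (P : Matrix (Fin r) (Fin r) ℝ) :
    psi (X * P) = |P.det| * psi X := by
  unfold psi
  rw [Finset.mul_sum]
  apply Finset.sum_congr rfl
  intro σ _
  have : (X * P).submatrix σ id = (X.submatrix σ id) * P := by
    ext i j; simp [Matrix.mul_apply]
  rw [this, Matrix.det_mul, abs_mul, mul_comm]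

theorem det_mul_expand {r : ℕ} (T : Matrix (Fin r) ι ℝ) (X : Matrix ι (Fin r) ℝ) :
    (T * X).det = ∑ τ : Fin r → ι, (∏ k, T k (τ k)) * (X.submatrix τ id).det := by
  have h : (T * X).det = Matrix.detRowAlternating (fun k => ∑ i, T k i • X i) := by
    change (T * X).det = Matrix.det _
    congr 1
    ext k j
    simp [Matrix.mul_apply, Finset.sum_apply]
  rw [h]
  rw [show (Matrix.detRowAlternating (fun k : Fin r => ∑ i, T k i • X i) : ℝ) =
    (Matrix.detRowAlternating : (Rv r) [⋀^Fin r]→ₗ[ℝ] ℝ).toMultilinearMap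
      (fun k : Fin r => ∑ i, T k i • X i) from rfl]
  rw [MultilinearMap.map_sum]
  apply Finset.sum_congr rfl
  intro τ _
  rw [MultilinearMap.map_smul_univ]
  rfl

theorem abs_det_mul_le {r : ℕ} (T : Matrix (Fin r) ι ℝ) (X : Matrix ι (Fin r) ℝ) (c : ℝ)
    (hT : ∀ k i, |T k i| ≤ c) : |(T * X).det| ≤ c ^ r * psi X := by
  rw [det_mul_expand]
  refine (Finset.abs_sum_le_sum_abs _ _).trans ?_
  unfold psi
  rw [Finset.mul_sum]
  apply Finset.sum_le_sum
  intro τ _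
  rw [abs_mul, Finset.abs_prod]
  gcongr
  refine (Finset.prod_le_prod (fun _ _ => abs_nonneg _) (fun k _ => hT k (τ k))).trans ?_
  simp

theorem psi_snoc {r : ℕ} (X : Matrix ι (Fin (r+1)) ℝ) :
    psi X ≤ (Fintype.card ι : ℝ) ^ (r+1) * (((r:ℝ) + 1) *
      (psi (X.submatrix id Fin.castSucc) * ‖fun i => X i (Fin.last r)‖)) := by
  apply psi_le
  intro σ
  rw [Matrix.det_succ_column _ (Fin.last r)]
  refine (Finset.abs_sum_le_sum_abs _ _).trans ?_
  have : ∀ k : Fin (r+1), |(-1:ℝ) ^ ((k:ℕ) + (Fin.last r : ℕ)) * X.submatrix σ id k (Fin.last r) *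
      ((X.submatrix σ id).submatrix k.succAbove (Fin.last r).succAbove).det| ≤
      psi (X.submatrix id Fin.castSucc) * ‖fun i => X i (Fin.last r)‖ := by
    intro k
    rw [abs_mul, abs_mul, abs_pow, abs_neg, abs_one, one_pow, one_mul, mul_comm]
    refine mul_le_mul ?_ ?_ (abs_nonneg _) (psi_nonneg _)
    · have := minor_le_psi (X.submatrix id Fin.castSucc) (σ ∘ k.succAbove)
      refine le_trans (le_of_eq ?_) this
      congr 2
      ext i j
      simp
    · have := norm_le_pi_norm (fun i => X i (Fin.last r)) (σ k)
      simpa using this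
  refine (Finset.sum_le_sum fun k _ => this k).trans ?_
  simp

def qv {r : ℕ} (B : Matrix ι (Fin r) ℤ) : Fin r → ι → ℚ := fun l i => (B i l : ℚ)

def rm {r : ℕ} (B : Matrix ι (Fin r) ℤ) : Matrix ι (Fin r) ℝ := B.map (fun z : ℤ => (z : ℝ))

def IsTup {r : ℕ} (W : Submodule ℚ (ι → ℚ)) (B : Matrix ι (Fin r) ℤ) : Prop :=
  r = Module.finrank ℚ W ∧ (∀ l, qv B l ∈ W) ∧ LinearIndependent ℚ (qv B)

theorem qv_exists_minor {r : ℕ} (B : Matrix ι (Fin r) ℤ) (h : LinearIndependent ℚ (qv B)) :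
    ∃ σ : Fin r → ι, (B.submatrix σ id).det ≠ 0 := by
  let Q : Matrix ι (Fin r) ℚ := B.map (fun z : ℤ => (z : ℚ))
  have hr : Q.rank = r := by
    rw [← Matrix.rank_transpose]
    have := LinearIndependent.rank_matrix (M := Q.transpose) h
    simpa using this
  have hr2 : Module.finrank ℚ (Submodule.span ℚ (Set.range Q.row)) = r := by
    rw [← Matrix.rank_eq_finrank_span_row]; exact hr
  have h4 := Submodule.exists_fun_fin_finrank_span_eq ℚ (Set.range Q.row)
  rw [hr2] at h4
  obtain ⟨f, hf1, hf2, hf3⟩ := h4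
  choose σ hσ using hf1
  refine ⟨σ, ?_⟩
  have h5 : LinearIndependent ℚ (Q.submatrix σ id).row := by
    have h6 : (Q.submatrix σ id).row = f := by
      ext k j
      rw [← hσ k]; rfl
    rw [h6]; exact hf3
  rw [Matrix.linearIndependent_rows_iff_isUnit, Matrix.isUnit_iff_isUnit_det] at h5
  have h6 : (Q.submatrix σ id).det = ((B.submatrix σ id).det : ℚ) := by
    rw [Int.cast_det]; rfl
  intro h7
  rw [h6, h7] at h5
  simp at h5

theorem tup_exists (W : Submodule ℚ (ι → ℚ)) :
    ∃ B : Matrix ι (Fin (Module.finrank ℚ W)) ℤ, IsTup W B := by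
  let c := Module.finBasis ℚ W
  obtain ⟨⟨k, hk⟩, hk'⟩ := IsLocalization.exist_integer_multiples_of_finite (nonZeroDivisors ℤ)
    (fun p : Fin (Module.finrank ℚ W) × ι => ((c p.1 : ι → ℚ) p.2))
  have hk0 : (k:ℚ) ≠ 0 := by
    have := nonZeroDivisors.ne_zero hk
    exact_mod_cast this
  choose g hg using hk'
  refine ⟨fun i l => g (l, i), rfl, ?_⟩
  have hq : ∀ l, qv (fun i l => g (l, i)) l = (k:ℚ) • (c l : ι → ℚ) := by
    intro l
    ext i
    have := hg (l, i)
    simp only [qv, Pi.smul_apply, smul_eq_mul]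
    simpa using this
  constructor
  · intro l
    rw [hq]
    exact W.smul_mem _ (c l).2
  · have h1 : LinearIndependent ℚ (fun l => (c l : ι → ℚ)) :=
      c.linearIndependent.map' W.subtype (by simp)
    have h2 := h1.units_smul (fun _ => Units.mk0 (k:ℚ) hk0)
    convert h2 using 1
    ext l i
    rw [hq]; rfl

def mu {r : ℕ} (B : Matrix ι (Fin r) ℤ) : ℕ :=
  ∑ σ : Fin r → ι, (B.submatrix σ id).det.natAbs

theorem mu_cast {r : ℕ} (B : Matrix ι (Fin r) ℤ) : (mu B : ℝ) = psi (rm B) := by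
  unfold mu psi rm
  push_cast
  apply Finset.sum_congr rfl
  intro σ _
  rw [Nat.cast_natAbs, Int.cast_abs, Int.cast_det]; rfl

theorem mu_pos {r : ℕ} (B : Matrix ι (Fin r) ℤ) (h : LinearIndependent ℚ (qv B)) : 0 < mu B := by
  obtain ⟨σ, hσ⟩ := qv_exists_minor B h
  have : (B.submatrix σ id).det.natAbs ≤ mu B :=
    Finset.single_le_sum (f := fun σ : Fin r → ι => (B.submatrix σ id).det.natAbs)
    (fun _ _ => Nat.zero_le _) (Finset.mem_univ σ)
  have h2 : 0 < (B.submatrix σ id).det.natAbs := Int.natAbs_pos.2 hσ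
  omega

theorem tup_min_exists (W : Submodule ℚ (ι → ℚ)) :
    ∃ B : Matrix ι (Fin (Module.finrank ℚ W)) ℤ, IsTup W B ∧
      ∀ B' : Matrix ι (Fin (Module.finrank ℚ W)) ℤ, IsTup W B' → mu B ≤ mu B' := by
  classical
  obtain ⟨B0, h0⟩ := tup_exists W
  have hne : ∃ n : ℕ, ∃ B : Matrix ι (Fin (Module.finrank ℚ W)) ℤ, IsTup W B ∧ mu B = n :=
    ⟨_, B0, h0, rfl⟩
  obtain ⟨B, hB, hB'⟩ := Nat.find_spec hne
  refine ⟨B, hB, fun B' hB'' => ?_⟩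
  rw [hB']
  exact Nat.find_min' hne ⟨B', hB'', rfl⟩

def tup (W : Submodule ℚ (ι → ℚ)) : Matrix ι (Fin (Module.finrank ℚ W)) ℤ :=
  (tup_min_exists W).choose

theorem tup_isTup (W : Submodule ℚ (ι → ℚ)) : IsTup W (tup W) :=
  (tup_min_exists W).choose_spec.1

theorem psi_tup_le (W : Submodule ℚ (ι → ℚ)) (M : Matrix ι ι ℝ) {r : ℕ}
    (B' : Matrix ι (Fin r) ℤ) (h : IsTup W B') :
    psi (M * rm (tup W)) ≤ psi (M * rm B') := by
  obtain ⟨hr, h2, h3⟩ := h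
  subst hr
  obtain ⟨-, g2, g3⟩ := tup_isTup W
  have hmin := (tup_min_exists W).choose_spec.2 B' ⟨rfl, h2, h3⟩
  change mu (tup W) ≤ mu B' at hmin
  have hspan : Submodule.span ℚ (Set.range (qv (tup W))) = W := by
    apply Submodule.eq_of_le_of_finrank_eq
    · rw [Submodule.span_le]; rintro _ ⟨l, rfl⟩; exact g2 l
    · rw [finrank_span_eq_card g3]; simp
  have hP : ∀ l, ∃ p : Fin (Module.finrank ℚ W) → ℚ, ∑ k, p k • qv (tup W) k = qv B' l := by
    intro l
    have h9 := (le_of_eq hspan.symm) (h2 l)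
    rw [Submodule.mem_span_range_iff_exists_fun] at h9
    exact h9
  choose p hp using hP
  let P : Matrix (Fin (Module.finrank ℚ W)) (Fin (Module.finrank ℚ W)) ℝ :=
    Matrix.of fun k l => ((p l k : ℚ) : ℝ)
  have hB : rm B' = rm (tup W) * P := by
    ext i l
    have := congrFun (hp l) i
    simp only [qv, Finset.sum_apply, Pi.smul_apply, smul_eq_mul] at this
    have h5 : (((B' i l : ℤ) : ℚ) : ℝ) = ((∑ k, p l k * ((tup W i k : ℤ) : ℚ) : ℚ) : ℝ) := by
      rw [this]
    push_cast at h5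
    simp only [rm, Matrix.map_apply, Matrix.mul_apply, P, Matrix.of_apply]
    rw [h5]
    apply Finset.sum_congr rfl
    intro k _
    ring
  have h1 : psi (rm B') = |P.det| * psi (rm (tup W)) := by rw [hB, psi_mul_right]
  rw [← mu_cast, ← mu_cast] at h1
  have hpos : (0:ℝ) < mu (tup W) := by exact_mod_cast mu_pos _ g3
  have hdet : 1 ≤ |P.det| := by
    have h6 : (mu (tup W) : ℝ) ≤ mu B' := by exact_mod_cast hmin
    rw [h1] at h6
    by_contra hlt
    push Not at hlt
    nlinarith
  rw [hB, ← Matrix.mul_assoc, psi_mul_right]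
  exact le_mul_of_one_le_left (psi_nonneg _) hdet

def castv (v : ι → ℤ) : ι → ℚ := fun i => (v i : ℚ)

theorem tup_H1 (W : Submodule ℚ (ι → ℚ)) (M : Matrix ι ι ℝ) (v : ι → ℤ) (hv : castv v ∉ W) :
    psi (M * rm (tup (W ⊔ Submodule.span ℚ {castv v}))) ≤
      ((Fintype.card ι : ℝ) ^ (Fintype.card ι + 1)) * psi (M * rm (tup W)) *
        ‖M.mulVec (fun i => (v i : ℝ))‖ := by
  set r := Module.finrank ℚ W with hr
  let B' : Matrix ι (Fin (r+1)) ℤ := Matrix.of fun i => Fin.snoc (fun l => tup W i l) (v i)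
  obtain ⟨-, g2, g3⟩ := tup_isTup W
  have hqv : qv B' = Fin.snoc (qv (tup W)) (castv v) := by
    ext l i
    refine Fin.lastCases ?_ (fun l => ?_) l
    · simp [qv, B', castv]
    · simp [qv, B']
  have hspan : Submodule.span ℚ (Set.range (qv (tup W))) = W := by
    apply Submodule.eq_of_le_of_finrank_eq
    · rw [Submodule.span_le]; rintro _ ⟨l, rfl⟩; exact g2 l
    · rw [finrank_span_eq_card g3]; simp
  have hli : LinearIndependent ℚ (qv B') := by
    rw [hqv, linearIndependent_finSnoc]
    refine ⟨g3, ?_⟩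
    rw [hspan]; exact hv
  have hspan' : Submodule.span ℚ (Set.range (qv B')) = W ⊔ Submodule.span ℚ {castv v} := by
    rw [hqv, Fin.range_snoc, Submodule.span_insert, hspan, sup_comm]
  have hcard := finrank_span_eq_card hli
  rw [hspan'] at hcard
  have htup : IsTup (W ⊔ Submodule.span ℚ {castv v}) B' := by
    refine ⟨by rw [hcard]; simp, ?_, hli⟩
    intro l
    rw [← hspan']
    exact Submodule.subset_span ⟨l, rfl⟩
  have hrle : r + 1 ≤ Fintype.card ι := by
    have := Submodule.finrank_le (W ⊔ Submodule.span ℚ {castv v})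
    rw [hcard] at this
    simpa using this
  refine (psi_tup_le _ M B' htup).trans ((psi_snoc _).trans ?_)
  have e1 : (M * rm B').submatrix id Fin.castSucc = M * rm (tup W) := by
    ext i l
    simp [Matrix.mul_apply, rm, B']
  have e2 : (fun i => (M * rm B') i (Fin.last r)) = M.mulVec (fun i => (v i : ℝ)) := by
    ext i
    simp [Matrix.mul_apply, Matrix.mulVec, dotProduct, rm, B']
  rw [e1, e2]
  have c1 : (1:ℝ) ≤ Fintype.card ι := by
    have : 1 ≤ Fintype.card ι := by omega
    exact_mod_cast this
  have c2 : ((r:ℝ) + 1) ≤ Fintype.card ι := by exact_mod_cast hrle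
  have c3 : (Fintype.card ι : ℝ) ^ (r+1) ≤ (Fintype.card ι : ℝ) ^ (Fintype.card ι) :=
    pow_le_pow_right₀ c1 hrle
  have := psi_nonneg (M * rm (tup W))
  have h9 : (Fintype.card ι : ℝ) ^ (r+1) * ((r:ℝ)+1) ≤ (Fintype.card ι : ℝ) ^ (Fintype.card ι + 1) := by
    rw [pow_succ (Fintype.card ι : ℝ) (Fintype.card ι)]
    gcongr
  calc _ = ((Fintype.card ι : ℝ) ^ (r+1) * ((r:ℝ)+1)) *
        (psi (M * rm (tup W)) * ‖M.mulVec (fun i => (v i : ℝ))‖) := by ring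
    _ ≤ (Fintype.card ι : ℝ) ^ (Fintype.card ι + 1) *
        (psi (M * rm (tup W)) * ‖M.mulVec (fun i => (v i : ℝ))‖) := by gcongr
    _ = _ := by ring

theorem psi_zero (X : Matrix ι (Fin 0) ℝ) : psi X = 1 := by
  simp [psi]

theorem psi_of_eq_zero {r : ℕ} (hr : r = 0) (X : Matrix ι (Fin r) ℝ) : psi X = 1 := by
  subst hr; exact psi_zero X

theorem psi_bot (M : Matrix ι ι ℝ) : psi (M * rm (tup (⊥ : Submodule ℚ (ι → ℚ)))) = 1 :=
  psi_of_eq_zero (by simp) _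

theorem psi_full {r : ℕ} (hr : r = Fintype.card ι) (M : Matrix ι ι ℝ) (hM : |M.det| = 1)
    (B : Matrix ι (Fin r) ℤ) (hB : LinearIndependent ℚ (qv B)) : 1 ≤ psi (M * rm B) := by
  obtain ⟨σ, hσ⟩ := qv_exists_minor B hB
  have hinj : Function.Injective σ := by
    intro a b hab
    by_contra hne
    exact hσ (Matrix.det_zero_of_row_eq hne (by ext j; simp [hab]))
  have hbij : Function.Bijective σ := by
    rw [Fintype.bijective_iff_injective_and_card]
    exact ⟨hinj, by simpa using hr⟩
  let e : Fin r ≃ ι := Equiv.ofBijective σ hbij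
  refine le_trans ?_ (minor_le_psi _ σ)
  have h1 : (M * rm B).submatrix σ id = M.submatrix e e * (rm B).submatrix e id := by
    ext i j
    simp only [Matrix.submatrix_apply, Matrix.mul_apply, id]
    exact (Equiv.sum_comp e (fun k => M (σ i) k * rm B k j)).symm
  have h2 : ((rm B).submatrix e id).det = (((B.submatrix σ id).det : ℤ) : ℝ) := by
    rw [Int.cast_det]; rfl
  rw [h1, Matrix.det_mul, Matrix.det_submatrix_equiv_self, abs_mul, hM, one_mul, h2]
  have h3 : 1 ≤ |(B.submatrix σ id).det| := Int.one_le_abs hσ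
  exact_mod_cast h3

theorem psi_top (M : Matrix ι ι ℝ) (hM : |M.det| = 1) :
    1 ≤ psi (M * rm (tup (⊤ : Submodule ℚ (ι → ℚ)))) :=
  psi_full (by simp) M hM _ (tup_isTup _).2.2

end P4

noncomputable section P1

variable {d : ℕ}

def ev (i : Fin d) : Fin d → ℝ := Pi.single i 1

def Tower (l : ℕ) (Ω : Set (Rv d)) (D : List (Fin d) → (Rv d) → ℝ) : Prop :=
  ∀ β : List (Fin d), β.length < l → ∀ x ∈ Ω, ∀ i,
    HasDerivAt (fun s : ℝ => D β (x + s • ev i)) (D (i :: β) x) 0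

theorem tower_shift {l : ℕ} {Ω : Set (Rv d)} {D : List (Fin d) → (Rv d) → ℝ}
    (h : Tower l Ω D) (β : List (Fin d)) (hβ : β.length < l) (x : Rv d) (i : Fin d) (s : ℝ)
    (hx : x + s • ev i ∈ Ω) :
    HasDerivAt (fun s : ℝ => D β (x + s • ev i)) (D (i :: β) (x + s • ev i)) s := by
  have h1 := h β hβ _ hx i
  have h2 : HasDerivAt (fun s' : ℝ => s' - s) 1 s := (hasDerivAt_id s).sub_const s
  have h4 := HasDerivAt.comp s (h₂ := fun s' : ℝ => D β (x + s • ev i + s' • ev i))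
    (h := fun s' => s' - s) (by simpa using h1) h2
  have h5 : ((fun s' : ℝ => D β (x + s • ev i + s' • ev i)) ∘ fun s' => s' - s) =
    fun s : ℝ => D β (x + s • ev i) := by
    ext s'
    simp only [Function.comp]
    congr 1
    module
  rw [h5] at h4
  simpa using h4

def fdc : ℕ → ℝ
  | 0 => 1
  | j + 1 => fdc j * (1/2) ^ (j + 2)

theorem fdc_pos (j : ℕ) : 0 < fdc j := by
  induction j with
  | zero => simp [fdc]
  | succ j ih => simp only [fdc]; positivity

theorem mem_cb_shift {y x : Rv d} {ρ ρ' s : ℝ} (hx : x ∈ cb y ρ)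
    (i : Fin d) (hs : ρ + |s| ≤ ρ') : x + s • ev i ∈ cb y ρ' := by
  rw [Metric.mem_closedBall] at hx ⊢
  have h0 : ‖ev i‖ = 1 := by
    unfold ev
    rw [Pi.norm_single]; simp
  calc dist (x + s • ev i) y ≤ dist (x + s • ev i) x + dist x y := dist_triangle _ _ _
    _ ≤ |s| + ρ := by
      gcongr
      rw [dist_eq_norm, add_sub_cancel_left, norm_smul, h0]; simp
    _ ≤ ρ' := by linarith

theorem finite_diff (β : List (Fin d)) : ∀ (l : ℕ) (D : List (Fin d) → (Rv d) → ℝ)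
    (y : Rv d) (ρ a : ℝ), 0 < ρ → 0 ≤ a → β.length ≤ l →
    Tower l (cb y ρ) D → (∀ x ∈ cb y ρ, a ≤ D β x) →
    ∃ x ∈ cb y ρ, fdc β.length * a * ρ ^ β.length ≤ |D [] x| := by
  induction β with
  | nil =>
    intro l D y ρ a hρ ha hl hT hD
    refine ⟨y, Metric.mem_closedBall_self hρ.le, ?_⟩
    simp only [List.length_nil, fdc, pow_zero, one_mul, mul_one]
    exact (hD y (Metric.mem_closedBall_self hρ.le)).trans (le_abs_self _)
  | cons i β ih =>
    intro l D y ρ a hρ ha hl hT hD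
    simp only [List.length_cons] at hl ⊢
    let D1 : List (Fin d) → (Rv d) → ℝ := fun γ x => D γ (x + (ρ/2) • ev i) - D γ x
    have hm1 : ∀ x ∈ cb y (ρ/2), x ∈ cb y ρ :=
      fun x hx => Metric.closedBall_subset_closedBall (by linarith) hx
    have hm2 : ∀ x ∈ cb y (ρ/2), ∀ s ∈ Set.Icc 0 (ρ/2),
        x + s • ev i ∈ cb y ρ := by
      intro x hx s hs
      apply mem_cb_shift hx
      rw [abs_of_nonneg hs.1]; linarith [hs.2]
    have hT1 : Tower l (cb y (ρ/2)) D1 := by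
      intro γ hγ x hx j
      have e1 := hT γ hγ _ (hm2 x hx (ρ/2) ⟨by positivity, le_rfl⟩) j
      have e2 := hT γ hγ x (hm1 x hx) j
      have h9 := e1.sub e2
      have h8 : (fun s : ℝ => D1 γ (x + s • ev j)) =
          ((fun s : ℝ => D γ (x + (ρ / 2) • ev i + s • ev j)) - fun s => D γ (x + s • ev j)) := by
        ext s
        change D γ (x + s • ev j + (ρ/2) • ev i) - D γ (x + s • ev j) =
          D γ (x + (ρ / 2) • ev i + s • ev j) - D γ (x + s • ev j)
        rw [add_right_comm]
      rw [h8]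
      exact h9
    have hD1 : ∀ x ∈ cb y (ρ/2), a * (ρ/2) ≤ D1 β x := by
      intro x hx
      have hd : ∀ s ∈ Set.Icc 0 (ρ/2), HasDerivAt (fun s : ℝ => D β (x + s • ev i))
          (D (i :: β) (x + s • ev i)) s := fun s hs =>
        tower_shift hT β (by omega) x i s (hm2 x hx s hs)
      obtain ⟨c, hc, hc'⟩ := exists_hasDerivAt_eq_slope (fun s : ℝ => D β (x + s • ev i))
        (fun s => D (i :: β) (x + s • ev i)) (a := 0) (b := ρ/2) (by positivity)
        (fun s hs => (hd s hs).continuousAt.continuousWithinAt)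
        (fun s hs => hd s ⟨hs.1.le, hs.2.le⟩)
      have h1 := hD _ (hm2 x hx c ⟨hc.1.le, hc.2.le⟩)
      rw [hc', le_div_iff₀ (by linarith)] at h1
      simpa [D1] using h1
    obtain ⟨x, hx, hx'⟩ := ih l D1 y (ρ/2) (a * (ρ/2)) (by positivity) (by positivity) (by omega)
      hT1 hD1
    have htri : |D1 [] x| ≤ |D [] (x + (ρ/2) • ev i)| + |D [] x| := by
      simp only [D1]; exact abs_sub _ _
    have hid : fdc (β.length + 1) * a * ρ ^ (β.length + 1) * 2 =
        fdc β.length * (a * (ρ/2)) * (ρ/2) ^ β.length := by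
      simp only [fdc, div_pow, pow_succ, one_div, inv_pow]
      field_simp
    rcases le_total (|D [] x|) (|D [] (x + (ρ/2) • ev i)|) with h | h
    · exact ⟨_, hm2 x hx (ρ/2) ⟨by positivity, le_rfl⟩, by linarith⟩
    · exact ⟨x, hm1 x hx, by linarith⟩

variable {J : ℕ}

def lin (g : Mp d J) (u0 : ℝ) (u : Rv J) (x : Rv d) : ℝ :=
  u0 + ∑ a, u a * g x a

def linD (g : Mp d J) (u0 : ℝ) (u : Rv J) (β : List (Fin d))
    (x : Rv d) : ℝ :=
  (if β = [] then u0 else 0) + ∑ a, u a * listPDeriv β g x a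

theorem linD_nil (g : Mp d J) (u0 : ℝ) (u : Rv J) (x : Rv d) :
    linD g u0 u [] x = lin g u0 u x := by simp [linD, lin, listPDeriv]

theorem contDiff_listPDeriv {g : Mp d J} {Ω : Set (Rv d)} (hΩ : IsOpen Ω)
    (β : List (Fin d)) : ∀ (l : ℕ), ContDiffOn ℝ l g Ω → β.length ≤ l →
    ContDiffOn ℝ ((l - β.length : ℕ)) (listPDeriv β g) Ω := by
  induction β with
  | nil => intro l h _; simpa [listPDeriv] using h
  | cons i β ih =>
    intro l h hl
    simp only [List.length_cons] at hl
    have h1 := ih l h (by omega)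
    have h2 : ContDiffOn ℝ ((l - (β.length+1) : ℕ)) (fun x => fderiv ℝ (listPDeriv β g) x) Ω := by
      apply h1.fderiv_of_isOpen hΩ
      have : l - (β.length + 1) + 1 = l - β.length := by omega
      rw [← this]; push_cast; exact le_rfl
    simp only [listPDeriv, List.length_cons]
    exact h2.clm_apply contDiffOn_const

theorem linD_tower {g : Mp d J} {Ω : Set (Rv d)} (hΩ : IsOpen Ω)
    {l : ℕ} (h : ContDiffOn ℝ l g Ω) (u0 : ℝ) (u : Rv J) : Tower l Ω (linD g u0 u) := by
  intro β hβ x hx i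
  have h1 := contDiff_listPDeriv hΩ β l h hβ.le
  have h2 : DifferentiableAt ℝ (listPDeriv β g) x :=
    (h1.differentiableOn (by
      have : l - β.length ≠ 0 := by omega
      exact_mod_cast this)).differentiableAt (hΩ.mem_nhds hx)
  have h3 : HasDerivAt (fun s : ℝ => x + s • ev i) (ev i) 0 := by
    have := ((hasDerivAt_id (0:ℝ)).smul_const (ev i)).const_add x
    simpa using this
  have h4 : HasDerivAt (fun s : ℝ => listPDeriv β g (x + s • ev i))
      (fderiv ℝ (listPDeriv β g) x (ev i)) 0 := by
    have := HasFDerivAt.comp_hasDerivAt (0:ℝ) (f := fun s : ℝ => x + s • ev i)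
      (l := listPDeriv β g) (l' := fderiv ℝ (listPDeriv β g) x) (f' := ev i)
      (by simpa using h2.hasFDerivAt) h3
    exact this
  have h5 := hasDerivAt_pi.1 h4
  have h6 := HasDerivAt.fun_sum (u := Finset.univ)
    (fun a _ => (h5 a).const_mul (u a))
  have h7 := h6.const_add (if β = [] then u0 else 0)
  simpa [linD, listPDeriv, ev] using h7

end P1

noncomputable section P1b

variable {d J : ℕ}

theorem cb_radius_le (hd : 0 < d) {x0 y : Rv d} {r ρ : ℝ} (hρ : 0 ≤ ρ)
    (h : cb y ρ ⊆ cb x0 r) : ρ ≤ r := by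
  let i : Fin d := ⟨0, hd⟩
  have h1 := h (mem_cb_shift (s := ρ) (ρ' := ρ) (Metric.mem_closedBall_self (le_refl 0)) i
    (by rw [abs_of_nonneg hρ]; simp))
  have h2 := h (mem_cb_shift (s := -ρ) (ρ' := ρ) (Metric.mem_closedBall_self (le_refl 0)) i
    (by rw [abs_neg, abs_of_nonneg hρ]; simp))
  rw [Metric.mem_closedBall] at h1 h2
  have h3 := (dist_le_pi_dist _ _ i).trans h1
  have h4 := (dist_le_pi_dist _ _ i).trans h2
  rw [Real.dist_eq, abs_le] at h3 h4
  simp only [ev, Pi.add_apply, Pi.smul_apply, Pi.single_eq_same, smul_eq_mul, mul_one] at h3 h4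
  linarith [h3.2, h4.1]

theorem span_lower {T : Type*} [Fintype T] (v : T → Fin J → ℝ)
    (h : Submodule.span ℝ (Set.range v) = ⊤) :
    ∃ c > 0, ∀ u : Rv J, c * ‖u‖ ≤ ∑ t, |∑ a, u a * v t a| := by
  have hpos : ∀ u : Rv J, u ≠ 0 → 0 < ∑ t, |∑ a, u a * v t a| := by
    intro u hu
    by_contra hcon
    apply hu
    have h0 : ∑ t, |∑ a, u a * v t a| = 0 :=
      le_antisymm (not_lt.1 hcon) (Finset.sum_nonneg fun _ _ => abs_nonneg _)
    rw [Finset.sum_eq_zero_iff_of_nonneg (fun _ _ => abs_nonneg _)] at h0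
    have h1 : ∀ w : Rv J, ∑ a, u a * w a = 0 := by
      intro w
      have hw : w ∈ Submodule.span ℝ (Set.range v) := by rw [h]; trivial
      induction hw using Submodule.span_induction with
      | mem w hw =>
        obtain ⟨t, rfl⟩ := hw
        simpa using h0 t (Finset.mem_univ t)
      | zero => simp
      | add x y _ _ hx hy => simp [mul_add, Finset.sum_add_distrib, hx, hy]
      | smul a x _ hx =>
        have : ∑ b, u b * (a • x) b = a * ∑ b, u b * x b := by
          rw [Finset.mul_sum]; apply Finset.sum_congr rfl; intro b _; simp; ring
        rw [this, hx, mul_zero]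
    ext a
    have := h1 (Pi.single a 1)
    simpa [Pi.single_apply] using this
  by_cases hJ : ∃ u : Rv J, ‖u‖ = 1
  · obtain ⟨w, hw⟩ := hJ
    have hc : IsCompact (Metric.sphere (0 : Rv J) 1) := isCompact_sphere _ _
    obtain ⟨u1, hu1, hmin⟩ := hc.exists_isMinOn ⟨w, by simpa using hw⟩
      (f := fun u : Fin J → ℝ => ∑ t, |∑ a, u a * v t a|)
      (by apply Continuous.continuousOn; fun_prop)
    refine ⟨_, hpos u1 (by rintro rfl; simp at hu1), ?_⟩
    intro u
    by_cases hu : u = 0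
    · subst hu; simp
    have hn : 0 < ‖u‖ := norm_pos_iff.2 hu
    have := hmin (a := ‖u‖⁻¹ • u) (by simp [norm_smul, hn.ne'])
    simp only [Set.mem_ofPred_eq] at this
    have e : ∑ t, |∑ a, (‖u‖⁻¹ • u) a * v t a| = ‖u‖⁻¹ * ∑ t, |∑ a, u a * v t a| := by
      rw [Finset.mul_sum]
      apply Finset.sum_congr rfl
      intro t _
      rw [← abs_of_pos (inv_pos.2 hn), ← abs_mul, Finset.mul_sum, abs_of_pos (inv_pos.2 hn)]
      congr 1
      apply Finset.sum_congr rfl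
      intro a _
      simp; ring
    have h7 : (∑ t, |∑ a, u1 a * v t a|) ≤ ‖u‖⁻¹ * ∑ t, |∑ a, u a * v t a| := by
      rw [← e]; exact this
    calc _ ≤ ‖u‖⁻¹ * (∑ t, |∑ a, u a * v t a|) * ‖u‖ := by gcongr
      _ = _ := by field_simp
  · refine ⟨1, one_pos, fun u => ?_⟩
    have : u = 0 := by
      by_contra hu
      apply hJ
      exact ⟨‖u‖⁻¹ • u, by rw [norm_smul]; simp [hu]⟩
    subst this; simp

def NProp (g : Mp d J) (x0 : Rv d) (l : ℕ) (r1 c : ℝ) : Prop :=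
  ∀ y ρ, 0 < ρ → cb y ρ ⊆ cb x0 r1 → ∀ u0 u,
    ∃ x ∈ cb y ρ, c * ρ ^ l * ‖u‖ ≤ |lin g u0 u x|

theorem abs_dot_le (u w : Rv J) : |∑ a, u a * w a| ≤ (J:ℝ) * (‖u‖ * ‖w‖) := by
  refine (Finset.abs_sum_le_sum_abs _ _).trans ?_
  have : ∀ a ∈ Finset.univ, |u a * w a| ≤ ‖u‖ * ‖w‖ := by
    intro a _
    rw [abs_mul]
    exact mul_le_mul (norm_le_pi_norm u a) (norm_le_pi_norm w a) (abs_nonneg _) (norm_nonneg _)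
  refine (Finset.sum_le_sum this).trans ?_
  simp

theorem lem_N (hd : 0 < d) {g : Mp d J} {x0 : Rv d} {l : ℕ}
    (h : IsLNondegenerateAt l g x0) :
    ∃ r1 > 0, r1 ≤ 1 ∧ ∃ c > 0, ∃ Ω, IsOpen Ω ∧ cb x0 r1 ⊆ Ω ∧
      ContDiffOn ℝ l g Ω ∧ NProp g x0 l r1 c := by
  obtain ⟨⟨V, hV, hC⟩, hspan⟩ := h
  obtain ⟨Ω, hΩV, hΩ, hx0⟩ := mem_nhds_iff.1 hV
  have hCΩ := hC.mono hΩV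
  let S : Set (List (Fin d)) := {β | 1 ≤ β.length ∧ β.length ≤ l}
  have hSfin : S.Finite := (List.finite_length_le (Fin d) l).subset (fun β hβ => hβ.2)
  have : Fintype S := hSfin.fintype
  obtain ⟨c0, hc0, hlow⟩ := span_lower (J := J) (fun β : S => listPDeriv β.1 g x0) (by
    rw [← hspan]; congr 1; ext v; constructor
    · rintro ⟨⟨β, h1, h2⟩, rfl⟩; exact ⟨β, h1, h2, rfl⟩
    · rintro ⟨β, h1, h2, rfl⟩; exact ⟨⟨β, h1, h2⟩, rfl⟩)
  let q : ℝ := Fintype.card S + 1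
  have hq : 0 < q := by positivity
  let δ : ℝ := c0 / (2 * q * (J + 1))
  have hδ : 0 < δ := by positivity
  have hcont : ∀ β : S, ∀ᶠ x in nhds x0, ‖listPDeriv β.1 g x - listPDeriv β.1 g x0‖ ≤ δ := by
    intro β
    have h1 := (contDiff_listPDeriv hΩ β.1 l hCΩ β.2.2).continuousOn.continuousAt
      (hΩ.mem_nhds hx0)
    have := (Metric.tendsto_nhds.1 h1 δ hδ)
    filter_upwards [this] with x hx
    rw [← dist_eq_norm]; exact hx.le
  have hall : ∀ᶠ x in nhds x0, x ∈ Ω ∧ ∀ β : S, ‖listPDeriv β.1 g x - listPDeriv β.1 g x0‖ ≤ δ :=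
    Filter.Eventually.and (hΩ.mem_nhds hx0) (eventually_all.2 hcont)
  obtain ⟨r, hr, hr'⟩ := Metric.nhds_basis_closedBall.eventually_iff.1 hall
  let c1 : ℝ := ∏ j ∈ Finset.range (l+1), min 1 (fdc j)
  have hc1 : 0 < c1 := Finset.prod_pos fun j _ => lt_min one_pos (fdc_pos j)
  have hc1le : ∀ j ≤ l, c1 ≤ fdc j := by
    intro j hj
    refine le_trans ?_ (min_le_right 1 (fdc j))
    calc c1 = min 1 (fdc j) * ∏ i ∈ (Finset.range (l+1)).erase j, min 1 (fdc i) :=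
        (Finset.mul_prod_erase _ _ (by simp; omega)).symm
      _ ≤ min 1 (fdc j) * 1 := by
        have h2 : 0 ≤ min 1 (fdc j) := le_min zero_le_one (fdc_pos j).le
        gcongr
        exact Finset.prod_le_one (fun i _ => le_min zero_le_one (fdc_pos i).le)
          (fun i _ => min_le_left _ _)
      _ = _ := mul_one _
  refine ⟨min r 1, lt_min hr one_pos, min_le_right _ _, c1 * (c0 / (2 * q)), by positivity, Ω, hΩ,
    ?_, hCΩ, ?_⟩
  · intro x hx
    exact (hr' (Metric.closedBall_subset_closedBall (min_le_left _ _) hx)).1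
  intro y ρ hρ hQ u0 u
  have hρ1 : ρ ≤ 1 := (cb_radius_le hd hρ.le hQ).trans (min_le_right _ _)
  have hQ' : ∀ x ∈ cb y ρ, x ∈ cb x0 r := fun x hx =>
    Metric.closedBall_subset_closedBall (min_le_left _ _) (hQ hx)
  by_cases hu : ‖u‖ = 0
  · exact ⟨y, Metric.mem_closedBall_self hρ.le, by rw [hu, mul_zero]; exact abs_nonneg _⟩
  have hex : ∃ β : S, c0 * ‖u‖ / q ≤ |∑ a, u a * listPDeriv β.1 g x0 a| := by
    by_contra hcon
    push Not at hcon
    have h1 := hlow u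
    have h2 : ∑ t : S, |∑ a, u a * listPDeriv t.1 g x0 a| ≤ ∑ t : S, c0 * ‖u‖ / q :=
      Finset.sum_le_sum fun t _ => (hcon t).le
    have h3 : ∑ t : S, c0 * ‖u‖ / q = (Fintype.card S : ℝ) * (c0 * ‖u‖ / q) := by simp
    have h4 : (Fintype.card S : ℝ) * (c0 * ‖u‖ / q) < q * (c0 * ‖u‖ / q) := by
      have : 0 < c0 * ‖u‖ / q := by
        have := lt_of_le_of_ne (norm_nonneg u) (Ne.symm hu)
        positivity
      have : (Fintype.card S : ℝ) < q := by simp [q]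
      nlinarith
    have h5 : q * (c0 * ‖u‖ / q) = c0 * ‖u‖ := by field_simp
    linarith
  obtain ⟨⟨β, hβ1, hβ2⟩, hβ⟩ := hex
  have hβne : β ≠ [] := by rintro rfl; simp at hβ1
  have hJδ : (J:ℝ) * (‖u‖ * δ) ≤ c0 * ‖u‖ / (2 * q) := by
    have : (J:ℝ) * δ ≤ c0 / (2*q) := by
      simp only [δ]
      rw [← div_div, mul_div_assoc', div_le_iff₀ (by positivity)]
      have : 0 < c0 / (2*q) := by positivity
      nlinarith
    calc (J:ℝ) * (‖u‖ * δ) = (J * δ) * ‖u‖ := by ring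
      _ ≤ c0 / (2*q) * ‖u‖ := by gcongr
      _ = _ := by ring
  have hnear : ∀ x ∈ cb y ρ,
      |(∑ a, u a * listPDeriv β g x a) - ∑ a, u a * listPDeriv β g x0 a| ≤ c0 * ‖u‖ / (2*q) := by
    intro x hx
    have h1 := (hr' (hQ' x hx)).2 ⟨β, hβ1, hβ2⟩
    have h2 := abs_dot_le u (listPDeriv β g x - listPDeriv β g x0)
    have h3 : ∑ a, u a * (listPDeriv β g x - listPDeriv β g x0) a =
      (∑ a, u a * listPDeriv β g x a) - ∑ a, u a * listPDeriv β g x0 a := by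
      rw [← Finset.sum_sub_distrib]; apply Finset.sum_congr rfl; intro a _; simp; ring
    rw [h3] at h2
    refine h2.trans (le_trans ?_ hJδ)
    gcongr
  have hhalf : c0 * ‖u‖ / q = 2 * (c0 * ‖u‖ / (2*q)) := by field_simp
  have hT : ∀ s0 : ℝ, ∀ s : Rv J, Tower l (cb y ρ) (linD g s0 s) := by
    intro s0 s γ hγ x hx i
    exact linD_tower hΩ hCΩ s0 s γ hγ x (hr' (hQ' x hx)).1 i
  have hfin : ∀ x, fdc β.length * (c0 * ‖u‖ / (2*q)) * ρ ^ β.length ≤ |lin g u0 u x| →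
      c1 * (c0 / (2 * q)) * ρ ^ l * ‖u‖ ≤ |lin g u0 u x| := by
    intro x hx
    refine le_trans ?_ hx
    have h1 : ρ ^ l ≤ ρ ^ β.length := pow_le_pow_of_le_one hρ.le hρ1 hβ2
    have h2 := hc1le β.length hβ2
    have h3 := fdc_pos β.length
    calc c1 * (c0 / (2 * q)) * ρ ^ l * ‖u‖ = c1 * (c0 * ‖u‖ / (2*q)) * ρ ^ l := by ring
      _ ≤ _ := by gcongr
  rcases le_total 0 (∑ a, u a * listPDeriv β g x0 a) with hs | hs
  · rw [abs_of_nonneg hs] at hβ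
    obtain ⟨x, hx, hx'⟩ := finite_diff β l (linD g u0 u) y ρ (c0 * ‖u‖ / (2*q)) hρ (by positivity)
      hβ2 (hT _ _) (by
        intro x hx
        have := (abs_le.1 (hnear x hx)).1
        simp only [linD, hβne, if_false, zero_add]
        linarith)
    rw [linD_nil] at hx'
    exact ⟨x, hx, hfin x hx'⟩
  · rw [abs_of_nonpos hs] at hβ
    obtain ⟨x, hx, hx'⟩ := finite_diff β l (linD g (-u0) (-u)) y ρ (c0 * ‖u‖ / (2*q)) hρ
      (by positivity) hβ2 (hT _ _) (by
        intro x hx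
        have := (abs_le.1 (hnear x hx)).2
        simp only [linD, hβne, if_false, zero_add, Pi.neg_apply, neg_mul, Finset.sum_neg_distrib]
        linarith)
    rw [linD_nil] at hx'
    have : lin g (-u0) (-u) x = - lin g u0 u x := by
      simp [lin, Finset.sum_neg_distrib]; ring
    rw [this, abs_neg] at hx'
    exact ⟨x, hx, hfin x hx'⟩

end P1b

noncomputable section P2

theorem compact_good {P : Type*} [TopologicalSpace P] (X : Set P) (hX : IsCompact X)
    (g : P → ℝ → ℝ) (hg : Continuous (Function.uncurry g))
    (h0 : ∀ c ∈ X, volume {τ : ℝ | τ ∈ Set.Icc (0:ℝ) 1 ∧ g c τ = 0} = 0) (κ : ℝ) (hκ : 0 < κ) :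
    ∃ ε > (0:ℝ), ∀ c ∈ X,
      volume {τ : ℝ | τ ∈ Set.Icc (0:ℝ) 1 ∧ |g c τ| < ε} ≤ oR κ := by
  refine hX.induction_on (p := fun s => ∃ ε > (0:ℝ), ∀ c ∈ s,
      volume {τ : ℝ | τ ∈ Set.Icc (0:ℝ) 1 ∧ |g c τ| < ε} ≤ oR κ) ?_ ?_ ?_ ?_
  · exact ⟨1, one_pos, by simp⟩
  · rintro s t hst ⟨ε, hε, h⟩
    exact ⟨ε, hε, fun c hc => h c (hst hc)⟩
  · rintro s t ⟨ε, hε, h⟩ ⟨ε', hε', h'⟩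
    refine ⟨min ε ε', lt_min hε hε', ?_⟩
    rintro c (hc | hc)
    · refine (measure_mono ?_).trans (h c hc)
      rintro τ ⟨h1, h2⟩
      exact ⟨h1, h2.trans_le (min_le_left _ _)⟩
    · refine (measure_mono ?_).trans (h' c hc)
      rintro τ ⟨h1, h2⟩
      exact ⟨h1, h2.trans_le (min_le_right _ _)⟩
  · intro c hc
    have hgc : Continuous (g c) := hg.comp (Continuous.prodMk_right c)
    let A : ℕ → Set ℝ := fun n => {τ : ℝ | τ ∈ Set.Icc (0:ℝ) 1 ∧ |g c τ| < 1 / ((n:ℝ) + 1)}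
    have hAm : ∀ n, MeasurableSet (A n) := by
      intro n
      exact measurableSet_Icc.inter (measurableSet_lt hgc.abs.measurable measurable_const)
    have hanti : Antitone A := by
      intro i j hij τ hτ
      refine ⟨hτ.1, hτ.2.trans_le ?_⟩
      have : (i:ℝ) ≤ j := by exact_mod_cast hij
      apply one_div_le_one_div_of_le (by positivity); linarith
    have hlim := tendsto_measure_iInter_atTop (μ := volume) (fun n => (hAm n).nullMeasurableSet)
      hanti ⟨0, ne_of_lt (lt_of_le_of_lt (measure_mono (fun τ hτ => hτ.1))
        (measure_Icc_lt_top (a := (0:ℝ)) (b := 1)))⟩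
    have hz : volume (⋂ n, A n) = 0 := by
      refine measure_mono_null ?_ (h0 c hc)
      intro τ hτ
      rw [Set.mem_iInter] at hτ
      refine ⟨(hτ 0).1, ?_⟩
      by_contra hne
      obtain ⟨n, hn⟩ := exists_nat_one_div_lt (abs_pos.2 hne)
      exact absurd (hτ n).2 (by linarith)
    rw [hz] at hlim
    have hev := hlim.eventually (gt_mem_nhds (ENNReal.ofReal_pos.2 hκ))
    obtain ⟨n, hn⟩ := hev.exists
    set δ : ℝ := 1 / ((n:ℝ) + 1) with hδ
    have hδ0 : 0 < δ := by positivity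
    have hnb : ∀ᶠ c' in nhds c, ∀ τ ∈ Set.Icc (0:ℝ) 1, |g c' τ - g c τ| < δ / 2 := by
      apply (isCompact_Icc (a := (0:ℝ)) (b := 1)).eventually_forall_of_forall_eventually
      intro τ _
      have hc1 : Continuous (fun z : P × ℝ => |g z.1 z.2 - g c z.2|) :=
        (hg.sub (hgc.comp continuous_snd)).abs
      have := hc1.tendsto (c, τ)
      apply this.eventually (gt_mem_nhds _)
      simp; positivity
    refine ⟨_, mem_nhdsWithin_of_mem_nhds hnb, δ / 2, by positivity, ?_⟩
    intro c' hc'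
    refine le_trans (measure_mono ?_) hn.le
    rintro τ ⟨hτ, hτ'⟩
    refine ⟨hτ, ?_⟩
    have := hc' τ hτ
    have h2 := abs_sub_abs_le_abs_sub (g c τ) (g c' τ)
    rw [abs_sub_comm] at h2
    linarith

def pl {l : ℕ} (c : Fin (l+1) → ℝ) (τ : ℝ) : ℝ := ∑ k, c k * τ ^ (k:ℕ)
def pl' {l : ℕ} (c : Fin (l+1) → ℝ) (τ : ℝ) : ℝ := ∑ k, c k * ((k:ℕ) * τ ^ ((k:ℕ) - 1))

def ply {l : ℕ} (c : Fin (l+1) → ℝ) : Polynomial ℝ :=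
  ∑ k, Polynomial.C (c k) * Polynomial.X ^ (k:ℕ)

theorem ply_eval {l : ℕ} (c : Fin (l+1) → ℝ) (τ : ℝ) : (ply c).eval τ = pl c τ := by
  simp [ply, pl, Polynomial.eval_finsetSum]

theorem ply_deriv_eval {l : ℕ} (c : Fin (l+1) → ℝ) (τ : ℝ) :
    (Polynomial.derivative (ply c)).eval τ = pl' c τ := by
  simp [ply, pl', Polynomial.eval_finsetSum, Polynomial.derivative_X_pow]

theorem ply_coeff {l : ℕ} (c : Fin (l+1) → ℝ) (k : Fin (l+1)) : (ply c).coeff k = c k := by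
  simp only [ply, Polynomial.finsetSum_coeff, Polynomial.coeff_C_mul_X_pow]
  rw [Finset.sum_eq_single k]
  · simp
  · intro b _ hb
    rw [if_neg]
    intro h
    exact hb (Fin.ext h.symm)
  · simp

theorem ply_eq_zero {l : ℕ} (c : Fin (l+1) → ℝ) (h : ply c = 0) : c = 0 := by
  ext k
  have := ply_coeff c k
  rw [h] at this
  simpa using this.symm

theorem poly_null (p : Polynomial ℝ) (hp : p ≠ 0) :
    volume {τ : ℝ | τ ∈ Set.Icc (0:ℝ) 1 ∧ p.eval τ = 0} = 0 := by
  apply Set.Finite.measure_zero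
  apply (Polynomial.finite_setOfPred_isRoot hp).subset
  rintro τ ⟨-, h⟩
  exact h

theorem pl_hasDeriv {l : ℕ} (c : Fin (l+1) → ℝ) (τ : ℝ) : HasDerivAt (pl c) (pl' c τ) τ := by
  have h := (ply c).hasDerivAt τ
  rw [ply_deriv_eval] at h
  have : (fun x => Polynomial.eval x (ply c)) = pl c := by ext; exact ply_eval c _
  rwa [this] at h

theorem pl_bound {l : ℕ} (c : Fin (l+1) → ℝ) (τ : ℝ) (hτ : τ ∈ Set.Icc (0:ℝ) 1) :
    |pl c τ| ≤ (l + 1) * ‖c‖ := by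
  refine (Finset.abs_sum_le_sum_abs _ _).trans ?_
  have : ∀ k ∈ Finset.univ, |c k * τ ^ (k:ℕ)| ≤ ‖c‖ := by
    intro k _
    rw [abs_mul, abs_pow, abs_of_nonneg hτ.1]
    calc _ ≤ ‖c‖ * 1 := mul_le_mul (norm_le_pi_norm c k) (pow_le_one₀ hτ.1 hτ.2)
          (by have := hτ.1; positivity) (norm_nonneg _)
      _ = _ := mul_one _
  refine (Finset.sum_le_sum this).trans ?_
  simp

theorem pl'_bound {l : ℕ} (c : Fin (l+1) → ℝ) (τ : ℝ) (hτ : τ ∈ Set.Icc (0:ℝ) 1) :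
    |pl' c τ| ≤ (l + 1) * (l * ‖c‖) := by
  refine (Finset.abs_sum_le_sum_abs _ _).trans ?_
  have : ∀ k ∈ Finset.univ, |c k * ((k:ℕ) * τ ^ ((k:ℕ) - 1))| ≤ l * ‖c‖ := by
    intro k _
    have h1 : 0 ≤ τ ^ ((k:ℕ) - 1) := pow_nonneg hτ.1 _
    have h2 : τ ^ ((k:ℕ) - 1) ≤ 1 := pow_le_one₀ hτ.1 hτ.2
    have h3 : ((k:ℕ):ℝ) ≤ l := by
      have := k.2; exact_mod_cast (by omega : (k:ℕ) ≤ l)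
    rw [abs_mul, abs_mul, abs_of_nonneg h1, Nat.abs_cast]
    have h4 := norm_le_pi_norm c k
    calc |c k| * ((k:ℕ) * τ ^ ((k:ℕ) - 1)) ≤ ‖c‖ * (l * 1) :=
          mul_le_mul h4 (mul_le_mul h3 h2 h1 (by positivity)) (by positivity) (norm_nonneg _)
      _ = _ := by ring
  refine (Finset.sum_le_sum this).trans ?_
  simp

theorem pl_cont {l : ℕ} : Continuous (Function.uncurry (fun (c : Fin (l+1) → ℝ) τ => pl c τ)) := by
  unfold pl; simp only [Function.uncurry_def]; fun_prop

theorem pl'_cont {l : ℕ} :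
    Continuous (Function.uncurry (fun (c : Fin (l+1) → ℝ) τ => pl' c τ)) := by
  unfold pl'; simp only [Function.uncurry_def]; fun_prop

theorem taylor (l : ℕ) : ∀ (φ : ℕ → ℝ → ℝ) (A ω : ℝ),
    (∀ j < l, ∀ τ ∈ Set.Icc (0:ℝ) 1, HasDerivAt (φ j) (φ (j+1) τ) τ) →
    (∀ τ ∈ Set.Icc (0:ℝ) 1, |φ l τ - A| ≤ ω) →
    ∃ c : Fin (l+1) → ℝ, ∀ τ ∈ Set.Icc (0:ℝ) 1, |φ 0 τ - pl c τ| ≤ ω ∧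
      (1 ≤ l → |φ 1 τ - pl' c τ| ≤ ω) := by
  induction l with
  | zero =>
    intro φ A ω _ h
    refine ⟨fun _ => A, fun τ hτ => ⟨?_, by simp⟩⟩
    simpa [pl] using h τ hτ
  | succ l ih =>
    intro φ A ω hd h
    obtain ⟨c, hc⟩ := ih (fun j => φ (j+1)) A ω (fun j hj τ hτ => hd (j+1) (by omega) τ hτ) h
    let c' : Fin (l+1+1) → ℝ := Fin.cons (φ 0 0) (fun k => c k / ((k:ℕ) + 1))
    have e1 : ∀ τ, pl' c' τ = pl c τ := by
      intro τ
      simp only [pl', pl, c']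
      rw [Fin.sum_univ_succ]
      simp only [Fin.cons_succ, Fin.val_succ, Fin.val_zero, Nat.cast_zero, zero_mul, mul_zero,
        zero_add, Nat.add_sub_cancel]
      apply Finset.sum_congr rfl
      intro k _
      push_cast
      field_simp
    have e2 : pl c' 0 = φ 0 0 := by
      simp only [pl, c']
      rw [Fin.sum_univ_succ]
      simp
    refine ⟨c', fun τ hτ => ⟨?_, ?_⟩⟩
    · have hder : ∀ s ∈ Set.Icc (0:ℝ) 1, HasDerivWithinAt (fun s => φ 0 s - pl c' s)
          (φ 1 s - pl c s) (Set.Icc (0:ℝ) 1) s := by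
        intro s hs
        have h2 := pl_hasDeriv c' s
        rw [e1] at h2
        exact ((hd 0 (by omega) s hs).sub h2).hasDerivWithinAt
      have hb := Convex.norm_image_sub_le_of_norm_hasDerivWithin_le (C := ω) hder
        (fun s hs => (hc s hs).1) (convex_Icc 0 1) (x := 0) (y := τ) (by simp) hτ
      rw [e2] at hb
      simp only [sub_self, sub_zero, Real.norm_eq_abs] at hb
      refine hb.trans ?_
      have h0 : 0 ≤ ω := (abs_nonneg _).trans (hc τ hτ).1
      rw [abs_of_nonneg hτ.1]
      nlinarith [hτ.2]
    · intro _
      rw [e1]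
      exact (hc τ hτ).1

theorem good1 (l : ℕ) (κ : ℝ) (hκ : 0 < κ) : ∃ ε > (0:ℝ), ε ≤ 1 ∧
    ∀ (φ : ℝ → ℝ) (c : Fin (l+1) → ℝ) (S : ℝ) (τ0 : ℝ), 0 < S → τ0 ∈ Set.Icc (0:ℝ) 1 →
    S ≤ |φ τ0| → (∀ τ ∈ Set.Icc (0:ℝ) 1, |φ τ - pl c τ| ≤ ε * S) →
    volume {τ : ℝ | τ ∈ Set.Icc (0:ℝ) 1 ∧ |φ τ| < ε * S} ≤ oR κ := by
  obtain ⟨ε1, hε1, h⟩ := compact_good (Metric.sphere (0 : Fin (l+1) → ℝ) 1) (isCompact_sphere _ _)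
    (fun c τ => pl c τ) pl_cont (by
      intro c hc
      have := poly_null (ply c) (by
        intro h0
        have := ply_eq_zero c h0
        subst this; simp at hc)
      simpa only [ply_eval] using this) κ hκ
  refine ⟨min (1/2) (ε1 / (4 * (l+1))), by positivity, (min_le_left _ _).trans (by norm_num), ?_⟩
  intro φ c S τ0 hS hτ0 hSφ hφ
  set ε := min (1/2) (ε1 / (4 * ((l:ℝ)+1))) with hε
  have h1 : ε ≤ 1/2 := min_le_left _ _
  have h2 : ε * (4 * (l+1)) ≤ ε1 := by
    rw [← le_div_iff₀ (by positivity)]; exact min_le_right _ _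
  have h3 : S / 2 ≤ |pl c τ0| := by
    have := hφ τ0 hτ0
    have h4 := abs_sub_abs_le_abs_sub (φ τ0) (pl c τ0)
    nlinarith
  have h4 : S / 2 ≤ (l+1) * ‖c‖ := h3.trans (pl_bound c τ0 hτ0)
  have hc : 0 < ‖c‖ := by
    by_contra hcon
    have : ‖c‖ = 0 := le_antisymm (not_lt.1 hcon) (norm_nonneg _)
    rw [this] at h4
    linarith
  refine (measure_mono ?_).trans (h (‖c‖⁻¹ • c) (by simp [norm_smul, hc.ne']))
  rintro τ ⟨hτ, hτ'⟩
  refine ⟨hτ, ?_⟩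
  have h5 : pl (‖c‖⁻¹ • c) τ = ‖c‖⁻¹ * pl c τ := by
    simp only [pl, Finset.mul_sum, Pi.smul_apply, smul_eq_mul, mul_assoc]
  rw [h5, abs_mul, abs_of_pos (inv_pos.2 hc), inv_mul_lt_iff₀ hc]
  have h6 := hφ τ hτ
  have h7 := abs_sub_abs_le_abs_sub (pl c τ) (φ τ)
  rw [abs_sub_comm] at h7
  have hεp : 0 < ε := by positivity
  calc |pl c τ| < 2 * ε * S := by linarith
    _ ≤ 2 * ε * (2 * ((l+1) * ‖c‖)) := by gcongr; linarith
    _ = ‖c‖ * (ε * (4 * (l+1))) := by ring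
    _ ≤ ‖c‖ * ε1 := by gcongr

end P2

noncomputable section P2b

variable {d J : ℕ}

theorem fub (k : Fin d) (E Q : Set (Rv d)) (hE : MeasurableSet E) (hQ : MeasurableSet Q)
    (κ : ℝ≥0∞)
    (h : ∀ x : Rv d, volume {s : ℝ | Function.update x k s ∈ E} ≤
      κ * volume {s : ℝ | Function.update x k s ∈ Q}) : volume E ≤ κ * volume Q := by
  classical
  have hu : (Finset.univ : Finset (Fin d)) = (Finset.univ.erase k) ∪ {k} := by
    ext i; simp
  have hdis : Disjoint ((Finset.univ : Finset (Fin d)).erase k) {k} := by simp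
  have key : ∀ X : Set (Rv d), MeasurableSet X → ∀ a : Rv d, volume X =
      (∫⋯∫⁻_(Finset.univ.erase k), (fun x => volume {s : ℝ | Function.update x k s ∈ X})
        ∂(fun _ : Fin d => (volume : Measure ℝ))) a := by
    intro X hX a
    have hm : Measurable (X.indicator (fun _ => (1:ℝ≥0∞))) := measurable_const.indicator hX
    rw [← lintegral_indicator_one hX]
    change ∫⁻ x, X.indicator (fun _ => (1:ℝ≥0∞)) x ∂(Measure.pi fun _ => volume) = _
    rw [lintegral_eq_lmarginal_univ a]
    conv_lhs => rw [hu]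
    rw [lmarginal_union _ _ hm hdis]
    congr 1
    ext x
    rw [lmarginal_singleton]
    have : MeasurableSet {s : ℝ | Function.update x k s ∈ X} := (measurable_update x) hX
    rw [← lintegral_indicator_one this]
    rfl
  rw [key E hE 0, key Q hQ 0]
  have hmm : Measurable (fun x => volume {s : ℝ | Function.update x k s ∈ Q}) := by
    have hm : Measurable (Q.indicator (fun _ => (1:ℝ≥0∞))) := measurable_const.indicator hQ
    have := Measurable.lmarginal (fun _ : Fin d => (volume : Measure ℝ)) (s := {k}) hm
    convert this using 1
    ext x
    rw [lmarginal_singleton]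
    have : MeasurableSet {s : ℝ | Function.update x k s ∈ Q} := (measurable_update x) hQ
    rw [← lintegral_indicator_one this]
    rfl
  have h3 : κ * (∫⋯∫⁻_(Finset.univ.erase k), (fun x => volume {s : ℝ | Function.update x k s ∈ Q})
        ∂(fun _ : Fin d => (volume : Measure ℝ))) 0 =
      (∫⋯∫⁻_(Finset.univ.erase k), (fun x => κ * volume {s : ℝ | Function.update x k s ∈ Q})
        ∂(fun _ : Fin d => (volume : Measure ℝ))) 0 := by
    simp only [lmarginal]
    rw [lintegral_const_mul]
    exact hmm.comp measurable_updateFinset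
  rw [h3]
  exact lmarginal_mono (fun x => h x) 0

theorem upd_eq (p : Rv d) (k : Fin d) (s : ℝ) :
    Function.update p k s = p + (s - p k) • ev k := by
  ext i
  by_cases h : i = k
  · subst h; simp [ev]
  · simp [ev, h]

theorem upd_mem {y p : Rv d} {ρ : ℝ} (hρ : 0 ≤ ρ) (hp : p ∈ cb y ρ) (k : Fin d)
    (s : ℝ) (hs : s ∈ Set.Icc (y k - ρ) (y k + ρ)) :
    Function.update p k s ∈ cb y ρ := by
  rw [Metric.mem_closedBall, dist_pi_le_iff hρ] at hp ⊢
  intro i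
  by_cases h : i = k
  · subst h
    rw [Function.update_self, Real.dist_eq, abs_le]
    constructor <;> linarith [hs.1, hs.2]
  · rw [Function.update_of_ne h]; exact hp i

theorem vol_affine (a b : ℝ) (hb : 0 < b) (E : Set ℝ) :
    volume {τ : ℝ | a + b * τ ∈ E} = oR b⁻¹ * volume E := by
  have h1 : {τ : ℝ | a + b * τ ∈ E} = (fun τ => b * τ) ⁻¹' ((fun s => a + s) ⁻¹' E) := rfl
  rw [h1, Real.volume_preimage_mul_left hb.ne', measure_preimage_add, abs_of_pos (inv_pos.2 hb)]

theorem line_hasDeriv {l : ℕ} {Ω : Set (Rv d)} {D : List (Fin d) → (Rv d) → ℝ}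
    (hT : Tower l Ω D) (p : Rv d) (k : Fin d) (a b : ℝ) (j : ℕ) (hj : j < l) (τ : ℝ)
    (hm : Function.update p k (a + b * τ) ∈ Ω) :
    HasDerivAt (fun τ => b ^ j * D (List.replicate j k) (Function.update p k (a + b * τ)))
      (b ^ (j+1) * D (List.replicate (j+1) k) (Function.update p k (a + b * τ))) τ := by
  have h1 := tower_shift hT (List.replicate j k) (by simpa using hj) p k (a + b * τ - p k)
    (by rw [← upd_eq]; exact hm)
  have h2 : HasDerivAt (fun τ : ℝ => a + b * τ - p k) b τ := by
    have := (((hasDerivAt_id τ).const_mul b).const_add a).sub_const (p k)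
    simpa using this
  have h3 := (HasDerivAt.comp τ h1 h2).const_mul (b ^ j)
  simp only [upd_eq]
  have e : b ^ (j+1) * D (List.replicate (j+1) k) (p + (a + b * τ - p k) • ev k) =
      b ^ j * (D (k :: List.replicate j k) (p + (a + b * τ - p k) • ev k) * b) := by
    rw [List.replicate_succ]; ring
  rw [e]
  exact h3

theorem vol_Icc_le (a b : ℝ) (hb : 0 < b) (P : ℝ → Prop) (κ : ℝ)
    (h : volume {τ : ℝ | τ ∈ Set.Icc (0:ℝ) 1 ∧ P (a + b * τ)} ≤ oR κ) :
    volume {s : ℝ | s ∈ Set.Icc a (a + b) ∧ P s} ≤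
      oR κ * oR b := by
  have h1 := vol_affine a b hb {s : ℝ | s ∈ Set.Icc a (a + b) ∧ P s}
  have h2 : {τ : ℝ | a + b * τ ∈ {s : ℝ | s ∈ Set.Icc a (a + b) ∧ P s}} =
      {τ : ℝ | τ ∈ Set.Icc (0:ℝ) 1 ∧ P (a + b * τ)} := by
    ext τ
    simp only [Set.mem_ofPred_eq, Set.mem_Icc, le_add_iff_nonneg_right, add_le_add_iff_left]
    constructor
    · rintro ⟨⟨e1, e2⟩, e3⟩
      exact ⟨⟨by nlinarith, by nlinarith⟩, e3⟩
    · rintro ⟨⟨e1, e2⟩, e3⟩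
      exact ⟨⟨by positivity, by nlinarith⟩, e3⟩
  rw [h2] at h1
  rw [h1] at h
  calc _ = oR b * (oR b⁻¹ * volume {s : ℝ | s ∈ Set.Icc a (a + b) ∧ P s}) := by
        rw [← mul_assoc, ← ENNReal.ofReal_mul hb.le, mul_inv_cancel₀ hb.ne', ENNReal.ofReal_one,
          one_mul]
    _ ≤ oR b * oR κ := by gcongr
    _ = _ := mul_comm _ _

structure Setup (g : Mp d J) (x0 : Rv d) (l : ℕ) (r1 c : ℝ)
    (Ω : Set (Rv d)) : Prop where
  hr1 : 0 < r1
  hr1' : r1 ≤ 1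
  hc : 0 < c
  hΩ : IsOpen Ω
  hsub : cb x0 r1 ⊆ Ω
  hC : ContDiffOn ℝ l g Ω
  hN : NProp g x0 l r1 c

theorem osc_small {g : Mp d J} {x0 : Rv d} {l : ℕ} {r1 c : ℝ}
    {Ω : Set (Rv d)} (S : Setup g x0 l r1 c Ω) (δ : ℝ) (hδ : 0 < δ) :
    ∃ r0 > 0, r0 ≤ r1 ∧ ∀ x ∈ cb x0 r0, ∀ k : Fin d, ∀ u0 u,
      |linD g u0 u (List.replicate l k) x - linD g u0 u (List.replicate l k) x0| ≤
        δ * ‖u‖ := by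
  have hx0 : x0 ∈ Ω := S.hsub (Metric.mem_closedBall_self S.hr1.le)
  have hcont : ∀ k : Fin d, ∀ᶠ x in nhds x0,
      ‖listPDeriv (List.replicate l k) g x - listPDeriv (List.replicate l k) g x0‖ ≤ δ / (J+1) := by
    intro k
    have h1 := (contDiff_listPDeriv S.hΩ (List.replicate l k) l S.hC (by simp)).continuousOn.continuousAt
      (S.hΩ.mem_nhds hx0)
    have := (Metric.tendsto_nhds.1 h1 (δ/(J+1)) (by positivity))
    filter_upwards [this] with x hx
    rw [← dist_eq_norm]; exact hx.le
  obtain ⟨r, hr, hr'⟩ := Metric.nhds_basis_closedBall.eventually_iff.1 (eventually_all.2 hcont)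
  refine ⟨min r r1, lt_min hr S.hr1, min_le_right _ _, ?_⟩
  intro x hx k u0 u
  have h1 := hr' (Metric.closedBall_subset_closedBall (min_le_left _ _) hx) k
  have h2 := abs_dot_le u (listPDeriv (List.replicate l k) g x - listPDeriv (List.replicate l k) g x0)
  have h3 : linD g u0 u (List.replicate l k) x - linD g u0 u (List.replicate l k) x0 =
      ∑ a, u a * (listPDeriv (List.replicate l k) g x - listPDeriv (List.replicate l k) g x0) a := by
    simp only [linD, Pi.sub_apply, mul_sub, Finset.sum_sub_distrib]; ring
  rw [h3]
  refine h2.trans ?_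
  calc (J:ℝ) * (‖u‖ * _) ≤ (J+1) * (‖u‖ * (δ / (J+1))) := by gcongr; linarith
    _ = _ := by field_simp

theorem line_taylor {g : Mp d J} {x0 : Rv d} {l : ℕ} {r1 c : ℝ}
    {Ω : Set (Rv d)} (S : Setup g x0 l r1 c Ω) {δ r0 : ℝ} (hr : r0 ≤ r1)
    (hosc : ∀ x ∈ cb x0 r0, ∀ k : Fin d, ∀ u0 u,
      |linD g u0 u (List.replicate l k) x - linD g u0 u (List.replicate l k) x0| ≤ δ * ‖u‖)
    (y : Rv d) (ρ : ℝ) (hρ : 0 < ρ) (hQ : cb y ρ ⊆ cb x0 r0)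
    (p : Rv d) (hp : p ∈ cb y ρ) (k : Fin d) (u0 : ℝ) (u : Rv J) :
    ∃ e : Fin (l+1) → ℝ, ∀ τ ∈ Set.Icc (0:ℝ) 1,
      |lin g u0 u (Function.update p k (y k - ρ + 2 * ρ * τ)) - pl e τ| ≤ (2*ρ)^l * (δ * ‖u‖) ∧
      (1 ≤ l → |2 * ρ * linD g u0 u [k] (Function.update p k (y k - ρ + 2 * ρ * τ)) - pl' e τ|
        ≤ (2*ρ)^l * (δ * ‖u‖)) := by
  have hmem : ∀ τ ∈ Set.Icc (0:ℝ) 1, Function.update p k (y k - ρ + 2 * ρ * τ) ∈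
      cb y ρ := by
    intro τ hτ
    apply upd_mem hρ.le hp
    constructor <;> nlinarith [hτ.1, hτ.2]
  obtain ⟨e, he⟩ := taylor l (fun j τ => (2*ρ)^j * linD g u0 u (List.replicate j k)
      (Function.update p k (y k - ρ + 2 * ρ * τ)))
    ((2*ρ)^l * linD g u0 u (List.replicate l k) x0) ((2*ρ)^l * (δ * ‖u‖))
    (by
      intro j hj τ hτ
      exact line_hasDeriv (linD_tower S.hΩ S.hC u0 u) p k (y k - ρ) (2 * ρ) j hj τ
        (S.hsub (Metric.closedBall_subset_closedBall hr (hQ (hmem τ hτ)))))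
    (by
      intro τ hτ
      rw [← mul_sub, abs_mul, abs_of_pos (by positivity)]
      gcongr
      exact hosc _ (hQ (hmem τ hτ)) k u0 u)
  refine ⟨e, fun τ hτ => ?_⟩
  have := he τ hτ
  simpa [linD_nil] using this

theorem lin_contOn {g : Mp d J} {x0 : Rv d} {l : ℕ} {r1 c : ℝ}
    {Ω : Set (Rv d)} (S : Setup g x0 l r1 c Ω) (u0 : ℝ) (u : Rv J) :
    ContinuousOn (lin g u0 u) Ω := by
  have h := S.hC.continuousOn
  unfold lin
  apply continuousOn_const.add
  apply continuousOn_finsetSum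
  intro a _
  exact continuousOn_const.mul ((continuous_apply a).comp_continuousOn h)

def hyb (z x : Rv d) (k : ℕ) : Fin d → ℝ := fun i => if (i:ℕ) < k then x i else z i

theorem lem_LG {g : Mp d J} {x0 : Rv d} {l : ℕ} {r1 c : ℝ}
    {Ω : Set (Rv d)} (hd : 0 < d) (S : Setup g x0 l r1 c Ω) (κ : ℝ) (hκ : 0 < κ) :
    ∃ r0 > 0, r0 ≤ r1 ∧ ∃ ε > 0, ε ≤ 1 ∧ ∀ y ρ, 0 < ρ →
      cb y ρ ⊆ cb x0 r0 → ∀ u0 u, ∀ xs ∈ cb y ρ,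
      volume {x | x ∈ cb y ρ ∧ |lin g u0 u x| < ε * |lin g u0 u xs|} ≤
        oR κ * volume (cb y ρ) := by
  obtain ⟨ε1, hε1, hε1', hgood⟩ := good1 l (κ / d) (by positivity)
  let δ : ℝ := ε1 ^ (d+1) * c / 2 ^ l
  have hc := S.hc
  have hδ : 0 < δ := by positivity
  obtain ⟨r0, hr0, hr01, hosc⟩ := osc_small S δ hδ
  refine ⟨r0, hr0, hr01, ε1 ^ d, by positivity, pow_le_one₀ hε1.le hε1', ?_⟩
  intro y ρ hρ hQ u0 u xs hxs
  set F := lin g u0 u with hF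
  set Q := cb y ρ with hQd
  by_cases hM0 : F xs = 0
  · have : {x | x ∈ Q ∧ |F x| < ε1 ^ d * |F xs|} = ∅ := by
      ext x; simp only [hM0, abs_zero, mul_zero, Set.mem_ofPred_eq, Set.mem_empty_iff_false, iff_false]
      rintro ⟨-, h⟩
      exact absurd h (not_lt.2 (abs_nonneg _))
    rw [this]; simp
  have hQ1 : Q ⊆ cb x0 r1 :=
    hQ.trans (Metric.closedBall_subset_closedBall hr01)
  obtain ⟨z, hz, hz1, hz2⟩ : ∃ z ∈ Q, |F xs| ≤ |F z| ∧ c * ρ ^ l * ‖u‖ ≤ |F z| := by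
    obtain ⟨w, hw, hw'⟩ := S.hN y ρ hρ hQ1 u0 u
    rcases le_total (|F w|) (|F xs|) with h | h
    · exact ⟨xs, hxs, le_rfl, hw'.trans h⟩
    · exact ⟨w, hw, h, hw'⟩
  set M := |F z| with hM
  have hMpos : 0 < M := (abs_pos.2 hM0).trans_le hz1
  have hFc : ContinuousOn F Q := (lin_contOn S u0 u).mono (hQ1.trans S.hsub)
  have hQm : MeasurableSet Q := Metric.isClosed_closedBall.measurableSet

  have hybQ : ∀ x ∈ Q, ∀ k, hyb z x k ∈ Q := by
    intro x hx k
    rw [hQd, Metric.mem_closedBall, dist_pi_le_iff hρ.le] at hx hz ⊢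
    intro i
    simp only [hyb]
    split_ifs
    · exact hx i
    · exact hz i
  have hybc : ∀ k, Continuous (fun x => hyb z x k) := by
    intro k
    apply continuous_pi
    intro i
    simp only [hyb]
    split_ifs <;> fun_prop
  have hmeas : ∀ k, ContinuousOn (fun x => F (hyb z x k)) Q := fun k =>
    hFc.comp (hybc k).continuousOn (fun x hx => hybQ x hx k)
  let Bad : Fin d → Set (Rv d) := fun k => {x | x ∈ Q ∧ ε1 ^ (k:ℕ) * M ≤ |F (hyb z x k)| ∧
    |F (hyb z x (k+1))| < ε1 ^ ((k:ℕ)+1) * M}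
  have hcover : {x | x ∈ Q ∧ |F x| < ε1 ^ d * |F xs|} ⊆ ⋃ k, Bad k := by
    rintro x ⟨hx, hlt⟩
    by_contra hcon
    have hall : ∀ k ≤ d, ε1 ^ k * M ≤ |F (hyb z x k)| := by
      intro k
      induction k with
      | zero =>
        intro _
        have : hyb z x 0 = z := by ext i; simp [hyb]
        rw [this]; simp [hM]
      | succ k ih =>
        intro hk
        by_contra h
        apply hcon
        rw [Set.mem_iUnion]
        exact ⟨⟨k, hk⟩, hx, ih (by omega), not_le.1 h⟩
    have h1 := hall d le_rfl
    have : hyb z x d = x := by ext i; simp [hyb]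
    rw [this] at h1
    have : ε1 ^ d * |F xs| ≤ ε1 ^ d * M := by gcongr
    linarith
  have hbad : ∀ k, volume (Bad k) ≤ oR (κ / d) * volume Q := by
    intro k
    apply fub k _ _ _ hQm
    · intro x
      by_cases hex : ∃ s, Function.update x k s ∈ Bad k
      swap
      · push Not at hex
        have : {s : ℝ | Function.update x k s ∈ Bad k} = ∅ := by
          ext s; simp [hex s]
        rw [this]; simp
      obtain ⟨s0, hs0⟩ := hex
      set p := hyb z (Function.update x k s0) k with hp
      have hpQ : p ∈ Q := hybQ _ hs0.1 k
      have hpF : ε1 ^ (k:ℕ) * M ≤ |F p| := hs0.2.1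
      have hps : ∀ s, hyb z (Function.update x k s) (k+1) = Function.update p k s := by
        intro s
        ext i
        simp only [hyb, hp]
        by_cases hi : i = k
        · subst hi; simp
        · have hne : (i:ℕ) ≠ k := fun h => hi (Fin.ext h)
          simp only [Function.update_of_ne hi, p, hyb]
          by_cases hlt : (i:ℕ) < k
          · rw [if_pos (by omega), if_pos hlt]
          · rw [if_neg (by omega), if_neg hlt]
      have hsub1 : {s : ℝ | Function.update x k s ∈ Bad k} ⊆
          {s : ℝ | s ∈ Set.Icc (y k - ρ) (y k - ρ + 2 * ρ) ∧
            |F (Function.update p k s)| < ε1 * (ε1 ^ (k:ℕ) * M)} := by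
        rintro s ⟨h1, -, h3⟩
        rw [hps] at h3
        refine ⟨?_, by rw [← mul_assoc, ← pow_succ']; exact h3⟩
        rw [hQd, Metric.mem_closedBall, dist_pi_le_iff hρ.le] at h1
        have := h1 k
        rw [Function.update_self, Real.dist_eq, abs_le] at this
        constructor <;> linarith [this.1, this.2]
      have hsub2 : Set.Icc (y k - ρ) (y k - ρ + 2 * ρ) ⊆
          {s : ℝ | Function.update x k s ∈ Q} := by
        intro s hs
        have := upd_mem hρ.le hs0.1 k s ⟨hs.1, by linarith [hs.2]⟩
        rw [Function.update_idem] at this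
        exact this
      have hQv : oR (2 * ρ) ≤ volume {s : ℝ | Function.update x k s ∈ Q} := by
        refine le_trans ?_ (measure_mono hsub2)
        rw [Real.volume_Icc]; simp
      refine (measure_mono hsub1).trans (le_trans ?_ (mul_le_mul_right hQv _))
      apply vol_Icc_le _ _ (by positivity) (fun s => |F (Function.update p k s)| <
        ε1 * (ε1 ^ (k:ℕ) * M))
      obtain ⟨e, he⟩ := line_taylor S hr01 hosc y ρ hρ hQ p hpQ k u0 u
      have hpk : p k ∈ Set.Icc (y k - ρ) (y k + ρ) := by
        have h1 := hpQ
        rw [hQd, Metric.mem_closedBall, dist_pi_le_iff hρ.le] at h1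
        have := h1 k
        rw [Real.dist_eq, abs_le] at this
        constructor <;> linarith [this.1, this.2]
      apply hgood (fun τ => F (Function.update p k (y k - ρ + 2 * ρ * τ))) e (ε1 ^ (k:ℕ) * M)
        ((p k - (y k - ρ)) / (2 * ρ)) (by positivity)
      · constructor
        · apply div_nonneg _ (by positivity); linarith [hpk.1]
        · rw [div_le_one (by positivity)]; linarith [hpk.2]
      · have : y k - ρ + 2 * ρ * ((p k - (y k - ρ)) / (2 * ρ)) = p k := by field_simp; ring
        simp only [this, Function.update_eq_self]
        exact hpF
      · intro τ hτ
        refine ((he τ hτ).1).trans ?_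
        have e1 : (2 * ρ) ^ l * (δ * ‖u‖) = ε1 ^ (d+1) * (c * ρ ^ l * ‖u‖) := by
          simp only [δ, mul_pow]; field_simp
        rw [e1]
        calc ε1 ^ (d+1) * (c * ρ ^ l * ‖u‖) ≤ ε1 ^ ((k:ℕ)+1) * M := by
              apply mul_le_mul _ hz2 (by positivity) (by positivity)
              exact pow_le_pow_of_le_one hε1.le hε1' (by have := k.2; omega)
          _ = _ := by ring
    · have h1 : MeasurableSet (Q ∩ (fun x => |F (hyb z x k)|) ⁻¹' Set.Ici (ε1 ^ (k:ℕ) * M)) :=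
        ((hmeas k).abs.preimage_isClosed_of_isClosed Metric.isClosed_closedBall isClosed_Ici).measurableSet
      have h2 : MeasurableSet (Q ∩ (fun x => |F (hyb z x (k+1))|) ⁻¹' Set.Ici (ε1 ^ ((k:ℕ)+1) * M)) :=
        ((hmeas (k+1)).abs.preimage_isClosed_of_isClosed Metric.isClosed_closedBall isClosed_Ici).measurableSet
      have h3 : Bad k = (Q ∩ (fun x => |F (hyb z x k)|) ⁻¹' Set.Ici (ε1 ^ (k:ℕ) * M)) \
        (Q ∩ (fun x => |F (hyb z x (k+1))|) ⁻¹' Set.Ici (ε1 ^ ((k:ℕ)+1) * M)) := by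
        ext x
        simp only [Bad, Set.mem_ofPred_eq, Set.mem_diff, Set.mem_inter_iff, Set.mem_preimage,
          Set.mem_Ici, not_and, not_le]
        tauto
      rw [h3]
      exact h1.diff h2
  calc _ ≤ volume (⋃ k, Bad k) := measure_mono hcover
    _ ≤ ∑ k, volume (Bad k) := measure_iUnion_fintype_le _ _
    _ ≤ ∑ k : Fin d, oR (κ / d) * volume Q := Finset.sum_le_sum fun k _ => hbad k
    _ = oR κ * volume Q := by
      rw [Finset.sum_const, Finset.card_univ, Fintype.card_fin, nsmul_eq_mul, ← mul_assoc]
      congr 1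
      rw [← ENNReal.ofReal_natCast, ← ENNReal.ofReal_mul (by positivity)]
      congr 1
      field_simp

end P2b

noncomputable section P5a

variable {d m : ℕ}

abbrev Idx (d m : ℕ) := Unit ⊕ (Fin d ⊕ Fin m)

abbrev iF : Idx d m := Sum.inl ()
abbrev iD (i : Fin d) : Idx d m := Sum.inr (Sum.inl i)
abbrev iW (j : Fin m) : Idx d m := Sum.inr (Sum.inr j)

def Fx (f : Mp d m) (u : Idx d m → ℝ) (x : Rv d) : ℝ :=
  u iF + ((∑ i, x i * u (iD i)) + ∑ j, f x j * u (iW j))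

def Dx (p : (Rv d) → Fin d → Fin m → ℝ) (u : Idx d m → ℝ) (x : Rv d) (i : Fin d) : ℝ :=
  u (iD i) + ∑ j, p x i j * u (iW j)

def RM (f : Mp d m) (p : (Rv d) → Fin d → Fin m → ℝ) (x : Rv d) :
    Matrix (Idx d m) (Idx d m) ℝ :=
  Matrix.fromBlocks 1 (Matrix.of fun _ => Sum.elim (fun i => x i) (fun j => f x j)) 0
    (Matrix.fromBlocks 1 (Matrix.of (p x)) 0 1)

variable (f : Mp d m) (p : (Rv d) → Fin d → Fin m → ℝ)

theorem RM_det (x : Rv d) : (RM f p x).det = 1 := by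
  simp [RM, Matrix.det_fromBlocks_zero₂₁]

theorem RM_F {r : ℕ} (x : Rv d) (b : Matrix (Idx d m) (Fin r) ℝ) (l : Fin r) :
    (RM f p x * b) iF l = Fx f (fun a => b a l) x := by
  simp [Matrix.mul_apply, Fintype.sum_sum_type, RM, Fx, Matrix.fromBlocks]

theorem RM_D {r : ℕ} (x : Rv d) (b : Matrix (Idx d m) (Fin r) ℝ) (l : Fin r) (i : Fin d) :
    (RM f p x * b) (iD i) l = Dx p (fun a => b a l) x i := by
  simp [Matrix.mul_apply, Fintype.sum_sum_type, RM, Dx, Matrix.fromBlocks, Matrix.one_apply]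

theorem RM_W {r : ℕ} (x : Rv d) (b : Matrix (Idx d m) (Fin r) ℝ) (l : Fin r) (j : Fin m) :
    (RM f p x * b) (iW j) l = b (iW j) l := by
  simp [Matrix.mul_apply, Fintype.sum_sum_type, RM, Matrix.fromBlocks, Matrix.one_apply]

def wt (A K ε : ℝ) : Idx d m → ℝ := Sum.elim (fun _ => A) (Sum.elim (fun _ => K⁻¹) (fun _ => ε))

def MM (A K ε : ℝ) (x : Rv d) : Matrix (Idx d m) (Idx d m) ℝ :=
  Matrix.diagonal (wt A K ε) * RM f p x

theorem wt_prod (A K ε : ℝ) (hK : 0 < K) (h : K ^ d = ε ^ m * A) :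
    ∏ a : Idx d m, wt A K ε a = 1 := by
  simp only [Fintype.prod_sum_type, wt, Sum.elim_inl, Sum.elim_inr, Finset.prod_const,
    Finset.card_univ, Fintype.card_fin, Fintype.card_unit, pow_one, inv_pow, h]
  have : ε ^ m * A ≠ 0 := by rw [← h]; positivity
  rw [← div_eq_inv_mul, mul_div_assoc', mul_comm, div_self this]

theorem MM_det (A K ε : ℝ) (hK : 0 < K) (h : K ^ d = ε ^ m * A) (x : Rv d) :
    (MM f p A K ε x).det = 1 := by
  rw [MM, Matrix.det_mul, RM_det, Matrix.det_diagonal, wt_prod A K ε hK h, mul_one]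

theorem MM_apply {r : ℕ} (A K ε : ℝ) (x : Rv d) (b : Matrix (Idx d m) (Fin r) ℝ) (a : Idx d m)
    (l : Fin r) : (MM f p A K ε x * b) a l = wt A K ε a * (RM f p x * b) a l := by
  rw [MM, Matrix.mul_assoc, Matrix.diagonal_mul]

theorem MM_minor {r : ℕ} (A K ε : ℝ) (x : Rv d) (b : Matrix (Idx d m) (Fin r) ℝ)
    (σ : Fin r → Idx d m) : ((MM f p A K ε x * b).submatrix σ id).det =
      (∏ k, wt A K ε (σ k)) * ((RM f p x * b).submatrix σ id).det := by
  rw [← Matrix.det_mul_column]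
  congr 1
  ext k l
  simp [MM_apply]

theorem wt_pos {A K ε : ℝ} (hA : 0 < A) (hK : 0 < K) (hε : 0 < ε) (a : Idx d m) :
    0 < wt A K ε a := by
  rcases a with a | i | j
  · exact hA
  · exact inv_pos.2 hK
  · exact hε

structure Geo (x0 : Rv d) (r0 L cN : ℝ) (l : ℕ) (κ e1 : ℝ) : Prop where
  hd : 0 < d
  hr0 : 0 < r0
  hr1 : r0 ≤ 1
  hL : 1 ≤ L
  hcN : 0 < cN
  he1 : 0 < e1
  he1' : e1 ≤ 1
  cont : ContinuousOn f (cb x0 r0)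
  der : ∀ x ∈ cb x0 r0, ∀ i j,
    HasDerivAt (fun s : ℝ => f (x + s • ev i) j) (p x i j) 0
  lip : ∀ x ∈ cb x0 r0, ∀ x' ∈ cb x0 r0, ∀ i j,
    |p x i j - p x' i j| ≤ L * dist x x'
  npr : ∀ y ρ, 0 < ρ → cb y ρ ⊆ cb x0 r0 → ∀ u : Idx d m → ℝ,
    ∃ x ∈ cb y ρ, ∀ b, cN * ρ ^ l * |u (Sum.inr b)| ≤ |Fx f u x|
  lg : ∀ y ρ, 0 < ρ → cb y ρ ⊆ cb x0 r0 → ∀ u : Idx d m → ℝ,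
    ∀ xs ∈ cb y ρ,
    volume {x | x ∈ cb y ρ ∧ |Fx f u x| < e1 * |Fx f u xs|} ≤
      oR κ * volume (cb y ρ)

theorem det_tri {r : ℕ} (X : Matrix (Fin r) (Fin r) ℝ) (b : Fin r → ℕ)
    (h : ∀ i j, i ≠ j → X i j ≠ 0 → b i < b j) : X.det = ∏ i, X i i := by
  rw [Matrix.det_apply', Finset.sum_eq_single 1]
  · simp
  · intro σ _ hσ
    have : ∃ i, X (σ i) i = 0 := by
      by_contra hcon
      push Not at hcon
      apply hσ
      have hle : ∀ i, b (σ i) ≤ b i := by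
        intro i
        by_cases hi : σ i = i
        · rw [hi]
        · exact (h _ _ hi (hcon i)).le
      have hsum : ∑ i, b (σ i) = ∑ i, b i := Equiv.sum_comp σ b
      have heq := (Finset.sum_eq_sum_iff_of_le (fun i _ => hle i)).1 hsum
      ext i
      by_contra hi
      have hi' : σ i ≠ i := fun hh => hi (by simp [hh])
      have := h _ _ hi' (hcon i)
      have := heq i (Finset.mem_univ i)
      omega
    obtain ⟨i, hi⟩ := this
    have h0 := Finset.prod_eq_zero (f := fun i => X (σ i) i) (Finset.mem_univ i) hi
    rw [h0, mul_zero]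
  · simp

theorem det_row_bound {r : ℕ} (X : Matrix (Fin r) (Fin r) ℝ) (w : Rv r)
    (h : ∀ i j, |X i j| ≤ w i) : |X.det| ≤ (r.factorial : ℝ) * ∏ i, w i := by
  rw [Matrix.det_apply']
  refine (Finset.abs_sum_le_sum_abs _ _).trans ?_
  have : ∀ σ ∈ (Finset.univ : Finset (Equiv.Perm (Fin r))),
      |((Equiv.Perm.sign σ : ℤ) : ℝ) * ∏ i, X (σ i) i| ≤ ∏ i, w i := by
    intro σ _
    have h1 : |((Equiv.Perm.sign σ : ℤ) : ℝ)| = 1 := by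
      rcases Int.units_eq_one_or (Equiv.Perm.sign σ) with e | e <;> simp [e]
    rw [abs_mul, h1, one_mul, Finset.abs_prod, ← Equiv.prod_comp σ w]
    exact Finset.prod_le_prod (fun i _ => abs_nonneg _) (fun i _ => h _ _)
  refine (Finset.sum_le_sum this).trans ?_
  simp [Fintype.card_perm]

theorem det_updateRow_sum {r : ℕ} (X : Matrix (Fin r) (Fin r) ℝ) (k : Fin r) (v : Rv r) :
    (X.updateRow k v).det = ∑ l, X.adjugate l k * v l := by
  rw [← Matrix.cramer_transpose_apply, Matrix.cramer_eq_adjugate_mulVec, Matrix.mulVec,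
    dotProduct]
  apply Finset.sum_congr rfl
  intro l _
  rw [← Matrix.adjugate_transpose]; rfl

theorem det_one_upd {r : ℕ} (k : Fin r) (v : Rv r) :
    ((1 : Matrix (Fin r) (Fin r) ℝ).updateRow k v).det = v k := by
  rw [det_updateRow_sum]
  simp [Matrix.one_apply]

theorem submat_mul {r : ℕ} (R : Matrix (Idx d m) (Idx d m) ℝ) (b : Matrix (Idx d m) (Fin r) ℝ)
    (σ : Fin r → Idx d m) : (R * b).submatrix σ id = (R.submatrix σ id) * b := by
  ext i j; simp [Matrix.mul_apply]

def nb {r : ℕ} (b : Matrix (Idx d m) (Fin r) ℝ) (σ : Fin r → Idx d m) :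
    Matrix (Idx d m) (Fin r) ℝ := b * (b.submatrix σ id)⁻¹

theorem nb_mul {r : ℕ} {b : Matrix (Idx d m) (Fin r) ℝ} {σ : Fin r → Idx d m}
    (h : (b.submatrix σ id).det ≠ 0) : nb b σ * (b.submatrix σ id) = b := by
  rw [nb, Matrix.mul_assoc, Matrix.nonsing_inv_mul _ (isUnit_iff_ne_zero.2 h), Matrix.mul_one]

theorem nb_minor {r : ℕ} {b : Matrix (Idx d m) (Fin r) ℝ} {σ : Fin r → Idx d m}
    (h : (b.submatrix σ id).det ≠ 0) (R : Matrix (Idx d m) (Idx d m) ℝ) (τ : Fin r → Idx d m) :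
    ((R * b).submatrix τ id).det =
      ((R * nb b σ).submatrix τ id).det * (b.submatrix σ id).det := by
  rw [← Matrix.det_mul]
  congr 1
  conv_lhs => rw [← nb_mul h, ← Matrix.mul_assoc]
  ext i j; simp [Matrix.mul_apply]

theorem nb_minor1 {r : ℕ} {b : Matrix (Idx d m) (Fin r) ℝ} {σ : Fin r → Idx d m}
    (h : (b.submatrix σ id).det ≠ 0) (τ : Fin r → Idx d m) :
    (b.submatrix τ id).det = ((nb b σ).submatrix τ id).det * (b.submatrix σ id).det := by
  have := nb_minor h 1 τ
  simpa using this

theorem nb_one {r : ℕ} {b : Matrix (Idx d m) (Fin r) ℝ} {σ : Fin r → Idx d m}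
    (h : (b.submatrix σ id).det ≠ 0) (k l : Fin r) : nb b σ (σ k) l = if k = l then 1 else 0 := by
  have : (nb b σ).submatrix σ id = 1 := by
    have h1 : (nb b σ).submatrix σ id = (b.submatrix σ id) * (b.submatrix σ id)⁻¹ := by
      ext i j; simp [nb, Matrix.mul_apply]
    rw [h1, Matrix.mul_nonsing_inv _ (isUnit_iff_ne_zero.2 h)]
  have h2 := congrFun (congrFun this k) l
  simpa [Matrix.one_apply] using h2

theorem nb_upd {r : ℕ} {b : Matrix (Idx d m) (Fin r) ℝ} {σ : Fin r → Idx d m}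
    (h : (b.submatrix σ id).det ≠ 0) (k : Fin r) (a : Idx d m) :
    (b.submatrix (Function.update σ k a) id).det = nb b σ a k * (b.submatrix σ id).det := by
  rw [nb_minor1 h]
  congr 1
  rw [← det_one_upd k (fun l => nb b σ a l)]
  congr 1
  ext i j
  by_cases hi : i = k
  · subst hi; simp
  · simp [hi, nb_one h, Matrix.one_apply]

theorem inj_of_det {r : ℕ} {b : Matrix (Idx d m) (Fin r) ℝ} {σ : Fin r → Idx d m}
    (h : (b.submatrix σ id).det ≠ 0) : Function.Injective σ := by
  intro i j hij
  by_contra hne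
  exact h (Matrix.det_zero_of_row_eq hne (by ext l; simp [hij]))

theorem nb_int {r : ℕ} (B : Matrix (Idx d m) (Fin r) ℤ) {σ : Fin r → Idx d m}
    (h : ((rm B).submatrix σ id).det ≠ 0) (a : Idx d m) (k : Fin r) :
    ∃ z : ℤ, nb (rm B) σ a k * ((rm B).submatrix σ id).det = z := by
  rw [← nb_upd h k a]
  refine ⟨(B.submatrix (Function.update σ k a) id).det, ?_⟩
  rw [Int.cast_det]; rfl

theorem int_abs_ge {x : ℝ} (h : ∃ z : ℤ, x = z) (hx : x ≠ 0) : 1 ≤ |x| := by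
  obtain ⟨z, rfl⟩ := h
  have : z ≠ 0 := by rintro rfl; simp at hx
  exact_mod_cast Int.one_le_abs this

theorem Fx_sum {r : ℕ} (b : Matrix (Idx d m) (Fin r) ℝ) (c : Rv r) (x : Rv d) :
    Fx f (fun a => ∑ l, c l * b a l) x = ∑ l, c l * Fx f (fun a => b a l) x := by
  simp only [Fx, mul_add, Finset.sum_add_distrib, Finset.mul_sum]
  congr 1
  congr 1
  · rw [Finset.sum_comm]
    apply Finset.sum_congr rfl; intro l _; apply Finset.sum_congr rfl; intro i _; ring
  · rw [Finset.sum_comm]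
    apply Finset.sum_congr rfl; intro l _; apply Finset.sum_congr rfl; intro i _; ring

end P5a

noncomputable section P5b

variable {d m : ℕ} {f : Mp d m} {p : (Rv d) → Fin d → Fin m → ℝ}
  {x0 : Rv d} {r0 L cN : ℝ} {l : ℕ} {κ e1 : ℝ} {A K ε : ℝ}

def TM (p : (Rv d) → Fin d → Fin m → ℝ) (K ε : ℝ) (x xs : Rv d) :
    Matrix (Idx d m) (Idx d m) ℝ :=
  Matrix.fromBlocks 1 0 0
    (Matrix.fromBlocks 1 (Matrix.of fun i j => (K * ε)⁻¹ * (p xs i j - p x i j)) 0 1)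

theorem TM_mul_F {r : ℕ} (x xs) (X : Matrix (Idx d m) (Fin r) ℝ) (q) :
    (TM p K ε x xs * X) iF q = X iF q := by
  simp [Matrix.mul_apply, Fintype.sum_sum_type, TM, Matrix.fromBlocks]

theorem TM_D0 {r : ℕ} (x xs) (X : Matrix (Idx d m) (Fin r) ℝ) (i q) :
    (TM p K ε x xs * X) (iD i) q =
      X (iD i) q + ∑ j, (K * ε)⁻¹ * (p xs i j - p x i j) * X (iW j) q := by
  simp [Matrix.mul_apply, Fintype.sum_sum_type, TM, Matrix.fromBlocks, Matrix.one_apply]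

theorem TM_mul_D {r : ℕ} (hK : 0 < K) (hε : 0 < ε) (x xs) (b : Matrix (Idx d m) (Fin r) ℝ) (i q) :
    (TM p K ε x xs * (MM f p A K ε x * b)) (iD i) q = (MM f p A K ε xs * b) (iD i) q := by
  rw [TM_D0]
  simp only [MM_apply, RM_D, RM_W, wt, Sum.elim_inl, Sum.elim_inr, Dx, mul_add, Finset.mul_sum]
  rw [add_assoc, ← Finset.sum_add_distrib]
  congr 1
  apply Finset.sum_congr rfl
  intro j _
  field_simp
  ring

theorem TM_W0 {r : ℕ} (x xs) (X : Matrix (Idx d m) (Fin r) ℝ) (j q) :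
    (TM p K ε x xs * X) (iW j) q = X (iW j) q := by
  simp [Matrix.mul_apply, Fintype.sum_sum_type, TM, Matrix.fromBlocks, Matrix.one_apply]

theorem TM_mul_W {r : ℕ} (x xs) (b : Matrix (Idx d m) (Fin r) ℝ) (j q) :
    (TM p K ε x xs * (MM f p A K ε x * b)) (iW j) q = (MM f p A K ε xs * b) (iW j) q := by
  rw [TM_W0, MM_apply, MM_apply, RM_W, RM_W]

theorem TM_bound (G : Geo f p x0 r0 L cN l κ e1) (hK : 0 < K) (hε : 0 < ε) {y : Rv d} {ρ : ℝ}
    (hQ : cb y ρ ⊆ cb x0 r0) (hρ : ρ ≤ 2 * (K * ε)) {x xs : Rv d}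
    (hx : x ∈ cb y ρ) (hxs : xs ∈ cb y ρ) (a a' : Idx d m) :
    |TM p K ε x xs a a'| ≤ 4 * L := by
  have hL := G.hL
  have hKε : 0 < K * ε := mul_pos hK hε
  by_cases h : ∃ i j, a = iD i ∧ a' = iW j
  · obtain ⟨i, j', rfl, rfl⟩ := h
    have h1 := G.lip xs (hQ hxs) x (hQ hx) i j'
    have h2 : dist xs x ≤ 2 * ρ := by
      have := dist_triangle_right xs x y
      rw [Metric.mem_closedBall] at hx hxs
      linarith
    have e : TM p K ε x xs (iD i) (iW j') = (K * ε)⁻¹ * (p xs i j' - p x i j') := rfl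
    rw [e, abs_mul, abs_of_pos (inv_pos.2 hKε), inv_mul_le_iff₀ hKε]
    calc _ ≤ _ := h1
      _ ≤ L * (4 * (K * ε)) := by gcongr; linarith
      _ = _ := by ring
  · rcases a with a | i | j <;> rcases a' with a' | i' | j' <;>
      simp [TM, Matrix.fromBlocks, Matrix.one_apply] at h ⊢ <;>
      (try split_ifs) <;> (try simp) <;> linarith

theorem frozen (G : Geo f p x0 r0 L cN l κ e1) (hA : 0 < A) (hK : 0 < K) (hε : 0 < ε)
    {y : Rv d} {ρ : ℝ} (h0 : 0 < ρ)
    (hQ : cb y ρ ⊆ cb x0 r0) (hρ : ρ ≤ 2 * (K * ε)) {r : ℕ} (b : Matrix (Idx d m) (Fin r) ℝ)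
    {c3 : ℝ} (hc : (4 * L) ^ r * c3 * (2 * (Fintype.card (Idx d m) : ℝ) ^ r) ≤ e1)
    {xs : Rv d} (hxs : xs ∈ cb y ρ) (h1 : 1 ≤ psi (MM f p A K ε xs * b)) :
    volume {x | x ∈ cb y ρ ∧ psi (MM f p A K ε x * b) < c3} ≤
      oR κ * volume (cb y ρ) := by
  have hcard : (0 : ℝ) < (Fintype.card (Idx d m) : ℝ) ^ r := by
    have : 0 < Fintype.card (Idx d m) := Fintype.card_pos
    positivity
  obtain ⟨σ, hσ⟩ := exists_minor_of_psi (MM f p A K ε xs * b)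
    (1 / (2 * (Fintype.card (Idx d m) : ℝ) ^ r)) (by
      refine lt_of_lt_of_le ?_ h1
      field_simp; norm_num)
  have hL4 : (0 : ℝ) < (4 * L) ^ r := by have := G.hL; positivity
  have hlow : (4 * L) ^ r * c3 ≤ e1 * |((MM f p A K ε xs * b).submatrix σ id).det| := by
    have h2 : (4 * L) ^ r * c3 ≤ e1 * (1 / (2 * (Fintype.card (Idx d m) : ℝ) ^ r)) := by
      rw [mul_one_div, le_div_iff₀ (by positivity)]; exact hc
    exact h2.trans (mul_le_mul_of_nonneg_left hσ.le G.he1.le)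
  have hup : ∀ x ∈ cb y ρ,
      |((TM p K ε x xs * (MM f p A K ε x * b)).submatrix σ id).det| ≤
        (4 * L) ^ r * psi (MM f p A K ε x * b) := by
    intro x hx
    have := abs_det_mul_le ((TM p K ε x xs).submatrix σ id) (MM f p A K ε x * b) (4 * L)
      (fun i a => TM_bound G hK hε hQ hρ hx hxs _ _)
    rwa [submat_mul]
  have hne : ((MM f p A K ε xs * b).submatrix σ id).det ≠ 0 := by
    intro h; rw [h, abs_zero] at hσ
    have : (0 : ℝ) < 1 / (2 * (Fintype.card (Idx d m) : ℝ) ^ r) := by positivity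
    linarith
  by_cases hF : ∃ k, σ k = iF
  · obtain ⟨k, hk⟩ := hF
    have hinj := inj_of_det hne
    set X := (MM f p A K ε xs * b).submatrix σ id with hX
    have hform : ∀ x, ((TM p K ε x xs * (MM f p A K ε x * b)).submatrix σ id).det =
        A * Fx f (fun a => ∑ q, X.adjugate q k * b a q) x := by
      intro x
      have e : (TM p K ε x xs * (MM f p A K ε x * b)).submatrix σ id =
          X.updateRow k (fun q => A * Fx f (fun a => b a q) x) := by
        ext k' q
        by_cases hkk : k' = k
        · subst hkk
          simp only [Matrix.submatrix_apply, id, hk, Matrix.updateRow_self]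
          rw [TM_mul_F, MM_apply, RM_F]; rfl
        · rw [Matrix.updateRow_ne hkk]
          have h2 : σ k' ≠ iF := fun h => hkk (hinj (h.trans hk.symm))
          simp only [Matrix.submatrix_apply, id, hX]
          rcases h3 : σ k' with a | i | j
          · exact absurd h3 h2
          · exact TM_mul_D hK hε x xs b i q
          · exact TM_mul_W x xs b j q
      rw [e, det_updateRow_sum, Fx_sum, Finset.mul_sum]
      apply Finset.sum_congr rfl; intro q _; ring
    have hxx : X.det = A * Fx f (fun a => ∑ q, X.adjugate q k * b a q) xs := by
      rw [← hform xs]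
      congr 1
      ext k' q
      simp only [Matrix.submatrix_apply, id, hX]
      rcases h3 : σ k' with a | i | j
      · rw [TM_mul_F]
      · exact (TM_mul_D hK hε xs xs b i q).symm
      · exact (TM_mul_W xs xs b j q).symm
    refine le_trans (measure_mono ?_) (G.lg y ρ h0 hQ (fun a => ∑ q, X.adjugate q k * b a q) xs hxs)
    rintro x ⟨hx, hlt⟩
    refine ⟨hx, ?_⟩
    have h2 := hup x hx
    rw [hform x, abs_mul, abs_of_pos hA] at h2
    rw [hxx, abs_mul, abs_of_pos hA] at hlow
    have h3 : (4 * L) ^ r * psi (MM f p A K ε x * b) < (4 * L) ^ r * c3 := by gcongr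
    have : A * |Fx f (fun a => ∑ q, X.adjugate q k * b a q) x| <
      A * (e1 * |Fx f (fun a => ∑ q, X.adjugate q k * b a q) xs|) := by linarith
    exact lt_of_mul_lt_mul_left this hA.le
  · push Not at hF
    have : {x | x ∈ cb y ρ ∧ psi (MM f p A K ε x * b) < c3} = ∅ := by
      ext x
      simp only [Set.mem_ofPred_eq, Set.mem_empty_iff_false, iff_false, not_and, not_lt]
      intro hx
      have h2 := hup x hx
      have e : (TM p K ε x xs * (MM f p A K ε x * b)).submatrix σ id =
          (MM f p A K ε xs * b).submatrix σ id := by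
        ext k' q
        simp only [Matrix.submatrix_apply, id]
        rcases h3 : σ k' with a | i | j
        · exact absurd h3 (hF k')
        · exact TM_mul_D hK hε x xs b i q
        · exact TM_mul_W x xs b j q
      rw [e] at h2
      have h3 : (4 * L) ^ r * c3 ≤ (4 * L) ^ r * psi (MM f p A K ε x * b) := by
        have := G.he1'
        have h4 : e1 * |((MM f p A K ε xs * b).submatrix σ id).det| ≤
          1 * |((MM f p A K ε xs * b).submatrix σ id).det| := by gcongr
        linarith
      exact le_of_mul_le_mul_left h3 hL4
    rw [this]; simp

end P5b

noncomputable section P5c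

variable {d m : ℕ} {f : Mp d m} {p : (Rv d) → Fin d → Fin m → ℝ}
  {x0 : Rv d} {r0 L cN : ℝ} {l : ℕ} {κ e1 : ℝ} {A K ε : ℝ}

theorem Fx_line (G : Geo f p x0 r0 L cN l κ e1) (u : Idx d m → ℝ) (x : Rv d) (i : Fin d)
    (s0 : ℝ) (hx : x + s0 • ev i ∈ cb x0 r0) :
    HasDerivAt (fun s : ℝ => Fx f u (x + s • ev i)) (Dx p u (x + s0 • ev i) i) s0 := by
  unfold Fx Dx
  have h1 : HasDerivAt (fun s : ℝ => ∑ i', (x + s • ev i) i' * u (iD i')) (u (iD i)) s0 := by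
    have : HasDerivAt (fun s : ℝ => ∑ i', (x + s • ev i) i' * u (iD i'))
        (∑ i', (if i' = i then 1 else 0) * u (iD i')) s0 := by
      refine HasDerivAt.fun_sum fun i' _ => ?_
      refine HasDerivAt.mul_const ?_ _
      have e : (fun s : ℝ => (x + s • ev i) i') = fun s => x i' + s * (if i' = i then 1 else 0) := by
        funext s; simp [ev, Pi.single_apply]
      rw [e]
      simpa using ((hasDerivAt_id s0).mul_const (if i' = i then (1 : ℝ) else 0)).const_add (x i')
    simpa using this
  have h2 : HasDerivAt (fun s : ℝ => ∑ j, f (x + s • ev i) j * u (iW j))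
      (∑ j, p (x + s0 • ev i) i j * u (iW j)) s0 := by
    refine HasDerivAt.fun_sum fun j _ => ?_
    refine HasDerivAt.mul_const ?_ _
    have h3 := G.der _ hx i j
    have h4 : HasDerivAt (fun s : ℝ => s - s0) 1 s0 := by
      simpa using (hasDerivAt_id s0).sub_const s0
    have h5 := HasDerivAt.comp_of_eq s0 (h₂ := fun s : ℝ => f (x + s0 • ev i + s • ev i) j) h3 h4
      (by simp)
    rw [mul_one] at h5
    convert h5 using 2 with s
    simp only [Function.comp]
    congr 1
    rw [add_assoc, ← add_smul]; congr 2; ring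
  simpa using (h1.add h2).const_add (u iF)

theorem D_bound (G : Geo f p x0 r0 L cN l κ e1) {y : Rv d} {ρ : ℝ}
    (hQ : cb y ρ ⊆ cb x0 r0) (u : Idx d m → ℝ) {w : ℝ} (hw : ∀ j, |u (iW j)| ≤ w)
    (x : Rv d) (i : Fin d) (s : ℝ) (hx : x ∈ cb y ρ) (hs : x + s • ev i ∈ cb y ρ) :
    |Dx p u x i| * |s| ≤ |Fx f u (x + s • ev i)| + |Fx f u x| + m * (L * |s| * w) * |s| := by
  have hmem : ∀ τ ∈ Icc (0 : ℝ) 1, x + (τ * s) • ev i ∈ cb y ρ := by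
    intro τ hτ
    have := (convex_closedBall y ρ) hx hs (a := 1 - τ) (b := τ) (by linarith [hτ.2]) hτ.1 (by ring)
    convert this using 1
    ext q; simp; ring
  have hder : ∀ τ ∈ Icc (0 : ℝ) 1, HasDerivAt (fun τ : ℝ => Fx f u (x + (τ * s) • ev i))
      (Dx p u (x + (τ * s) • ev i) i * s) τ := by
    intro τ hτ
    have h1 := Fx_line G u x i (τ * s) (hQ (hmem τ hτ))
    have h2 : HasDerivAt (fun τ : ℝ => τ * s) s τ := by simpa using (hasDerivAt_id τ).mul_const s
    exact HasDerivAt.comp τ (h₂ := fun s : ℝ => Fx f u (x + s • ev i)) (h := fun τ : ℝ => τ * s) h1 h2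
  obtain ⟨ξ, hξ, he⟩ := exists_hasDerivAt_eq_slope (fun τ : ℝ => Fx f u (x + (τ * s) • ev i))
    (fun τ => Dx p u (x + (τ * s) • ev i) i * s) zero_lt_one
    (fun τ hτ => (hder τ hτ).continuousAt.continuousWithinAt)
    (fun τ hτ => hder τ ⟨hτ.1.le, hτ.2.le⟩)
  simp only [zero_mul, zero_smul, add_zero, sub_zero, div_one, one_mul] at he
  have hξ' : ξ ∈ Icc (0 : ℝ) 1 := ⟨hξ.1.le, hξ.2.le⟩
  have hdiff : |Dx p u x i - Dx p u (x + (ξ * s) • ev i) i| ≤ m * (L * |s| * w) := by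
    have : Dx p u x i - Dx p u (x + (ξ * s) • ev i) i =
        ∑ j, (p x i j - p (x + (ξ * s) • ev i) i j) * u (iW j) := by
      simp only [Dx, _root_.sub_mul, Finset.sum_sub_distrib]; ring
    rw [this]
    refine (Finset.abs_sum_le_sum_abs _ _).trans ?_
    refine (Finset.sum_le_card_nsmul _ _ (L * |s| * w) ?_).trans (by simp)
    intro j _
    rw [abs_mul]
    have h1 := G.lip x (hQ hx) _ (hQ (hmem ξ hξ')) i j
    have h2 : dist x (x + (ξ * s) • ev i) ≤ |s| := by
      rw [dist_eq_norm]
      have : x - (x + (ξ * s) • ev i) = -((ξ * s) • ev i) := by abel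
      rw [this, norm_neg, norm_smul, Real.norm_eq_abs, abs_mul, abs_of_nonneg hξ'.1]
      have h3 : ‖(ev i : Rv d)‖ = 1 := by rw [ev, Pi.norm_single]; simp
      rw [h3, mul_one]
      exact mul_le_of_le_one_left (abs_nonneg _) hξ'.2
    have hL := G.hL
    exact mul_le_mul (h1.trans (by gcongr)) (hw j) (abs_nonneg _) (by positivity)
  calc |Dx p u x i| * |s| ≤ (|Dx p u (x + (ξ * s) • ev i) i| +
        |Dx p u x i - Dx p u (x + (ξ * s) • ev i) i|) * |s| := by
        gcongr
        have := abs_add_le (Dx p u (x + (ξ * s) • ev i) i)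
          (Dx p u x i - Dx p u (x + (ξ * s) • ev i) i)
        simpa using this
    _ ≤ (|Dx p u (x + (ξ * s) • ev i) i| + m * (L * |s| * w)) * |s| := by gcongr
    _ = |Dx p u (x + (ξ * s) • ev i) i * s| + m * (L * |s| * w) * |s| := by rw [abs_mul]; ring
    _ ≤ _ := by rw [he]; gcongr; exact abs_sub _ _

theorem exists_shift {x y : Rv d} {ρ s : ℝ} (hs : 0 ≤ s) (hsρ : s ≤ ρ) (hx : x ∈ cb y ρ)
    (i : Fin d) : ∃ s', |s'| = s ∧ x + s' • ev i ∈ cb y ρ := by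
  have hρ : 0 ≤ ρ := hs.trans hsρ
  rw [Metric.mem_closedBall, dist_pi_le_iff hρ] at hx
  have key : ∀ s', |s'| = s → |x i + s' - y i| ≤ ρ → x + s' • ev i ∈ cb y ρ := by
    intro s' _ h
    rw [Metric.mem_closedBall, dist_pi_le_iff hρ]
    intro q
    by_cases hq : q = i
    · subst hq; simpa [ev, Real.dist_eq] using h
    · simpa [ev, hq] using hx q
  have h1 := hx i
  rw [Real.dist_eq, abs_le] at h1
  rcases le_total (x i) (y i) with h | h
  · exact ⟨s, abs_of_nonneg hs, key s (abs_of_nonneg hs) (by rw [abs_le]; constructor <;> linarith)⟩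
  · exact ⟨-s, by rw [abs_neg, abs_of_nonneg hs], key (-s) (by rw [abs_neg, abs_of_nonneg hs])
      (by rw [abs_le]; constructor <;> linarith)⟩

theorem wt_inj {r : ℕ} (τ : Fin r → Idx d m) (hτ : Function.Injective τ) (hA : 0 < A) (hK : 1 ≤ K)
    (hε : 0 < ε) (hε1 : ε ≤ 1) (h : K ^ d = ε ^ m * A) (k0 : Fin r) (hk0 : τ k0 = iF) :
    1 ≤ ∏ k, wt A K ε (τ k) ∧
      ((∃ i, ∀ k, τ k ≠ iD i) → K ≤ ∏ k, wt A K ε (τ k)) := by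
  classical
  have hK0 : 0 < K := by linarith
  set S : Finset (Idx d m) := Finset.univ.image τ with hS
  have h1 : ∏ k, wt A K ε (τ k) = ∏ a ∈ S, wt A K ε a := by
    rw [hS, Finset.prod_image (fun a _ b _ hab => hτ hab)]
  have h2 : (∏ a ∈ S, wt A K ε a) * ∏ a ∈ Sᶜ, wt A K ε a = 1 := by
    rw [Finset.prod_mul_prod_compl, wt_prod A K ε hK0 h]
  have hF : ∀ a ∈ Sᶜ, wt A K ε a ≤ 1 := by
    intro a ha
    rcases a with a | i | j
    · exfalso; rw [Finset.mem_compl] at ha; apply ha; rw [hS, Finset.mem_image]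
      exact ⟨k0, Finset.mem_univ _, hk0⟩
    · exact inv_le_one_of_one_le₀ hK
    · exact hε1
  have hpos : ∀ a : Idx d m, 0 < wt A K ε a := wt_pos hA hK0 hε
  have hP : 0 < ∏ a ∈ S, wt A K ε a := Finset.prod_pos fun a _ => hpos a
  rw [h1]
  constructor
  · have h3 : ∏ a ∈ Sᶜ, wt A K ε a ≤ 1 := Finset.prod_le_one (fun a _ => (hpos a).le) hF
    nlinarith
  · rintro ⟨i, hi⟩
    have hmem : iD i ∈ Sᶜ := by
      rw [Finset.mem_compl, hS, Finset.mem_image]; rintro ⟨k, _, hk⟩; exact hi k hk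
    have h3 : ∏ a ∈ Sᶜ, wt A K ε a ≤ K⁻¹ := by
      rw [← Finset.mul_prod_erase _ _ hmem]
      have : ∏ a ∈ Sᶜ.erase (iD i), wt A K ε a ≤ 1 :=
        Finset.prod_le_one (fun a _ => (hpos a).le) (fun a ha => hF a (Finset.mem_of_mem_erase ha))
      have e : wt A K ε (iD i : Idx d m) = K⁻¹ := rfl
      rw [e]
      exact mul_le_of_le_one_right (inv_nonneg.2 hK0.le) this
    have h4 : 1 ≤ (∏ a ∈ S, wt A K ε a) * K⁻¹ := by rw [← h2]; gcongr
    rwa [← div_eq_mul_inv, le_div_iff₀ hK0, one_mul] at h4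

end P5c

noncomputable section P5d

variable {d m : ℕ} {f : Mp d m} {p : (Rv d) → Fin d → Fin m → ℝ}
  {x0 : Rv d} {r0 L cN : ℝ} {l : ℕ} {κ e1 : ℝ} {A K ε : ℝ}

abbrev sW {r : ℕ} (σ : Fin r → Fin m) : Fin r → Idx d m := fun k => iW (σ k)

structure MaxW {r : ℕ} (b : Matrix (Idx d m) (Fin r) ℝ) (σ : Fin r → Fin m) : Prop where
  ge : 1 ≤ |(b.submatrix (sW σ) id).det|
  mx : ∀ σ' : Fin r → Fin m, |(b.submatrix (sW σ') id).det| ≤ |(b.submatrix (sW σ) id).det|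

theorem rm_det_int {r : ℕ} (B : Matrix (Idx d m) (Fin r) ℤ) (σ : Fin r → Idx d m) :
    ∃ z : ℤ, ((rm B).submatrix σ id).det = z := by
  refine ⟨(B.submatrix σ id).det, ?_⟩
  rw [Int.cast_det]; rfl

theorem exists_MaxW {r : ℕ} (B : Matrix (Idx d m) (Fin r) ℤ)
    (h : ∃ σ : Fin r → Fin m, ((rm B).submatrix (sW σ) id).det ≠ 0) : ∃ σ, MaxW (rm B) σ := by
  obtain ⟨σ1, h1⟩ := h
  haveI : Nonempty (Fin r → Fin m) := ⟨σ1⟩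
  obtain ⟨σ, hσ⟩ := Finite.exists_max (fun σ : Fin r → Fin m => |((rm B).submatrix (sW σ) id).det|)
  refine ⟨σ, ?_, hσ⟩
  exact (int_abs_ge (rm_det_int B _) h1).trans (hσ σ1)

variable {r : ℕ} {b : Matrix (Idx d m) (Fin r) ℝ} {σ : Fin r → Fin m}

theorem MaxW.ne (h : MaxW b σ) : (b.submatrix (sW σ) id).det ≠ 0 := by
  intro h0; have := h.ge; rw [h0] at this; norm_num at this

theorem MaxW.rle (h : MaxW b σ) : r ≤ m := by
  have := inj_of_det h.ne
  have h2 : Function.Injective σ := fun i j hij => this (by simp [sW, hij])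
  simpa using Fintype.card_le_of_injective σ h2

theorem MaxW.le_one (h : MaxW b σ) (j : Fin m) (k : Fin r) : |nb b (sW σ) (iW j) k| ≤ 1 := by
  have h1 := nb_upd h.ne k (iW j)
  have h2 : Function.update (sW σ) k (iW j : Idx d m) = sW (Function.update σ k j) := by
    ext k'
    by_cases hk : k' = k
    · subst hk; simp [sW]
    · simp [sW, hk]
  have h3 := h.mx (Function.update σ k j)
  rw [← h2, h1, abs_mul] at h3
  have := h.ge
  by_contra hc
  push Not at hc
  nlinarith

def uk (b : Matrix (Idx d m) (Fin r) ℝ) (s : Fin r → Idx d m) (k : Fin r) : Idx d m → ℝ :=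
  fun a => nb b s a k

def Chi (f : Mp d m) (A ε : ℝ) (b : Matrix (Idx d m) (Fin r) ℝ)
    (s : Fin r → Idx d m) (x : Rv d) : Prop :=
  1 ≤ ε ^ r * |(b.submatrix s id).det| ∨
    ∃ k, 1 ≤ A * ε ^ (r - 1) * |(b.submatrix s id).det| * |Fx f (uk b s k) x|

theorem chi_const (hε : 0 < ε) (x : Rv d) :
    ε ^ r * |(b.submatrix (sW σ) id).det| ≤ psi (MM f p A K ε x * b) := by
  have := minor_le_psi (MM f p A K ε x * b) (sW σ)
  have e2 : (RM f p x * b).submatrix (sW σ) id = b.submatrix (sW σ) id := by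
    ext k q; exact RM_W f p x b q (σ k)
  rw [MM_minor, abs_mul, e2] at this
  have e : ∏ k, wt A K ε (sW σ k : Idx d m) = ε ^ r := by simp [sW, wt]
  rwa [e, abs_of_pos (pow_pos hε r)] at this

theorem wt_upd (k : Fin r) : ∏ k', wt A K ε (Function.update (sW σ) k iF k' : Idx d m) =
    A * ε ^ (r - 1) := by
  have : ∀ k', wt A K ε (Function.update (sW σ) k iF k' : Idx d m) =
      Function.update (fun _ => ε) k A k' := by
    intro k'
    by_cases hk : k' = k
    · subst hk; simp [wt]
    · simp [hk, wt]
  simp only [this]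
  rw [Finset.prod_update_of_mem (Finset.mem_univ k)]
  simp [Finset.card_sdiff]

theorem chi_minor (h : MaxW b σ) (hA : 0 < A) (hε : 0 < ε) (k : Fin r) (x : Rv d) :
    A * ε ^ (r - 1) * |(b.submatrix (sW σ) id).det| * |Fx f (uk b (sW σ) k) x| ≤
      psi (MM f p A K ε x * b) := by
  have := minor_le_psi (MM f p A K ε x * b) (Function.update (sW σ) k iF)
  rw [MM_minor, wt_upd, nb_minor h.ne] at this
  have e : ((RM f p x * nb b (sW σ)).submatrix (Function.update (sW σ) k iF) id).det =
      Fx f (uk b (sW σ) k) x := by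
    have := det_one_upd k (fun q => Fx f (uk b (sW σ) q) x)
    rw [← this]
    congr 1
    ext k' q
    by_cases hk : k' = k
    · subst hk
      simp only [Matrix.submatrix_apply, id, Function.update_self, Matrix.updateRow_self]
      rw [RM_F]; rfl
    · rw [Matrix.updateRow_ne hk]
      simp only [Matrix.submatrix_apply, id, Function.update_of_ne hk]
      rw [RM_W, Matrix.one_apply]
      exact nb_one h.ne k' q
  rw [e, abs_mul (A * ε ^ (r - 1)), abs_mul (Fx f _ x), abs_of_pos (a := A * ε ^ (r - 1))
    (by positivity)] at this
  linarith

theorem Chi.psi_ge {x : Rv d} (h : MaxW b σ) (hA : 0 < A) (hε : 0 < ε)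
    (hc : Chi f A ε b (sW σ) x) : 1 ≤ psi (MM f p A K ε x * b) := by
  rcases hc with hc | ⟨k, hc⟩
  · exact hc.trans (chi_const hε x)
  · exact hc.trans (chi_minor h hA hε k x)

theorem chi_good (G : Geo f p x0 r0 L cN l κ e1) (h : MaxW b σ) (hA : 0 < A) (hε : 0 < ε)
    {y : Rv d} {ρ : ℝ} (h0 : 0 < ρ) (hQ : cb y ρ ⊆ cb x0 r0) {c3 : ℝ} (hc3 : c3 ≤ e1)
    {xs : Rv d} (hxs : xs ∈ cb y ρ) (hc : Chi f A ε b (sW σ) xs) :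
    volume {x | x ∈ cb y ρ ∧ psi (MM f p A K ε x * b) < c3} ≤
      oR κ * volume (cb y ρ) := by
  have he := G.he1
  have he' := G.he1'
  rcases hc with hc | ⟨k, hc⟩
  · have : {x | x ∈ cb y ρ ∧ psi (MM f p A K ε x * b) < c3} = ∅ := by
      ext x
      simp only [Set.mem_ofPred_eq, Set.mem_empty_iff_false, iff_false, not_and, not_lt]
      intro _
      have := chi_const (f := f) (p := p) (A := A) (K := K) (b := b) (σ := σ) hε x
      linarith
    rw [this]; simp
  · refine le_trans (measure_mono ?_) (G.lg y ρ h0 hQ (uk b (sW σ) k) xs hxs)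
    rintro x ⟨hx, hlt⟩
    refine ⟨hx, ?_⟩
    have h1 := chi_minor (f := f) (p := p) (K := K) h hA hε k x
    set c := A * ε ^ (r - 1) * |(b.submatrix (sW σ) id).det|
    have hcp : 0 < c := by have := h.ge; positivity
    have : c * |Fx f (uk b (sW σ) k) x| < c * (e1 * |Fx f (uk b (sW σ) k) xs|) := by nlinarith
    exact lt_of_mul_lt_mul_left this hcp.le

theorem weight_ge (h : MaxW b σ) (hA : 0 < A) (hε : 0 < ε) (hε1 : ε ≤ 1) (hr : 0 < r)
    (hKd : K ^ d = ε ^ m * A) : K ^ d ≤ ε * (A * ε ^ (r - 1) * |(b.submatrix (sW σ) id).det|) := by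
  have h1 : ε ^ m ≤ ε * ε ^ (r - 1) := by
    rw [← pow_succ']
    exact pow_le_pow_of_le_one hε.le hε1 (by have := h.rle; omega)
  have h2 := h.ge
  calc K ^ d = ε ^ m * A * 1 := by rw [hKd, mul_one]
    _ ≤ (ε * ε ^ (r - 1)) * A * |(b.submatrix (sW σ) id).det| := by gcongr
    _ = _ := by ring

theorem chi_upper (G : Geo f p x0 r0 L cN l κ e1) (h : MaxW b σ) (hA : 0 < A) (hK : 1 ≤ K)
    (hε : 0 < ε) (hε1 : ε ≤ 1) (hKd : K ^ d = ε ^ m * A) (hK2 : 1 ≤ K ^ 2 * ε)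
    {y : Rv d} {ρ : ℝ} (hQ : cb y ρ ⊆ cb x0 r0) (hρ : K * ε ≤ ρ)
    (hc : ∀ x ∈ cb y ρ, ¬ Chi f A ε b (sW σ) x) (x : Rv d) (hx : x ∈ cb y ρ) :
    psi (MM f p A K ε x * b) ≤
      (Fintype.card (Idx d m) : ℝ) ^ r * ((r.factorial : ℝ) * (2 + m * L) ^ r) := by
  have hL := G.hL
  have hK0 : 0 < K := by linarith
  set Dt := |(b.submatrix (sW σ) id).det| with hDt
  have hD1 := h.ge
  rw [← hDt] at hD1
  set C := 2 + m * L with hC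
  have hC1 : 1 ≤ C := by have : (0 : ℝ) ≤ m * L := by positivity
                         linarith
  have hconst : ε ^ r * Dt ≤ 1 := by
    by_contra hcon
    exact hc x hx (Or.inl (by linarith))
  have hFx : ∀ x ∈ cb y ρ, ∀ k, A * ε ^ (r - 1) * Dt * |Fx f (uk b (sW σ) k) x| ≤ 1 := by
    intro x hx k
    by_contra hcon
    exact hc x hx (Or.inr ⟨k, by rw [← hDt]; linarith⟩)
  apply psi_le
  intro σ'
  rw [MM_minor, nb_minor h.ne]
  by_cases hinj : Function.Injective σ'
  swap
  · have : ((RM f p x * nb b (sW σ)).submatrix σ' id).det = 0 := by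
      by_contra hne
      exact hinj (inj_of_det hne)
    rw [this]; simp; positivity
  have hrows : ∀ k q, |(wt A K ε (σ' k)) * (RM f p x * nb b (sW σ)) (σ' k) q| ≤
      if σ' k = iF then 1 / (ε ^ (r - 1) * Dt) else C * ε := by
    intro k q
    have hr : 0 < r := lt_of_le_of_lt (Nat.zero_le _) k.2
    have hwg := weight_ge h hA hε hε1 hr hKd
    rw [← hDt] at hwg
    have hKd1 : 1 ≤ K ^ d := one_le_pow₀ hK
    have hFε : ∀ x ∈ cb y ρ, |Fx f (uk b (sW σ) q) x| ≤ ε := by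
      intro x hx
      have h1 := hFx x hx q
      have h2 : 1 * |Fx f (uk b (sW σ) q) x| ≤
          (ε * (A * ε ^ (r - 1) * Dt)) * |Fx f (uk b (sW σ) q) x| := by
        gcongr; linarith
      nlinarith
    rcases hk : σ' k with a | i | j
    · rw [if_pos rfl, RM_F]
      have h1 := hFx x hx q
      have e : wt A K ε (Sum.inl a : Idx d m) = A := rfl
      rw [e, abs_mul, abs_of_pos hA, le_div_iff₀ (by positivity)]
      calc _ = A * ε ^ (r - 1) * Dt * |Fx f (uk b (sW σ) q) x| := by unfold uk; ring
        _ ≤ 1 := h1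
    · rw [if_neg (by simp), RM_D]
      obtain ⟨s', hs', hm'⟩ := exists_shift (by positivity) hρ hx i
      have h1 := D_bound G hQ (uk b (sW σ) q) (w := 1) (fun j => h.le_one j q) x i s' hx hm'
      have h2 := hFε _ hm'
      have h3 := hFε _ hx
      rw [hs'] at h1
      have e : wt A K ε (Sum.inr (Sum.inl i) : Idx d m) = K⁻¹ := rfl
      rw [e, abs_mul, abs_of_pos (inv_pos.2 hK0), inv_mul_le_iff₀ hK0]
      change |Dx p (uk b (sW σ) q) x i| ≤ _
      have h4 : |Dx p (uk b (sW σ) q) x i| * (K * ε) ≤ (K * (C * ε)) * (K * ε) := by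
        refine h1.trans ?_
        have : 2 * ε ≤ 2 * (K ^ 2 * ε) * ε := by nlinarith
        rw [hC]
        nlinarith
      exact le_of_mul_le_mul_right h4 (by positivity)
    · rw [if_neg (by simp), RM_W]
      have e : wt A K ε (Sum.inr (Sum.inr j) : Idx d m) = ε := rfl
      rw [e, abs_mul, abs_of_pos hε]
      have := h.le_one j q
      nlinarith
  have hdet := det_row_bound (fun k q => (wt A K ε (σ' k)) * (RM f p x * nb b (sW σ)) (σ' k) q) _ hrows
  have e : (Matrix.det fun k q => (wt A K ε (σ' k)) * (RM f p x * nb b (sW σ)) (σ' k) q) =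
      (∏ k, wt A K ε (σ' k)) * ((RM f p x * nb b (sW σ)).submatrix σ' id).det :=
    Matrix.det_mul_column _ _
  rw [e] at hdet
  rw [← mul_assoc, abs_mul, ← hDt]
  refine (mul_le_mul_of_nonneg_right hdet (by positivity)).trans ?_
  rw [mul_assoc]
  refine mul_le_mul_of_nonneg_left ?_ (by positivity)
  by_cases hF : ∃ k, σ' k = iF
  · obtain ⟨k, hk⟩ := hF
    have hr : 0 < r := lt_of_le_of_lt (Nat.zero_le _) k.2
    have : ∀ k', (if σ' k' = iF then 1 / (ε ^ (r - 1) * Dt) else C * ε) =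
        Function.update (fun _ => C * ε) k (1 / (ε ^ (r - 1) * Dt)) k' := by
      intro k'
      by_cases hkk : k' = k
      · subst hkk; simp [hk]
      · have : σ' k' ≠ iF := fun h => hkk (hinj (h.trans hk.symm))
        simp [hkk, this]
    simp only [this]
    rw [Finset.prod_update_of_mem (Finset.mem_univ k)]
    have e3 : ∏ x ∈ Finset.univ \ {k}, C * ε = (C * ε) ^ (r - 1) := by
      simp [Finset.card_sdiff]
    rw [e3, mul_pow]
    calc _ = C ^ (r - 1) := by field_simp
      _ ≤ C ^ r := pow_le_pow_right₀ hC1 (by omega)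
  · push Not at hF
    simp only [hF, if_false, Finset.prod_const, Finset.card_univ, Fintype.card_fin, mul_pow]
    calc C ^ r * ε ^ r * Dt = C ^ r * (ε ^ r * Dt) := by ring
      _ ≤ C ^ r * 1 := by gcongr
      _ = _ := mul_one _

end P5d

noncomputable section P5e

variable {d m : ℕ} {f : Mp d m} {p : (Rv d) → Fin d → Fin m → ℝ}
  {x0 : Rv d} {r0 L cN : ℝ} {l : ℕ} {κ e1 : ℝ} {A K ε : ℝ}

theorem exists_maxcnt {r : ℕ} {b : Matrix (Idx d m) (Fin r) ℝ}
    (hne : ∃ σ : Fin r → Idx d m, (b.submatrix σ id).det ≠ 0) :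
    ∃ σ : Fin r → Idx d m, (b.submatrix σ id).det ≠ 0 ∧
      ∀ k, (∀ j, σ k ≠ iW j) → ∀ j, nb b σ (iW j) k = 0 := by
  classical
  obtain ⟨σ1, h1⟩ := hne
  obtain ⟨σ, hσ, hmax⟩ := Finset.exists_max_image
    (Finset.univ.filter fun σ : Fin r → Idx d m => (b.submatrix σ id).det ≠ 0)
    (fun σ => (Finset.univ.filter fun k => ∃ j, σ k = iW j).card) ⟨σ1, by simpa using h1⟩
  rw [Finset.mem_filter] at hσ
  refine ⟨σ, hσ.2, ?_⟩
  intro k hk j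
  by_contra hcon
  have h2 := hmax (Function.update σ k (iW j)) (by
    simp only [Finset.mem_filter, Finset.mem_univ, true_and]
    rw [nb_upd hσ.2]
    exact mul_ne_zero hcon hσ.2)
  refine absurd h2 (not_le.2 ?_)
  apply Finset.card_lt_card
  rw [Finset.ssubset_iff_of_subset]
  · exact ⟨k, by simp, by simpa using hk⟩
  · intro k' hk'
    simp only [Finset.mem_filter, Finset.mem_univ, true_and] at hk' ⊢
    have : k' ≠ k := by rintro rfl; obtain ⟨j', hj'⟩ := hk'; exact hk j' hj'
    simpa [this] using hk'

theorem affine_sup {u : Idx d m → ℝ} (hw : ∀ j, u (iW j) = 0) (D : ℝ)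
    (hint : ∀ a, ∃ z : ℤ, u a * D = z) (hu : u ≠ 0) (hD : D ≠ 0) (y : Rv d) {ρ : ℝ}
    (hρ : 0 < ρ) : ∃ x ∈ cb y ρ, min 1 ρ ≤ |Fx f u x * D| ∧
      ((∀ i, u (iD i) = 0) → 1 ≤ |Fx f u x * D|) := by
  have hF : ∀ x, Fx f u x = u iF + ∑ i, x i * u (iD i) := by intro x; simp [Fx, hw]
  by_cases h : ∀ i, u (iD i) = 0
  · have hy : y ∈ cb y ρ := Metric.mem_closedBall_self hρ.le
    have h1 : 1 ≤ |Fx f u y * D| := by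
      rw [hF]; simp only [h, mul_zero, Finset.sum_const_zero, add_zero]
      apply int_abs_ge (hint iF)
      refine mul_ne_zero ?_ hD
      intro h0
      apply hu
      funext a
      rcases a with a | i | j
      · exact h0
      · exact h i
      · exact hw j
    exact ⟨y, hy, (min_le_left _ _).trans h1, fun _ => h1⟩
  · push Not at h
    obtain ⟨i, hi⟩ := h
    have hone : 1 ≤ |u (iD i) * D| := int_abs_ge (hint _) (mul_ne_zero hi hD)
    have hy : y ∈ cb y 0 := by simp
    have hp : y + ρ • ev i ∈ cb y ρ := mem_cb_shift hy i (by rw [abs_of_pos hρ]; linarith)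
    have hm : y + (-ρ) • ev i ∈ cb y ρ :=
      mem_cb_shift hy i (by rw [abs_neg, abs_of_pos hρ]; linarith)
    have hval : ∀ s : ℝ, Fx f u (y + s • ev i) = Fx f u y + s * u (iD i) := by
      intro s
      rw [hF, hF]
      have : ∑ i', (y + s • ev i) i' * u (iD i') =
          ∑ i', (y i' * u (iD i') + (if i' = i then s * u (iD i') else 0)) := by
        apply Finset.sum_congr rfl
        intro i' _
        by_cases hii : i' = i
        · subst hii; simp [ev]; ring
        · simp [ev, hii]
      rw [this, Finset.sum_add_distrib]; simp; ring
    have hsum : 2 * ρ ≤ |Fx f u (y + ρ • ev i) * D| + |Fx f u (y + (-ρ) • ev i) * D| := by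
      have e : Fx f u (y + ρ • ev i) * D - Fx f u (y + (-ρ) • ev i) * D =
        (2 * ρ) * (u (iD i) * D) := by rw [hval, hval]; ring
      have h3 := abs_sub (Fx f u (y + ρ • ev i) * D) (Fx f u (y + (-ρ) • ev i) * D)
      rw [e, abs_mul, abs_of_pos (by linarith : 0 < 2 * ρ)] at h3
      nlinarith
    by_cases hc : ρ ≤ |Fx f u (y + ρ • ev i) * D|
    · exact ⟨_, hp, (min_le_right _ _).trans hc, fun h => absurd (h i) hi⟩
    · exact ⟨_, hm, (min_le_right _ _).trans (by push Not at hc; linarith),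
        fun h => absurd (h i) hi⟩

theorem lowLB {r : ℕ} (B : Matrix (Idx d m) (Fin r) ℤ)
    (hne : ∃ σ : Fin r → Idx d m, ((rm B).submatrix σ id).det ≠ 0)
    (hP : ∀ σ : Fin r → Fin m, ((rm B).submatrix (sW σ) id).det = 0)
    (hA : 0 < A) (hK : 1 ≤ K) (hε : 0 < ε) (hε1 : ε ≤ 1) (hKd : K ^ d = ε ^ m * A)
    (y : Rv d) {ρ : ℝ} (hρ : 0 < ρ) :
    ∃ x ∈ cb y ρ, min 1 (K * ρ) ≤ psi (MM f p A K ε x * rm B) := by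
  classical
  obtain ⟨σ, hσ, hz⟩ := exists_maxcnt hne
  have hinj := inj_of_det hσ
  have hnonW : ∃ k, ∀ j, σ k ≠ iW j := by
    by_contra hcon
    push Not at hcon
    choose g hg using hcon
    have : σ = sW g := funext hg
    rw [this] at hσ
    exact hσ (hP g)
  have hk0 : ∃ k0, (∀ j, σ k0 ≠ iW j) ∧ ∀ k, σ k = iF → k = k0 := by
    by_cases hF : ∃ k, σ k = iF
    · obtain ⟨k, hk⟩ := hF
      exact ⟨k, by rw [hk]; simp, fun k' hk' => hinj (hk'.trans hk.symm)⟩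
    · push Not at hF
      obtain ⟨k, hk⟩ := hnonW
      exact ⟨k, hk, fun k' hk' => absurd hk' (hF k')⟩
  obtain ⟨k0, hk0, hFk⟩ := hk0
  set b := rm B with hb
  set τ := Function.update σ k0 iF with hτ
  have hτ0 : τ k0 = iF := by simp [hτ]
  have hτk : ∀ k, k ≠ k0 → τ k = σ k := fun k hk => by simp [hτ, hk]
  have hτinj : Function.Injective τ := by
    intro k k' hkk
    by_cases h1 : k = k0 <;> by_cases h2 : k' = k0
    · rw [h1, h2]
    · rw [h1, hτ0, hτk k' h2] at hkk; exact absurd (hFk k' hkk.symm) h2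
    · rw [h2, hτ0, hτk k h1] at hkk; exact absurd (hFk k hkk) h1
    · rw [hτk k h1, hτk k' h2] at hkk; exact hinj hkk
  have hu0 : uk b σ k0 (σ k0) = 1 := by simp [uk, nb_one hσ]
  have hdet : ∀ x, ((RM f p x * nb b σ).submatrix τ id).det = Fx f (uk b σ k0) x := by
    intro x
    rw [det_tri _ (fun k => if k = k0 then 0 else if ∃ j, σ k = iW j then 2 else 1)]
    · rw [Finset.prod_eq_single k0]
      · simp only [Matrix.submatrix_apply, id, hτ0]; rw [RM_F]; rfl
      · intro k _ hk
        simp only [Matrix.submatrix_apply, id, hτk k hk]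
        rcases hs : σ k with a | i | j
        · exact absurd (hFk k hs) hk
        · rw [RM_D, Dx]
          have h1 := nb_one hσ k k
          rw [hs] at h1
          have h2 := hz k (by rw [hs]; simp)
          simp [h1, h2]
        · rw [RM_W]
          have h1 := nb_one hσ k k
          rw [hs] at h1
          simpa using h1
      · simp
    · intro k q hkq hne0
      by_cases hk : k = k0
      · have hq : q ≠ k0 := fun h => hkq (hk.trans h.symm)
        simp only [hk, hq, if_true, if_false]; split_ifs <;> norm_num
      · simp only [Matrix.submatrix_apply, id, hτk k hk] at hne0
        rcases hs : σ k with a | i | j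
        · exact absurd (hFk k hs) hk
        · rw [hs, RM_D, Dx] at hne0
          have h1 := nb_one hσ k q
          rw [hs, if_neg hkq] at h1
          by_cases hqW : ∃ j, σ q = iW j
          · have hq0 : q ≠ k0 := by rintro rfl; obtain ⟨j, hj⟩ := hqW; exact hk0 j hj
            simp [hk, hq0, hqW]
          · exfalso; apply hne0
            have h2 := hz q (by push Not at hqW; exact hqW)
            simp [h1, h2]
        · exfalso; apply hne0
          rw [hs, RM_W]
          have h1 := nb_one hσ k q
          rw [hs, if_neg hkq] at h1
          exact h1
  obtain ⟨x, hx, hx1, hx2⟩ := affine_sup (f := f) (u := uk b σ k0) (hz k0 hk0)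
    (b.submatrix σ id).det (fun a => nb_int B hσ a k0)
    (fun h => by rw [h] at hu0; simp at hu0) hσ y hρ
  refine ⟨x, hx, le_trans ?_ (minor_le_psi _ τ)⟩
  rw [MM_minor, nb_minor hσ, hdet, abs_mul]
  obtain ⟨w1, w2⟩ := wt_inj τ hτinj hA hK hε hε1 hKd k0 hτ0
  by_cases hD : ∃ i, ∀ k, τ k ≠ iD i
  · have h3 := w2 hD
    rw [abs_of_nonneg (by linarith)]
    calc min 1 (K * ρ) ≤ K * min 1 ρ := by
          rw [mul_min_of_nonneg _ _ (by linarith)]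
          exact min_le_min_right _ (by linarith)
      _ ≤ _ := mul_le_mul h3 hx1 (by positivity) (by linarith)
  · push Not at hD
    have h3 := hx2 (by
      intro i
      obtain ⟨k, hk⟩ := hD i
      have hkk : k ≠ k0 := by rintro rfl; rw [hτ0] at hk; simp at hk
      rw [hτk k hkk] at hk
      rw [uk, ← hk, nb_one hσ, if_neg hkk])
    rw [abs_of_nonneg (by linarith)]
    refine (min_le_left _ _).trans ?_
    nlinarith

end P5e

noncomputable section P5f

variable {d m : ℕ} {f : Mp d m} {p : (Rv d) → Fin d → Fin m → ℝ}
  {x0 : Rv d} {r0 L cN : ℝ} {l : ℕ} {κ e1 : ℝ} {A K ε : ℝ}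

theorem Geo.contp (G : Geo f p x0 r0 L cN l κ e1) (i : Fin d) (j : Fin m) :
    ContinuousOn (fun x => p x i j) (cb x0 r0) := by
  have hL := G.hL
  have : LipschitzOnWith (Real.toNNReal L) (fun x => p x i j) (cb x0 r0) := by
    apply LipschitzOnWith.of_dist_le_mul
    intro x hx x' hx'
    rw [Real.coe_toNNReal _ (by linarith), Real.dist_eq]
    exact G.lip x hx x' hx' i j
  exact this.continuousOn

theorem psi_cont (G : Geo f p x0 r0 L cN l κ e1) {r : ℕ} (b : Matrix (Idx d m) (Fin r) ℝ) :
    ContinuousOn (fun x => psi (MM f p A K ε x * b)) (cb x0 r0) := by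
  have hf : ∀ j, ContinuousOn (fun x => f x j) (cb x0 r0) :=
    fun j => (continuousOn_pi.1 G.cont) j
  have hent : ∀ a q, ContinuousOn (fun x => (MM f p A K ε x * b) a q) (cb x0 r0) := by
    intro a q
    simp only [MM_apply]
    refine continuousOn_const.mul ?_
    rcases a with ⟨⟩ | i | j
    · refine ContinuousOn.congr (f := fun x => Fx f (fun a => b a q) x) ?_
        (fun x _ => RM_F f p x b q)
      unfold Fx
      refine continuousOn_const.add (ContinuousOn.add ?_ ?_)
      · exact continuousOn_finsetSum _ fun i _ => (by fun_prop)
      · exact continuousOn_finsetSum _ fun j _ => (hf j).mul continuousOn_const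
    · refine ContinuousOn.congr (f := fun x => Dx p (fun a => b a q) x i) ?_
        (fun x _ => RM_D f p x b q i)
      unfold Dx
      exact continuousOn_const.add
        (continuousOn_finsetSum _ fun j _ => (G.contp i j).mul continuousOn_const)
    · exact ContinuousOn.congr (f := fun x => b (iW j) q) continuousOn_const
        (fun x _ => RM_W f p x b q j)
  unfold psi
  refine continuousOn_finsetSum _ fun σ _ => ?_
  refine ContinuousOn.abs ?_
  simp only [Matrix.det_apply']
  refine continuousOn_finsetSum _ fun π _ => continuousOn_const.mul ?_
  exact continuousOn_finsetProd _ fun i _ => hent _ _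

abbrev nI (d m : ℕ) : ℕ := Fintype.card (Idx d m)

def cC2 (d m : ℕ) (L : ℝ) : ℝ :=
  (nI d m : ℝ) ^ (nI d m) * (((nI d m).factorial : ℝ) * (2 + m * L) ^ (nI d m))

def cc3 (d m : ℕ) (L e1 : ℝ) : ℝ := e1 / ((4 * L) ^ (nI d m) * (2 * (nI d m : ℝ) ^ (nI d m)))

theorem nI_one : (1 : ℝ) ≤ nI d m := by
  have : 0 < nI d m := Fintype.card_pos
  exact_mod_cast this

theorem cC2_ge {L : ℝ} (hL : 1 ≤ L) {r : ℕ} (hr : r ≤ nI d m) :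
    (nI d m : ℝ) ^ r * ((r.factorial : ℝ) * (2 + m * L) ^ r) ≤ cC2 d m L := by
  have h1 := nI_one (d := d) (m := m)
  have h2 : (1 : ℝ) ≤ 2 + m * L := by
    have : (0 : ℝ) ≤ m * L := by positivity
    linarith
  have h3 : (r.factorial : ℝ) ≤ ((nI d m).factorial : ℝ) := by
    exact_mod_cast Nat.factorial_le hr
  unfold cC2
  gcongr

theorem cC2_one {L : ℝ} (hL : 1 ≤ L) : 1 ≤ cC2 d m L := by
  have := cC2_ge (d := d) (m := m) hL (Nat.zero_le _)
  simpa using this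

theorem cc3_pos {L e1 : ℝ} (hL : 1 ≤ L) (he : 0 < e1) : 0 < cc3 d m L e1 := by
  have h1 := nI_one (d := d) (m := m)
  unfold cc3; positivity

theorem cc3_le {L e1 : ℝ} (hL : 1 ≤ L) (he : 0 < e1) {r : ℕ} (hr : r ≤ nI d m) :
    (4 * L) ^ r * cc3 d m L e1 * (2 * (nI d m : ℝ) ^ r) ≤ e1 := by
  have h1 := nI_one (d := d) (m := m)
  have h4 : (1 : ℝ) ≤ 4 * L := by linarith
  have hp := cc3_pos (d := d) (m := m) hL he
  calc _ ≤ (4 * L) ^ (nI d m) * cc3 d m L e1 * (2 * (nI d m : ℝ) ^ (nI d m)) := by gcongr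
    _ = e1 := by unfold cc3; field_simp

theorem cc3_le_e1 {L e1 : ℝ} (hL : 1 ≤ L) (he : 0 < e1) : cc3 d m L e1 ≤ e1 := by
  have := cc3_le (d := d) (m := m) hL he (Nat.zero_le _)
  have hp := cc3_pos (d := d) (m := m) hL he
  simp at this; linarith

theorem tup_minor (W : Submodule ℚ (Idx d m → ℚ)) :
    ∃ σ : Fin (Module.finrank ℚ W) → Idx d m, ((rm (tup W)).submatrix σ id).det ≠ 0 := by
  obtain ⟨σ, hσ⟩ := qv_exists_minor (tup W) (tup_isTup W).2.2
  refine ⟨σ, ?_⟩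
  have : ((rm (tup W)).submatrix σ id).det = (((tup W).submatrix σ id).det : ℤ) := by
    rw [Int.cast_det]; rfl
  rw [this]; exact_mod_cast hσ

theorem finrank_le_nI (W : Submodule ℚ (Idx d m → ℚ)) : Module.finrank ℚ W ≤ nI d m := by
  have := Submodule.finrank_le W
  rwa [Module.finrank_fintype_fun_eq_card] at this

open Classical in
def BigA (f : Mp d m) (p : (Rv d) → Fin d → Fin m → ℝ) (A K ε : ℝ)
    (y : Rv d) (ρ : ℝ) (W : Submodule ℚ (Idx d m → ℚ)) : Prop :=
  if h : ∃ σ, MaxW (rm (tup W)) σ then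
    (if K * ε < ρ then ∃ x ∈ cb y ρ, Chi f A ε (rm (tup W)) (sW h.choose) x
      else ∃ x ∈ cb y ρ, 1 ≤ psi (MM f p A K ε x * rm (tup W)))
  else (K * ε < ρ ∨ ∃ x ∈ cb y ρ, 1 ≤ psi (MM f p A K ε x * rm (tup W)))

theorem assemble (G : Geo f p x0 r0 L cN l κ e1) (hK : 0 < K) (hKd : K ^ d = ε ^ m * A)
    {z : Rv d} {r : ℝ} (hr : 0 < r) {C2 c3 : ℝ} {κ' : ℝ≥0∞} (hC2 : 1 ≤ C2) (hc3 : c3 ≤ 1)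
    (Big : (Rv d) → ℝ → Submodule ℚ (Idx d m → ℚ) → Prop)
    (H2 : ∀ y ρ y' W, 0 < ρ → cb y ρ ⊆ cb z r → cb y' (ρ / 2) ⊆ cb y ρ → W ≠ ⊥ → W ≠ ⊤ →
      Big y ρ W → ¬ Big y' (ρ / 2) W →
      (∀ x ∈ cb y' (ρ / 2), psi (MM f p A K ε x * rm (tup W)) ≤ C2) ∧
      volume {x | x ∈ cb y ρ ∧ psi (MM f p A K ε x * rm (tup W)) < c3} ≤ κ' * volume (cb y ρ))
    (H3 : ∀ x ∈ cb z r, ∀ W : Submodule ℚ (Idx d m → ℚ), W ≠ ⊥ → W ≠ ⊤ →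
      psi (MM f p A K ε x * rm (tup W)) < c3 →
      ∃ s > 0, ∀ y ρ, 0 < ρ → ρ ≤ s → x ∈ cb y ρ → cb y ρ ⊆ cb z r → ¬ Big y ρ W)
    (H4 : ∀ W, W ≠ ⊥ → W ≠ ⊤ → Big z r W) :
    volume {x | x ∈ cb z r ∧ ∃ v : Idx d m → ℤ, v ≠ 0 ∧
      (nI d m : ℝ) ^ (nI d m + 1) * C2 * ‖(MM f p A K ε x).mulVec (fun a => (v a : ℝ))‖ < c3} ≤
      p3c d (nI d m) * κ' * volume (cb z r) := by
  have key := p3_nondiv (V := Idx d m → ℚ) (Z := Set.range castv)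
    (N := fun x v => ‖(MM f p A K ε x).mulVec (fun a => ((v a : ℚ) : ℝ))‖)
    (ψ := fun W x => psi (MM f p A K ε x * rm (tup W))) (Big := Big)
    (C1 := (nI d m : ℝ) ^ (nI d m + 1)) (C2 := C2) (c3 := c3) (κ := κ') z r hr (by positivity)
    (fun x v => norm_nonneg _)
    (by
      rintro x _ W _ ⟨v, rfl⟩ hv
      have := tup_H1 W (MM f p A K ε x) v hv
      simpa [castv] using this)
    H2 H3 H4
    (by intro x _; show psi (MM f p A K ε x * rm (tup ⊥)) ≤ C2; rw [psi_bot]; exact hC2)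
    (by
      intro x _
      have := psi_top (MM f p A K ε x) (by rw [MM_det f p A K ε hK hKd x]; simp)
      exact hc3.trans this)
  rw [Module.finrank_fintype_fun_eq_card] at key
  refine le_trans (measure_mono ?_) key
  rintro x ⟨hx, v, hv, h⟩
  refine ⟨hx, castv v, ⟨v, rfl⟩, ?_, ?_⟩
  · intro h0; apply hv; funext a
    have := congrFun h0 a
    simpa [castv] using this
  · simpa [castv] using h

theorem H3_gen (G : Geo f p x0 r0 L cN l κ e1) {z : Rv d} {r : ℝ}
    (hz : cb z r ⊆ cb x0 r0) {c3 : ℝ} (hc3 : c3 ≤ 1) {k : ℕ} (b : Matrix (Idx d m) (Fin k) ℝ)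
    (x : Rv d) (hx : x ∈ cb z r) (h : psi (MM f p A K ε x * b) < c3) :
    ∃ s > 0, ∀ y ρ, 0 < ρ → ρ ≤ s → x ∈ cb y ρ → cb y ρ ⊆ cb z r →
      ∀ x' ∈ cb y ρ, psi (MM f p A K ε x' * b) < 1 := by
  have hc := psi_cont (A := A) (K := K) (ε := ε) G b x (hz hx)
  have h1 : ∀ᶠ x' in nhdsWithin x (cb x0 r0), psi (MM f p A K ε x' * b) < 1 :=
    hc.eventually (gt_mem_nhds (lt_of_lt_of_le h hc3))
  rw [eventually_nhdsWithin_iff, Metric.eventually_nhds_iff] at h1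
  obtain ⟨s, hs, h2⟩ := h1
  refine ⟨s / 3, by positivity, ?_⟩
  intro y ρ h0 hρ hxy hyz x' hx'
  refine h2 ?_ (hz (hyz hx'))
  have := dist_triangle_right x' x y
  rw [Metric.mem_closedBall] at hxy hx'
  linarith

theorem caseA (G : Geo f p x0 r0 L cN l κ e1) (hA : 0 < A) (hK : 0 < K) (hε : 0 < ε)
    (hε1 : ε ≤ 1) (hKd : K ^ d = ε ^ m * A) (hK2 : 1 ≤ K ^ 2 * ε)
    {z : Rv d} {r : ℝ} (hr : 0 < r) (hz : cb z r ⊆ cb x0 r0)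
    (hKr : 1 ≤ K * (cN * r ^ l)) (hKr2 : 1 ≤ K * r) :
    volume {x | x ∈ cb z r ∧ ∃ v : Idx d m → ℤ, v ≠ 0 ∧ (nI d m : ℝ) ^ (nI d m + 1) * cC2 d m L *
      ‖(MM f p A K ε x).mulVec (fun a => (v a : ℝ))‖ < cc3 d m L e1} ≤
      p3c d (nI d m) * oR κ * volume (cb z r) := by
  classical
  have hL := G.hL
  have hK1 : 1 ≤ K := by
    by_contra hcon
    push Not at hcon
    nlinarith [mul_pos hK hε, mul_pos (mul_pos hK hε) hK]
  have hρ0 : 0 < K * ε := mul_pos hK hε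
  have hc31 : cc3 d m L e1 ≤ 1 := (cc3_le_e1 hL G.he1).trans G.he1'
  refine assemble G hK hKd hr (cC2_one hL) hc31 (BigA f p A K ε) ?_ ?_ ?_
  · intro y ρ y' W h0 hyz hy' hbot htop hB hnB
    have hyx : cb y ρ ⊆ cb x0 r0 := hyz.trans hz
    have hyx' : cb y' (ρ / 2) ⊆ cb x0 r0 := hy'.trans hyx
    have hrk := finrank_le_nI W
    have hfr := cc3_le (e1 := e1) hL G.he1 hrk
    have hC2 := cC2_ge (d := d) (m := m) hL hrk
    have hone := cC2_one (d := d) (m := m) hL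
    by_cases h : ∃ σ, MaxW (rm (tup W)) σ
    · simp only [BigA, dif_pos h] at hB hnB
      have hM := h.choose_spec
      by_cases h2 : K * ε < ρ
      · rw [if_pos h2] at hB
        obtain ⟨xs, hxs, hchi⟩ := hB
        refine ⟨?_, chi_good G hM hA hε h0 hyx (cc3_le_e1 hL G.he1) hxs hchi⟩
        by_cases h3 : K * ε < ρ / 2
        · rw [if_pos h3] at hnB
          push Not at hnB
          intro x hx
          exact (chi_upper G hM hA hK1 hε hε1 hKd hK2 hyx' h3.le hnB x hx).trans hC2
        · rw [if_neg h3] at hnB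
          push Not at hnB
          intro x hx
          exact (hnB x hx).le.trans hone
      · rw [if_neg h2] at hB
        have h3 : ¬ K * ε < ρ / 2 := by linarith
        rw [if_neg h3] at hnB
        push Not at hnB
        obtain ⟨xs, hxs, hpsi⟩ := hB
        exact ⟨fun x hx => (hnB x hx).le.trans hone,
          frozen G hA hK hε h0 hyx (by linarith) _ hfr hxs hpsi⟩
    · simp only [BigA, dif_neg h] at hB hnB
      push Not at hnB
      refine ⟨fun x hx => (hnB.2 x hx).le.trans hone, ?_⟩
      have hex : ∃ x ∈ cb y ρ, 1 ≤ psi (MM f p A K ε x * rm (tup W)) := by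
        rcases hB with hB | hB
        · obtain ⟨x, hx, hx1⟩ := lowLB (f := f) (p := p) (tup W) (tup_minor W) (by
            intro σ; by_contra hcon; exact h (exists_MaxW _ ⟨σ, hcon⟩)) hA hK1 hε hε1 hKd y h0
          refine ⟨x, hx, le_trans ?_ hx1⟩
          rw [le_min_iff]
          refine ⟨le_rfl, ?_⟩
          nlinarith
        · exact hB
      obtain ⟨xs, hxs, hpsi⟩ := hex
      exact frozen G hA hK hε h0 hyx (by linarith [hnB.1]) _ hfr hxs hpsi
  · intro x hx W hbot htop hlt
    obtain ⟨s, hs, h1⟩ := H3_gen G hz hc31 _ x hx hlt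
    refine ⟨min s (K * ε), lt_min hs hρ0, ?_⟩
    intro y ρ h0 hρ hxy hyz hB
    have h2 := h1 y ρ h0 (hρ.trans (min_le_left _ _)) hxy hyz
    have h3 : ¬ K * ε < ρ := by have := hρ.trans (min_le_right _ _); linarith
    by_cases h : ∃ σ, MaxW (rm (tup W)) σ
    · simp only [BigA, dif_pos h, if_neg h3] at hB
      obtain ⟨x', hx', h4⟩ := hB
      linarith [h2 x' hx']
    · simp only [BigA, dif_neg h] at hB
      rcases hB with hB | ⟨x', hx', h4⟩
      · exact h3 hB
      · linarith [h2 x' hx']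
  · intro W hbot htop
    by_cases h : ∃ σ, MaxW (rm (tup W)) σ
    · simp only [BigA, dif_pos h]
      have hM := h.choose_spec
      have hpos : 0 < Module.finrank ℚ W := by
        rw [Module.finrank_pos_iff]
        exact Submodule.nontrivial_iff_ne_bot.2 hbot
      set k : Fin (Module.finrank ℚ W) := ⟨0, hpos⟩
      obtain ⟨x, hx, hx1⟩ := G.npr z r hr hz (uk (rm (tup W)) (sW h.choose) k)
      have h1 := hx1 (Sum.inr (h.choose k))
      have e : uk (rm (tup W)) (sW h.choose) k (Sum.inr (Sum.inr (h.choose k))) = 1 := by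
        have := nb_one hM.ne k k
        simpa [uk] using this
      rw [e, abs_one, mul_one] at h1
      have hchi : Chi f A ε (rm (tup W)) (sW h.choose) x := by
        right
        refine ⟨k, ?_⟩
        have h2 := weight_ge hM hA hε hε1 hpos hKd
        set w := A * ε ^ (Module.finrank ℚ W - 1) * |((rm (tup W)).submatrix (sW h.choose) id).det|
        have hw : 0 ≤ w := by positivity
        have h3 : K ≤ K ^ d := by
          calc K = K ^ 1 := (pow_one K).symm
            _ ≤ K ^ d := pow_le_pow_right₀ hK1 G.hd
        have h4 : K ≤ w := by nlinarith
        have h5 : 0 ≤ cN * r ^ l := by have := G.hcN; positivity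
        calc 1 ≤ K * (cN * r ^ l) := hKr
          _ ≤ w * |Fx f (uk (rm (tup W)) (sW h.choose) k) x| := by gcongr
      split_ifs
      · exact ⟨x, hx, hchi⟩
      · exact ⟨x, hx, hchi.psi_ge hM hA hε⟩
    · simp only [BigA, dif_neg h]
      right
      obtain ⟨x, hx, hx1⟩ := lowLB (f := f) (p := p) (tup W) (tup_minor W) (by
            intro σ; by_contra hcon; exact h (exists_MaxW _ ⟨σ, hcon⟩)) hA hK1 hε hε1 hKd z hr
      exact ⟨x, hx, le_trans (le_min le_rfl hKr2) hx1⟩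

end P5f

noncomputable section P6a

theorem wr_dep {a b : ℝ} (u v u' v' : ℝ → ℝ) (hu : ∀ x ∈ Ioo a b, HasDerivAt u (u' x) x)
    (hv : ∀ x ∈ Ioo a b, HasDerivAt v (v' x) x) (h0 : ∀ x ∈ Ioo a b, u x ≠ 0)
    (hW : ∀ x ∈ Ioo a b, u x * v' x - u' x * v x = 0) :
    ∃ c : ℝ, ∀ x ∈ Ioo a b, v x = c * u x := by
  have hd : ∀ x ∈ Ioo a b, HasDerivAt (fun x => v x / u x) 0 x := by
    intro x hx
    have := (hv x hx).div (hu x hx) (h0 x hx)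
    have e : (v' x * u x - v x * u' x) / u x ^ 2 = 0 := by
      rw [div_eq_zero_iff]; left; linarith [hW x hx]
    rw [e] at this
    exact this
  by_cases hne : (Ioo a b).Nonempty
  swap
  · exact ⟨0, fun x hx => absurd ⟨x, hx⟩ hne⟩
  obtain ⟨x0, hx0⟩ := hne
  refine ⟨v x0 / u x0, fun x hx => ?_⟩
  have : (fun x => v x / u x) x = (fun x => v x / u x) x0 := by
    apply isOpen_Ioo.is_const_of_deriv_eq_zero isPreconnected_Ioo
      (fun z hz => (hd z hz).differentiableAt.differentiableWithinAt)
      (fun z hz => (hd z hz).deriv) hx hx0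
  simp only at this
  rw [← this, div_mul_cancel₀ _ (h0 x hx)]

theorem poly_wr_ne (p q : Polynomial ℝ) (hp : p ≠ 0)
    (hW : p * Polynomial.derivative q - Polynomial.derivative p * q = 0) :
    ∃ c : ℝ, q = Polynomial.C c * p := by
  have hfin := Polynomial.finite_setOfPred_isRoot hp
  obtain ⟨t, ht⟩ := hfin.infinite_compl.nonempty
  have ho : IsOpen ({x : ℝ | p.IsRoot x}ᶜ) := hfin.isClosed.isOpen_compl
  obtain ⟨r, hr, hsub⟩ := Metric.isOpen_iff.1 ho t ht
  rw [Real.ball_eq_Ioo] at hsub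
  obtain ⟨c, hc⟩ := wr_dep (a := t - r) (b := t + r) (fun x => p.eval x) (fun x => q.eval x)
    (fun x => (Polynomial.derivative p).eval x) (fun x => (Polynomial.derivative q).eval x)
    (fun x _ => p.hasDerivAt x) (fun x _ => q.hasDerivAt x) (fun x hx => hsub hx)
    (fun x _ => by
      have := congrArg (Polynomial.eval x) hW
      simpa using this)
  refine ⟨c, ?_⟩
  rw [← sub_eq_zero]
  apply Polynomial.eq_zero_of_infinite_isRoot
  apply (Ioo_infinite (show t - r < t + r by linarith)).mono
  intro x hx
  simp only [Set.mem_ofPred_eq, Polynomial.IsRoot, Polynomial.eval_sub, Polynomial.eval_mul,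
    Polynomial.eval_C]
  rw [hc x hx, sub_self]

theorem coef_bd (l : ℕ) : ∃ M > (0:ℝ), ∀ c : Fin (l+1) → ℝ,
    (∀ τ ∈ Icc (0:ℝ) 1, |pl c τ| ≤ 2) → ‖c‖ ≤ M := by
  obtain ⟨ε, hε, h⟩ := compact_good (Metric.sphere (0 : Fin (l+1) → ℝ) 1) (isCompact_sphere _ _)
    (fun c τ => pl c τ) pl_cont (by
      intro c hc
      have hc0 : ply c ≠ 0 := by
        intro h0
        rw [ply_eq_zero c h0] at hc
        simp at hc
      have := poly_null (ply c) hc0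
      simpa only [ply_eval] using this) (1/2) (by norm_num)
  refine ⟨2 / ε, by positivity, fun c hc => ?_⟩
  by_cases h0 : c = 0
  · rw [h0, norm_zero]; positivity
  have hn : 0 < ‖c‖ := norm_pos_iff.2 h0
  have h1 := h (‖c‖⁻¹ • c) (by simp [norm_smul, hn.ne'])
  have h2 : ∃ τ ∈ Icc (0:ℝ) 1, ε ≤ |pl (‖c‖⁻¹ • c) τ| := by
    by_contra hcon
    push Not at hcon
    have : Icc (0:ℝ) 1 ⊆ {τ : ℝ | τ ∈ Set.Icc (0:ℝ) 1 ∧ |pl (‖c‖⁻¹ • c) τ| < ε} :=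
      fun τ hτ => ⟨hτ, hcon τ hτ⟩
    have h3 := (measure_mono this).trans h1
    rw [Real.volume_Icc, ENNReal.ofReal_le_ofReal_iff (by norm_num)] at h3
    norm_num at h3
  obtain ⟨τ, hτ, h3⟩ := h2
  have h4 : pl (‖c‖⁻¹ • c) τ = ‖c‖⁻¹ * pl c τ := by
    simp only [pl, Pi.smul_apply, smul_eq_mul, Finset.mul_sum, mul_assoc]
  rw [h4, abs_mul, abs_of_pos (inv_pos.2 hn), inv_mul_eq_div, le_div_iff₀ hn] at h3
  rw [le_div_iff₀ hε]
  linarith [hc τ hτ]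

set_option maxHeartbeats 1000000 in
theorem good2 (l : ℕ) (κ : ℝ) (hκ : 0 < κ) : ∃ ε > (0:ℝ), ε ≤ 1 ∧
    ∀ (U U' V V' : ℝ → ℝ) (e e' : Fin (l+1) → ℝ) (τ1 τ2 : ℝ), τ1 ∈ Icc (0:ℝ) 1 →
    τ2 ∈ Icc (0:ℝ) 1 → |U τ1| = 1 → V τ1 = 0 → |V τ2| = 1 →
    (∀ τ ∈ Icc (0:ℝ) 1, |U τ| ≤ 1 ∧ |V τ| ≤ 1 ∧ |U τ - pl e τ| ≤ ε ∧ |U' τ - pl' e τ| ≤ ε ∧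
      |V τ - pl e' τ| ≤ ε ∧ |V' τ - pl' e' τ| ≤ ε) → ∀ τs ∈ Icc (0:ℝ) 1,
    volume {τ : ℝ | τ ∈ Icc (0:ℝ) 1 ∧ |U τ * V' τ - U' τ * V τ| <
      ε * |U τs * V' τs - U' τs * V τs|} ≤ oR κ := by
  obtain ⟨M, hM, hMb⟩ := coef_bd l
  let X : Set ((Fin (l+1) → ℝ) × (Fin (l+1) → ℝ) × ℝ × ℝ) :=
    (cb 0 M ×ˢ (cb 0 M ×ˢ (Icc (0:ℝ) 1 ×ˢ Icc (0:ℝ) 1))) ∩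
    {c | (∀ τ ∈ Icc (0:ℝ) 1, |pl c.1 τ| ≤ 5/4) ∧ 3/4 ≤ |pl c.1 c.2.2.1| ∧
      |pl c.2.1 c.2.2.1| ≤ 1/4 ∧ 3/4 ≤ |pl c.2.1 c.2.2.2|}
  have hplc : ∀ {P : Type} [TopologicalSpace P] {a : P → Fin (l+1) → ℝ} {b : P → ℝ},
      Continuous a → Continuous b → Continuous (fun c => pl (a c) (b c)) :=
    fun ha hb => pl_cont.comp (ha.prodMk hb)
  have hplc' : ∀ {P : Type} [TopologicalSpace P] {a : P → Fin (l+1) → ℝ} {b : P → ℝ},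
      Continuous a → Continuous b → Continuous (fun c => pl' (a c) (b c)) :=
    fun ha hb => pl'_cont.comp (ha.prodMk hb)
  have hX : IsCompact X := by
    apply IsCompact.inter_right
    · exact (isCompact_closedBall _ _).prod ((isCompact_closedBall _ _).prod
        (isCompact_Icc.prod isCompact_Icc))
    · apply IsClosed.inter
      · have : {c : (Fin (l+1) → ℝ) × (Fin (l+1) → ℝ) × ℝ × ℝ |
            ∀ τ ∈ Icc (0:ℝ) 1, |pl c.1 τ| ≤ 5/4} =
            ⋂ τ ∈ Icc (0:ℝ) 1, {c | |pl c.1 τ| ≤ 5/4} := by ext c; simp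
        show IsClosed {c : (Fin (l+1) → ℝ) × (Fin (l+1) → ℝ) × ℝ × ℝ |
            ∀ τ ∈ Icc (0:ℝ) 1, |pl c.1 τ| ≤ 5/4}
        rw [this]
        exact isClosed_biInter fun τ _ => isClosed_le
          (hplc continuous_fst continuous_const).abs continuous_const
      · apply IsClosed.inter
        · exact isClosed_le continuous_const
            (hplc continuous_fst (continuous_snd.snd.fst)).abs
        · apply IsClosed.inter
          · exact isClosed_le (hplc continuous_snd.fst continuous_snd.snd.fst).abs continuous_const
          · exact isClosed_le continuous_const
              (hplc continuous_snd.fst continuous_snd.snd.snd).abs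
  obtain ⟨ε0, hε0, hgood⟩ := compact_good X hX
    (fun c τ => pl c.1 τ * pl' c.2.1 τ - pl' c.1 τ * pl c.2.1 τ)
    (((hplc continuous_fst.fst continuous_snd).mul
      (hplc' continuous_fst.snd.fst continuous_snd)).sub
      ((hplc' continuous_fst.fst continuous_snd).mul
      (hplc continuous_fst.snd.fst continuous_snd)))
    (by
      rintro ⟨e, e', τ1, τ2⟩ ⟨⟨h1, h2, h3, h4⟩, h5, h6, h7, h8⟩
      simp only at h1 h2 h3 h4 h5 h6 h7 h8 ⊢
      have hp : ply e ≠ 0 := by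
        intro h0
        rw [← ply_eval, h0] at h6
        norm_num at h6
      have hW : ply e * Polynomial.derivative (ply e') -
          Polynomial.derivative (ply e) * ply e' ≠ 0 := by
        intro h0
        obtain ⟨c, hc⟩ := poly_wr_ne _ _ hp h0
        have hev : ∀ τ, pl e' τ = c * pl e τ := by
          intro τ
          rw [← ply_eval, hc, Polynomial.eval_mul, Polynomial.eval_C, ply_eval]
        rw [hev, abs_mul] at h7 h8
        have h9 := h5 τ2 h4
        nlinarith [abs_nonneg c, abs_nonneg (pl e τ1), abs_nonneg (pl e τ2)]
      have := poly_null _ hW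
      simpa only [Polynomial.eval_sub, Polynomial.eval_mul, ply_eval, ply_deriv_eval] using this)
    κ hκ
  set B : ℝ := (l + 1) * (l * M) with hB
  have hB0 : 0 ≤ B := by positivity
  set ε1 := min ε0 1 with hε1
  have hε1p : 0 < ε1 := lt_min hε0 one_pos
  have hε11 : ε1 ≤ 1 := min_le_right _ _
  set ε := ε1 / (8 * B + 8) with hεd
  have hεp : 0 < ε := by positivity
  have hεe : ε * (8 * B + 8) = ε1 := by rw [hεd]; field_simp
  have hε8 : ε ≤ 1/8 := by nlinarith
  refine ⟨ε, hεp, by linarith, ?_⟩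
  intro U U' V V' e e' τ1 τ2 hτ1 hτ2 hU1 hV1 hV2 hcl τs hτs
  have hpe : ∀ τ ∈ Icc (0:ℝ) 1, |pl e τ| ≤ 5/4 := by
    intro τ hτ
    obtain ⟨a1, a2, a3, a4, a5, a6⟩ := hcl τ hτ
    rw [abs_le] at *; constructor <;> linarith
  have hqe : ∀ τ ∈ Icc (0:ℝ) 1, |pl e' τ| ≤ 5/4 := by
    intro τ hτ
    obtain ⟨a1, a2, a3, a4, a5, a6⟩ := hcl τ hτ
    rw [abs_le] at *; constructor <;> linarith
  have heM := hMb e fun τ hτ => (hpe τ hτ).trans (by norm_num)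
  have heM' := hMb e' fun τ hτ => (hqe τ hτ).trans (by norm_num)
  have hp' : ∀ τ ∈ Icc (0:ℝ) 1, |pl' e τ| ≤ B := fun τ hτ =>
    (pl'_bound e τ hτ).trans (by rw [hB]; gcongr)
  have hq' : ∀ τ ∈ Icc (0:ℝ) 1, |pl' e' τ| ≤ B := fun τ hτ =>
    (pl'_bound e' τ hτ).trans (by rw [hB]; gcongr)
  have hmem : (e, e', τ1, τ2) ∈ X := by
    refine ⟨⟨by simpa using heM, by simpa using heM', hτ1, hτ2⟩, hpe, ?_, ?_, ?_⟩
    · obtain ⟨a1, a2, a3, a4, a5, a6⟩ := hcl τ1 hτ1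
      have := abs_sub_abs_le_abs_sub (U τ1) (pl e τ1)
      show 3/4 ≤ |pl e τ1|
      linarith
    · obtain ⟨a1, a2, a3, a4, a5, a6⟩ := hcl τ1 hτ1
      rw [hV1, zero_sub, abs_neg] at a5
      show |pl e' τ1| ≤ 1/4
      linarith
    · obtain ⟨a1, a2, a3, a4, a5, a6⟩ := hcl τ2 hτ2
      have := abs_sub_abs_le_abs_sub (V τ2) (pl e' τ2)
      show 3/4 ≤ |pl e' τ2|
      linarith
  have hdiff : ∀ τ ∈ Icc (0:ℝ) 1, |(U τ * V' τ - U' τ * V τ) -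
      (pl e τ * pl' e' τ - pl' e τ * pl e' τ)| ≤ ε * (2 + 2 * B) := by
    intro τ hτ
    obtain ⟨a1, a2, a3, a4, a5, a6⟩ := hcl τ hτ
    have b1 : |U τ * (V' τ - pl' e' τ)| ≤ 1 * ε := by rw [abs_mul]; gcongr
    have b2 : |(U τ - pl e τ) * pl' e' τ| ≤ ε * B := by
      rw [abs_mul]; gcongr; exact hq' τ hτ
    have b3 : |(U' τ - pl' e τ) * V τ| ≤ ε * 1 := by rw [abs_mul]; gcongr
    have b4 : |pl' e τ * (V τ - pl e' τ)| ≤ B * ε := by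
      rw [abs_mul]; gcongr; exact hp' τ hτ
    rw [abs_le] at *
    constructor <;> nlinarith
  have hup : |U τs * V' τs - U' τs * V τs| ≤ 3 * B + 1 := by
    have h1 := hdiff τs hτs
    have b1 : |pl e τs * pl' e' τs| ≤ 5/4 * B := by
      rw [abs_mul]; gcongr; exacts [hpe τs hτs, hq' τs hτs]
    have b2 : |pl' e τs * pl e' τs| ≤ B * (5/4) := by
      rw [abs_mul]; gcongr; exacts [hp' τs hτs, hqe τs hτs]
    have b3 : ε * (2 + 2 * B) ≤ 1 / 2 * B + 1 := by nlinarith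
    rw [abs_le] at *
    constructor <;> linarith
  refine le_trans (measure_mono ?_) (hgood _ hmem)
  rintro τ ⟨hτ, hlt⟩
  refine ⟨hτ, ?_⟩
  have h1 := hdiff τ hτ
  have h2 : ε * |U τs * V' τs - U' τs * V τs| ≤ ε * (3 * B + 1) := by gcongr
  have h3 : |U τ * V' τ - U' τ * V τ| < ε * (3 * B + 1) := hlt.trans_le h2
  have h4 : ε1 ≤ ε0 := min_le_left _ _
  show |pl e τ * pl' e' τ - pl' e τ * pl e' τ| < ε0
  rw [abs_le] at h1
  rw [abs_lt] at *
  constructor <;> nlinarith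

end P6a

noncomputable section P6b

variable {J : ℕ}

def wrl (g : Mp 1 J) (u0 : ℝ) (u : Rv J) (v0 : ℝ) (v : Rv J)
    (x : Rv 1) : ℝ :=
  lin g u0 u x * linD g v0 v [0] x - linD g u0 u [0] x * lin g v0 v x

theorem lin_sub (g : Mp 1 J) (u0 : ℝ) (u : Rv J) (v0 : ℝ) (v : Rv J)
    (t : ℝ) (x : Rv 1) : lin g (v0 - t * u0) (v - t • u) x = lin g v0 v x - t * lin g u0 u x := by
  simp only [lin, Pi.sub_apply, Pi.smul_apply, smul_eq_mul, sub_mul, Finset.sum_sub_distrib, mul_add,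
    Finset.mul_sum, mul_assoc]
  ring

theorem linD_sub (g : Mp 1 J) (u0 : ℝ) (u : Rv J) (v0 : ℝ) (v : Rv J)
    (t : ℝ) (x : Rv 1) : linD g (v0 - t * u0) (v - t • u) [0] x =
      linD g v0 v [0] x - t * linD g u0 u [0] x := by
  simp [linD, sub_mul, Finset.sum_sub_distrib, Finset.mul_sum, mul_assoc]

theorem lin_deg {g : Mp 1 J} {x0 : Rv 1} {l : ℕ} {r1 c : ℝ}
    {Ω : Set (Rv 1)} (S : Setup g x0 l r1 c Ω) {y : Rv 1} {ρ : ℝ} (hρ : 0 < ρ)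
    (hQ : cb y ρ ⊆ cb x0 r1) (u0 : ℝ) (u : Rv J) : ∃ x1 ∈ cb y ρ,
      (∀ x ∈ cb y ρ, |lin g u0 u x| ≤ |lin g u0 u x1|) ∧ c * ρ ^ l * ‖u‖ ≤ |lin g u0 u x1| ∧
      (lin g u0 u x1 = 0 → ∀ x ∈ cb y ρ, lin g u0 u x = 0 ∧ linD g u0 u [0] x = 0) := by
  have hc := S.hc
  obtain ⟨x1, hx1, hmax⟩ := (isCompact_closedBall y ρ).exists_isMaxOn
    (Metric.nonempty_closedBall.2 hρ.le) ((lin_contOn S u0 u).mono (hQ.trans S.hsub)).abs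
  have hm : ∀ x ∈ cb y ρ, |lin g u0 u x| ≤ |lin g u0 u x1| := fun x hx => hmax hx
  have hn : c * ρ ^ l * ‖u‖ ≤ |lin g u0 u x1| := by
    obtain ⟨w, hw, hw'⟩ := S.hN y ρ hρ hQ u0 u
    exact hw'.trans (hm w hw)
  refine ⟨x1, hx1, hm, hn, fun h0 x hx => ?_⟩
  have h1 := hm x hx
  rw [h0, abs_zero] at h1 hn
  have hu : u = 0 := by
    rw [← norm_eq_zero]
    have h2 : 0 < c * ρ ^ l := by positivity
    nlinarith [norm_nonneg u]
  exact ⟨abs_eq_zero.1 (le_antisymm h1 (abs_nonneg _)), by simp [linD, hu]⟩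

theorem vol_one (y : Rv 1) (ρ : ℝ) (hρ : 0 < ρ) (P : (Rv 1) → Prop) (κ : ℝ)
    (h : volume {τ : ℝ | τ ∈ Icc (0:ℝ) 1 ∧ P (Function.update y 0 (y 0 - ρ + 2 * ρ * τ))} ≤
      oR κ) :
    volume {x | x ∈ cb y ρ ∧ P x} ≤ oR κ * volume (cb y ρ) := by
  have h1 := vol_Icc_le (y 0 - ρ) (2 * ρ) (by positivity) (fun s => P (Function.update y 0 s)) κ h
  rw [p3_vol_cb y hρ.le, pow_one]
  refine le_trans ?_ h1
  rw [← (volume_preserving_funUnique (Fin 1) ℝ).measure_preimage_equiv]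
  apply measure_mono
  rintro x ⟨hx, hP⟩
  have hxe : Function.update y 0 (x 0) = x := by
    ext i; fin_cases i; simp
  rw [Metric.mem_closedBall, dist_pi_le_iff hρ.le] at hx
  have h2 := hx 0
  rw [Real.dist_eq, abs_le] at h2
  show (x default ∈ _) ∧ P (Function.update y 0 (x default))
  rw [show (default : Fin 1) = 0 from rfl, hxe]
  exact ⟨⟨by linarith, by linarith⟩, hP⟩

theorem lem_LW {g : Mp 1 J} {x0 : Rv 1} {l : ℕ} {r1 c : ℝ}
    {Ω : Set (Rv 1)} (S : Setup g x0 l r1 c Ω) (hl : 1 ≤ l) (κ : ℝ) (hκ : 0 < κ) :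
    ∃ r0 > 0, r0 ≤ r1 ∧ ∃ ε > 0, ε ≤ 1 ∧ ∀ y ρ, 0 < ρ →
      cb y ρ ⊆ cb x0 r0 → ∀ u0 u v0 v, ∀ xs ∈ cb y ρ,
      volume {x | x ∈ cb y ρ ∧ |wrl g u0 u v0 v x| < ε * |wrl g u0 u v0 v xs|} ≤
        oR κ * volume (cb y ρ) := by
  obtain ⟨ε1, hε1, hε1', hgood⟩ := good2 l κ hκ
  have hc := S.hc
  obtain ⟨r0, hr0, hr01, hosc⟩ := osc_small S (ε1 * c / 2 ^ l) (by positivity)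
  refine ⟨r0, hr0, hr01, ε1, hε1, hε1', ?_⟩
  intro y ρ hρ hQ u0 u v0 v xs hxs
  have hQ1 : cb y ρ ⊆ cb x0 r1 := hQ.trans (Metric.closedBall_subset_closedBall hr01)
  by_cases hM0 : wrl g u0 u v0 v xs = 0
  · have : {x | x ∈ cb y ρ ∧ |wrl g u0 u v0 v x| < ε1 * |wrl g u0 u v0 v xs|} = ∅ := by
      ext x; simp only [hM0, abs_zero, mul_zero, Set.mem_ofPred_eq, Set.mem_empty_iff_false, iff_false]
      rintro ⟨-, h⟩
      exact absurd h (not_lt.2 (abs_nonneg _))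
    rw [this]; simp
  obtain ⟨x1, hx1, hu1, hu2, hu3⟩ := lin_deg S hρ hQ1 u0 u
  have hsu : lin g u0 u x1 ≠ 0 := by
    intro h
    obtain ⟨a, b⟩ := hu3 h xs hxs
    apply hM0; simp [wrl, a, b]
  set t := lin g v0 v x1 / lin g u0 u x1 with ht
  set w0 := v0 - t * u0 with hw0
  set w := v - t • u with hw
  have hwr : ∀ x, wrl g u0 u v0 v x = wrl g u0 u w0 w x := by
    intro x
    simp only [wrl, hw0, hw, lin_sub, linD_sub]; ring
  simp only [hwr] at hM0 ⊢
  have hwx1 : lin g w0 w x1 = 0 := by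
    rw [hw0, hw, lin_sub, ht, div_mul_cancel₀ _ hsu, sub_self]
  obtain ⟨x2, hx2, hw1, hw2, hw3⟩ := lin_deg S hρ hQ1 w0 w
  have hsw : lin g w0 w x2 ≠ 0 := by
    intro h
    obtain ⟨a, b⟩ := hw3 h xs hxs
    apply hM0; simp [wrl, a, b]
  obtain ⟨e, he⟩ := line_taylor S hr01 hosc y ρ hρ hQ y (Metric.mem_closedBall_self hρ.le) 0 u0 u
  obtain ⟨e', he'⟩ := line_taylor S hr01 hosc y ρ hρ hQ y (Metric.mem_closedBall_self hρ.le) 0 w0 w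
  set φ : ℝ → Fin 1 → ℝ := fun τ => Function.update y 0 (y 0 - ρ + 2 * ρ * τ) with hφ
  have hφQ : ∀ τ ∈ Icc (0:ℝ) 1, φ τ ∈ cb y ρ := by
    intro τ hτ
    apply upd_mem hρ.le (Metric.mem_closedBall_self hρ.le)
    constructor <;> nlinarith [hτ.1, hτ.2]
  have hφs : ∀ x ∈ cb y ρ, ∃ τ ∈ Icc (0:ℝ) 1, φ τ = x := by
    intro x hx
    rw [Metric.mem_closedBall, dist_pi_le_iff hρ.le] at hx
    have h2 := hx 0
    rw [Real.dist_eq, abs_le] at h2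
    refine ⟨(x 0 - (y 0 - ρ)) / (2 * ρ), ⟨?_, ?_⟩, ?_⟩
    · apply div_nonneg _ (by positivity); linarith
    · rw [div_le_one (by positivity)]; linarith
    · ext i; fin_cases i; simp [hφ]; field_simp; ring
  obtain ⟨τ1, hτ1, rfl⟩ := hφs x1 hx1
  obtain ⟨τ2, hτ2, rfl⟩ := hφs x2 hx2
  obtain ⟨τs, hτs, rfl⟩ := hφs xs hxs
  set su := |lin g u0 u (φ τ1)| with hsud
  set sw := |lin g w0 w (φ τ2)| with hswd
  have hsup : 0 < su := abs_pos.2 hsu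
  have hswp : 0 < sw := abs_pos.2 hsw
  have herr : ∀ s N : ℝ, c * ρ ^ l * N ≤ s → (2 * ρ) ^ l * (ε1 * c / 2 ^ l * N) ≤ ε1 * s := by
    intro s N h
    have : (2 * ρ) ^ l * (ε1 * c / 2 ^ l * N) = ε1 * (c * ρ ^ l * N) := by
      rw [mul_pow]; field_simp
    rw [this]; gcongr
  have hsc : ∀ (s : ℝ), 0 < s → ∀ e : Fin (l+1) → ℝ, ∀ τ, pl (s⁻¹ • e) τ = s⁻¹ * pl e τ ∧
      pl' (s⁻¹ • e) τ = s⁻¹ * pl' e τ := by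
    intro s _ e τ
    simp only [pl, pl', Pi.smul_apply, smul_eq_mul, Finset.mul_sum, mul_assoc, and_self]
  have hdv : ∀ (s a b : ℝ), 0 < s → |a - b| ≤ ε1 * s → |s⁻¹ * a - s⁻¹ * b| ≤ ε1 := by
    intro s a b hs h
    rw [← mul_sub, abs_mul, abs_of_pos (inv_pos.2 hs), inv_mul_eq_div, div_le_iff₀ hs]
    exact h
  have hG := hgood (fun τ => su⁻¹ * lin g u0 u (φ τ)) (fun τ => su⁻¹ * (2 * ρ * linD g u0 u [0] (φ τ)))
    (fun τ => sw⁻¹ * lin g w0 w (φ τ)) (fun τ => sw⁻¹ * (2 * ρ * linD g w0 w [0] (φ τ)))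
    (su⁻¹ • e) (sw⁻¹ • e') τ1 τ2 hτ1 hτ2
    (by simp only [abs_mul, abs_inv]; rw [abs_of_pos hsup, ← hsud, inv_mul_cancel₀ hsup.ne'])
    (by simp [hwx1])
    (by simp only [abs_mul, abs_inv]; rw [abs_of_pos hswp, ← hswd, inv_mul_cancel₀ hswp.ne'])
    (by
      intro τ hτ
      rw [(hsc su hsup e τ).1, (hsc su hsup e τ).2, (hsc sw hswp e' τ).1, (hsc sw hswp e' τ).2]
      refine ⟨?_, ?_, ?_, ?_, ?_, ?_⟩
      · rw [abs_mul, abs_of_pos (inv_pos.2 hsup), inv_mul_eq_div, div_le_one hsup]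
        exact hu1 _ (hφQ τ hτ)
      · rw [abs_mul, abs_of_pos (inv_pos.2 hswp), inv_mul_eq_div, div_le_one hswp]
        exact hw1 _ (hφQ τ hτ)
      · exact hdv _ _ _ hsup ((he τ hτ).1.trans (herr _ _ hu2))
      · exact hdv _ _ _ hsup (((he τ hτ).2 hl).trans (herr _ _ hu2))
      · exact hdv _ _ _ hswp ((he' τ hτ).1.trans (herr _ _ hw2))
      · exact hdv _ _ _ hswp (((he' τ hτ).2 hl).trans (herr _ _ hw2)))
    τs hτs
  apply vol_one y ρ hρ (fun x => |wrl g u0 u w0 w x| < ε1 * |wrl g u0 u w0 w (φ τs)|)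
  refine le_trans (measure_mono ?_) hG
  rintro τ ⟨hτ, hlt⟩
  refine ⟨hτ, ?_⟩
  have hid : ∀ x, su⁻¹ * lin g u0 u x * (sw⁻¹ * (2 * ρ * linD g w0 w [0] x)) -
      su⁻¹ * (2 * ρ * linD g u0 u [0] x) * (sw⁻¹ * lin g w0 w x) =
      (su⁻¹ * sw⁻¹ * (2 * ρ)) * wrl g u0 u w0 w x := by
    intro x; simp only [wrl]; ring
  have hpos : 0 < su⁻¹ * sw⁻¹ * (2 * ρ) := by positivity
  simp only [hid, abs_mul _ (wrl _ _ _ _ _ _), abs_of_pos hpos]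
  have h9 := mul_lt_mul_of_pos_left hlt hpos
  rw [mul_left_comm _ ε1] at h9
  exact h9

end P6b

noncomputable section P6c

variable {m : ℕ} {f : Mp 1 m} {p : (Rv 1) → Fin 1 → Fin m → ℝ}
  {x0 : Rv 1} {r0 L cN : ℝ} {l : ℕ} {κ e1 : ℝ} {A K ε : ℝ}

variable (f p) in
def WX (u v : Idx 1 m → ℝ) (x : Rv 1) : ℝ := Fx f u x * Dx p v x 0 - Dx p u x 0 * Fx f v x

theorem det_two {r : ℕ} (M : Matrix (Fin r) (Fin r) ℝ) {k k' : Fin r} (hk : k ≠ k')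
    (h : ∀ q, q ≠ k → q ≠ k' → ∀ l, M q l = (1 : Matrix (Fin r) (Fin r) ℝ) q l) :
    M.det = M k k * M k' k' - M k k' * M k' k := by
  let U : Matrix (Fin r) (Fin 2) ℝ := Matrix.of fun q i =>
    if i = 0 then (1 : Matrix (Fin r) (Fin r) ℝ) q k else (1 : Matrix (Fin r) (Fin r) ℝ) q k'
  let V : Matrix (Fin 2) (Fin r) ℝ := Matrix.of fun i l =>
    if i = 0 then M k l - (1 : Matrix (Fin r) (Fin r) ℝ) k l
    else M k' l - (1 : Matrix (Fin r) (Fin r) ℝ) k' l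
  have hM : M = 1 + U * V := by
    ext q l
    simp only [Matrix.add_apply, Matrix.mul_apply, Fin.sum_univ_two, U, V, Matrix.of_apply]
    by_cases h1 : q = k
    · subst h1; simp [Matrix.one_apply, hk]
    · by_cases h2 : q = k'
      · subst h2; simp [Matrix.one_apply, h1]
      · simp [Matrix.one_apply, h1, h2, h q h1 h2]
  have hv : (1 + V * U).det = M k k * M k' k' - M k k' * M k' k := by
    rw [Matrix.det_fin_two]
    simp [Matrix.mul_apply, U, V, hk, hk.symm, Matrix.one_apply]
  rw [← hv, ← Matrix.det_one_add_mul_comm, ← hM]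

theorem minor_good (G : Geo f p x0 r0 L cN l κ e1) {e2 : ℝ}
    (hW : ∀ y ρ, 0 < ρ → cb y ρ ⊆ cb x0 r0 → ∀ u v, ∀ xs ∈ cb y ρ,
      volume {x | x ∈ cb y ρ ∧ |WX f p u v x| < e2 * |WX f p u v xs|} ≤
        oR κ * volume (cb y ρ))
    {e3 : ℝ} (he1 : e3 ≤ e1) (he2 : e3 ≤ e2) {y : Rv 1} {ρ : ℝ} (hρ : 0 < ρ)
    (hQ : cb y ρ ⊆ cb x0 r0) {r : ℕ} (b : Matrix (Idx 1 m) (Fin r) ℝ) (σ : Fin r → Idx 1 m)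
    (xs : Rv 1) (hxs : xs ∈ cb y ρ) :
    volume {x | x ∈ cb y ρ ∧ |((RM f p x * b).submatrix σ id).det| <
      e3 * |((RM f p xs * b).submatrix σ id).det|} ≤ oR κ * volume (cb y ρ) := by
  set Y := (RM f p xs * b).submatrix σ id with hY
  by_cases h0 : Y.det = 0
  · have : {x | x ∈ cb y ρ ∧ |((RM f p x * b).submatrix σ id).det| < e3 * |Y.det|} = ∅ := by
      ext x; simp only [h0, abs_zero, mul_zero, Set.mem_ofPred_eq, Set.mem_empty_iff_false, iff_false]
      rintro ⟨-, h⟩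
      exact absurd h (not_lt.2 (abs_nonneg _))
    rw [this]; simp
  have hinj : Function.Injective σ := inj_of_det (b := RM f p xs * b) h0
  set b' := b * Y⁻¹ with hb'
  set Z : (Rv 1) → Matrix (Fin r) (Fin r) ℝ := fun x => (RM f p x * b').submatrix σ id with hZ
  have hdet : ∀ x, ((RM f p x * b).submatrix σ id).det = (Z x).det * Y.det := by
    intro x
    rw [← Matrix.det_mul]
    congr 1
    have : RM f p x * b = (RM f p x * b') * Y := by
      rw [hb', Matrix.mul_assoc, Matrix.mul_assoc,
        Matrix.nonsing_inv_mul _ (isUnit_iff_ne_zero.2 h0), Matrix.mul_one]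
    rw [this]
    ext i j; simp [hZ, Matrix.mul_apply]
  have hZs : Z xs = 1 := by
    have h1 : Z xs = Y * Y⁻¹ := by
      have h2 : RM f p xs * b' = (RM f p xs * b) * Y⁻¹ := by rw [hb', Matrix.mul_assoc]
      show (RM f p xs * b').submatrix σ id = _
      rw [h2]
      ext i j; rw [hY]; simp [Matrix.mul_apply]
    rw [h1, Matrix.mul_nonsing_inv _ (isUnit_iff_ne_zero.2 h0)]
  have hZW : ∀ q, (∃ j, σ q = iW j) → ∀ x l, Z x q l = (1 : Matrix (Fin r) (Fin r) ℝ) q l := by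
    rintro q ⟨j, hj⟩ x l
    rw [← hZs]
    simp only [hZ, Matrix.submatrix_apply, hj, id, RM_W]
  have fin : ∀ h : (Rv 1) → ℝ, (∀ x, (Z x).det = h x) →
      volume {x | x ∈ cb y ρ ∧ |h x| < e3 * |h xs|} ≤ oR κ * volume (cb y ρ) →
      volume {x | x ∈ cb y ρ ∧ |((RM f p x * b).submatrix σ id).det| < e3 * |Y.det|} ≤
        oR κ * volume (cb y ρ) := by
    intro h hh hv
    refine le_trans (measure_mono ?_) hv
    rintro x ⟨hx, hlt⟩
    refine ⟨hx, ?_⟩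
    rw [hdet, hh, abs_mul] at hlt
    have h1 : h xs = 1 := by rw [← hh, hZs, Matrix.det_one]
    rw [h1, abs_one, mul_one]
    exact lt_of_mul_lt_mul_right hlt (abs_nonneg _)
  have mono : ∀ (e : ℝ) (h : (Rv 1) → ℝ), e3 ≤ e →
      volume {x | x ∈ cb y ρ ∧ |h x| < e * |h xs|} ≤ oR κ * volume (cb y ρ) →
      volume {x | x ∈ cb y ρ ∧ |h x| < e3 * |h xs|} ≤ oR κ * volume (cb y ρ) := by
    intro e h he hv
    refine le_trans (measure_mono ?_) hv
    rintro x ⟨hx, hlt⟩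
    exact ⟨hx, hlt.trans_le (by gcongr)⟩
  have htri : ∀ a : Idx 1 m, a = iF ∨ a = iD 0 ∨ ∃ j, a = iW j := by
    rintro (a | i | j)
    · left; rfl
    · right; left; fin_cases i; rfl
    · right; right; exact ⟨j, rfl⟩
  by_cases hF : ∃ k, σ k = iF
  · obtain ⟨k, hk⟩ := hF
    by_cases hD : ∃ k, σ k = iD 0
    · obtain ⟨k', hk'⟩ := hD
      have hne : k ≠ k' := by rintro rfl; rw [hk] at hk'; simp at hk'
      apply fin (WX f p (fun a => b' a k) (fun a => b' a k'))
      · intro x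
        rw [det_two (Z x) hne]
        · simp only [hZ, Matrix.submatrix_apply, hk, hk', id, RM_F, RM_D, WX]; ring
        · intro q h1 h2
          apply hZW
          rcases htri (σ q) with h | h | h
          · exact absurd (hinj (h.trans hk.symm)) h1
          · exact absurd (hinj (h.trans hk'.symm)) h2
          · exact h
      · exact mono e2 _ he2 (hW y ρ hρ hQ _ _ xs hxs)
    · apply fin (Fx f (fun a => b' a k))
      · intro x
        have : Z x = (1 : Matrix (Fin r) (Fin r) ℝ).updateRow k (Z x k) := by
          ext q l
          by_cases hq : q = k
          · subst hq; simp
          · rw [Matrix.updateRow_ne hq]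
            apply hZW
            rcases htri (σ q) with h | h | h
            · exact absurd (hinj (h.trans hk.symm)) hq
            · exact absurd ⟨q, h⟩ hD
            · exact h
        rw [this, det_one_upd]
        simp only [hZ, Matrix.submatrix_apply, hk, id, RM_F]
      · exact mono e1 _ he1 (G.lg y ρ hρ hQ _ xs hxs)
  · by_cases hD : ∃ k, σ k = iD 0
    · obtain ⟨k', hk'⟩ := hD
      apply fin (WX f p (fun a => if a = iF then 1 else 0) (fun a => b' a k'))
      · intro x
        have : Z x = (1 : Matrix (Fin r) (Fin r) ℝ).updateRow k' (Z x k') := by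
          ext q l
          by_cases hq : q = k'
          · subst hq; simp
          · rw [Matrix.updateRow_ne hq]
            apply hZW
            rcases htri (σ q) with h | h | h
            · exact absurd ⟨q, h⟩ hF
            · exact absurd (hinj (h.trans hk'.symm)) hq
            · exact h
        rw [this, det_one_upd]
        simp only [hZ, Matrix.submatrix_apply, hk', id, RM_D, WX]
        simp [Fx, Dx]
      · exact mono e2 _ he2 (hW y ρ hρ hQ _ _ xs hxs)
    · apply fin (fun _ => 1)
      · intro x
        have : Z x = 1 := by
          ext q l
          apply hZW
          rcases htri (σ q) with h | h | h
          · exact absurd ⟨q, h⟩ hF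
          · exact absurd ⟨q, h⟩ hD
          · exact h
        rw [this, Matrix.det_one]
      · have : {x | x ∈ cb y ρ ∧ |(1:ℝ)| < e3 * |(1:ℝ)|} = ∅ := by
          ext x; simp only [abs_one, mul_one, Set.mem_ofPred_eq, Set.mem_empty_iff_false, iff_false]
          rintro ⟨-, h⟩
          linarith [G.he1']
        rw [this]; simp

theorem Fnz {d m : ℕ} {f : Mp d m} {p : (Rv d) → Fin d → Fin m → ℝ}
    {x0 : Rv d} (G : Geo f p x0 r0 L cN l κ e1) {u : Idx d m → ℝ} (hu : u ≠ 0)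
    {y : Rv d} {ρ : ℝ} (hρ : 0 < ρ) (hQ : cb y ρ ⊆ cb x0 r0) : ∃ x ∈ cb y ρ, Fx f u x ≠ 0 := by
  obtain ⟨x, hx, h⟩ := G.npr y ρ hρ hQ u
  refine ⟨x, hx, fun h0 => hu ?_⟩
  have hc := G.hcN
  have hb : ∀ b, u (Sum.inr b) = 0 := by
    intro b
    have := h b
    rw [h0, abs_zero] at this
    have h1 : 0 < cN * ρ ^ l := by positivity
    have h2 : |u (Sum.inr b)| ≤ 0 := by
      by_contra hc
      push Not at hc
      nlinarith [mul_pos h1 hc]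
    exact abs_eq_zero.1 (le_antisymm h2 (abs_nonneg _))
  have hF : u iF = 0 := by
    rw [Fx] at h0
    simpa [hb] using h0
  funext a
  rcases a with a | a
  · exact hF
  · exact hb a

theorem wx_exists (G : Geo f p x0 r0 L cN l κ e1) {u v : Idx 1 m → ℝ} (hu : u ≠ 0)
    (huv : ∀ c : ℝ, (fun a => v a - c * u a) ≠ 0) {z : Rv 1} {ρ : ℝ} (hρ : 0 < ρ)
    (hQ : cb z ρ ⊆ cb x0 r0) : ∃ x ∈ cb z ρ, WX f p u v x ≠ 0 := by
  by_contra hcon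
  push Not at hcon
  have hs2 : cb z (ρ/2) ⊆ cb x0 r0 := (Metric.closedBall_subset_closedBall (by linarith)).trans hQ
  obtain ⟨x1, hx1, hne⟩ := Fnz G hu (half_pos hρ) hs2
  have hin : ∀ s ∈ Icc (-(ρ/2)) (ρ/2), x1 + s • ev 0 ∈ cb z ρ := by
    intro s hs
    exact mem_cb_shift hx1 0 (by have := abs_le.2 hs; linarith)
  have hd : ∀ w : Idx 1 m → ℝ, ∀ s ∈ Icc (-(ρ/2)) (ρ/2),
      HasDerivAt (fun s : ℝ => Fx f w (x1 + s • ev 0)) (Dx p w (x1 + s • ev 0) 0) s :=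
    fun w s hs => Fx_line G w x1 0 s (hQ (hin s hs))
  have h00 : (0:ℝ) ∈ Icc (-(ρ/2)) (ρ/2) := ⟨by linarith, by linarith⟩
  have hcont := (hd u 0 h00).continuousAt
  have hev : ∀ᶠ s in nhds (0:ℝ), Fx f u (x1 + s • ev 0) ≠ 0 :=
    hcont.eventually_ne (by simpa using hne)
  obtain ⟨δ, hδ, hball⟩ := Metric.eventually_nhds_iff_ball.1 hev
  set δ' := min δ (ρ/2) with hδ'
  have hδp : 0 < δ' := lt_min hδ (by linarith)
  have hδi : ∀ s ∈ Ioo (-δ') δ', s ∈ Icc (-(ρ/2)) (ρ/2) := fun s hs =>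
    ⟨by have := min_le_right δ (ρ/2); linarith [hs.1],
     by have := min_le_right δ (ρ/2); linarith [hs.2]⟩
  obtain ⟨c, hc⟩ := wr_dep (a := -δ') (b := δ') _ _ _ _ (fun s hs => hd u s (hδi s hs))
    (fun s hs => hd v s (hδi s hs)) (fun s hs => hball s (by
      rw [Real.ball_eq_Ioo]
      have := min_le_left δ (ρ/2)
      exact ⟨by linarith [hs.1], by linarith [hs.2]⟩))
    (fun s hs => hcon _ (hin s (hδi s hs)))
  have hsub : cb x1 (δ'/2) ⊆ cb x0 r0 := by
    refine subset_trans (Metric.closedBall_subset_closedBall' ?_) hQ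
    rw [Metric.mem_closedBall] at hx1
    have := min_le_right δ (ρ/2)
    linarith
  obtain ⟨x, hx, hx1'⟩ := Fnz G (huv c) (half_pos hδp) hsub
  apply hx1'
  have hxe : x = x1 + (x 0 - x1 0) • ev 0 := by
    ext i; fin_cases i; simp [ev]
  have hb : x 0 - x1 0 ∈ Ioo (-δ') δ' := by
    rw [Metric.mem_closedBall, dist_pi_le_iff (by positivity)] at hx
    have := hx 0
    rw [Real.dist_eq, abs_le] at this
    exact ⟨by linarith [this.1], by linarith [this.2]⟩
  have h2 := hc _ hb
  rw [← hxe] at h2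
  have h3 : Fx f (fun a => v a - c * u a) x = Fx f v x - c * Fx f u x := by
    simp only [Fx, mul_sub, Finset.sum_sub_distrib, mul_add, Finset.mul_sum, mul_left_comm _ c]
    ring
  rw [h3, h2, sub_self]

end P6c

noncomputable section P6d

theorem span_rows {ι : Type*} {r : ℕ} (B : Matrix ι (Fin r) ℝ) (σ : Fin r → ι)
    (h : (B.submatrix σ id).det ≠ 0) : Submodule.span ℝ (Set.range fun a => B a) = ⊤ := by
  have h1 : LinearIndependent ℝ (fun k => (B.submatrix σ id) k) :=
    Matrix.linearIndependent_rows_iff_isUnit.2 ((Matrix.isUnit_iff_isUnit_det _).2 h.isUnit)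
  have h2 := h1.span_eq_top_of_card_eq_finrank' (by simp)
  rw [eq_top_iff, ← h2, Submodule.span_le]
  rintro _ ⟨k, rfl⟩
  exact Submodule.subset_span ⟨σ k, rfl⟩

theorem ext_minor {ι : Type*} [Finite ι] {r : ℕ} (X : Matrix ι (Fin r) ℝ)
    (hX : Submodule.span ℝ (Set.range fun a => X a) = ⊤) (s : Set ι)
    (hs : LinearIndepOn ℝ (fun a => X a) s) :
    ∃ τ : Fin r → ι, (X.submatrix τ id).det ≠ 0 ∧ s ⊆ range τ := by
  classical
  obtain ⟨b, -, hsb, hsp, hli⟩ := exists_linearIndepOn_extension hs (Set.subset_univ s)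
  have hfin : Fintype b := Fintype.ofFinite b
  have htop : ⊤ ≤ Submodule.span ℝ (Set.range fun x : b => X x) := by
    rw [← hX, Submodule.span_le]
    rintro _ ⟨a, rfl⟩
    have := hsp ⟨a, Set.mem_univ a, rfl⟩
    rw [Set.image_eq_range] at this
    exact this
  have hcard : Fintype.card b = r := by
    have := Module.finrank_eq_card_basis (Module.Basis.mk hli.linearIndependent htop)
    simpa using this.symm
  let e : Fin r ≃ b := (Fintype.equivFinOfCardEq hcard).symm
  refine ⟨fun k => (e k : ι), ?_, ?_⟩
  · have h1 : LinearIndependent ℝ (fun k => (X.submatrix (fun k => (e k : ι)) id) k) :=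
      hli.linearIndependent.comp e e.injective
    exact ((Matrix.isUnit_iff_isUnit_det _).1 (Matrix.linearIndependent_rows_iff_isUnit.1 h1)).ne_zero
  · intro a ha
    exact ⟨e.symm ⟨a, hsb ha⟩, by simp⟩

variable {m : ℕ} {f : Mp 1 m} {p : (Rv 1) → Fin 1 → Fin m → ℝ}
  {x0 : Rv 1} {r0 L cN : ℝ} {l : ℕ} {κ e1 : ℝ} {A K ε : ℝ} {z : Rv 1} {ρ : ℝ}

theorem fd_exists (G : Geo f p x0 r0 L cN l κ e1) (hρ : 0 < ρ) (hQ : cb z ρ ⊆ cb x0 r0)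
    {r : ℕ} (hr : 1 ≤ r) (B : Matrix (Idx 1 m) (Fin r) ℝ) (σ : Fin r → Idx 1 m)
    (hσ : (B.submatrix σ id).det ≠ 0) :
    ∃ x ∈ cb z ρ, ∃ τ : Fin r → Idx 1 m, ((RM f p x * B).submatrix τ id).det ≠ 0 ∧
      (∃ k, τ k = iF) ∧ (2 ≤ r → ∃ k, τ k = iD 0) := by
  have hspan : ∀ x, Submodule.span ℝ (Set.range fun a => (RM f p x * B) a) = ⊤ := by
    intro x
    rw [eq_top_iff, ← span_rows B σ hσ, Submodule.span_le]
    rintro _ ⟨a, rfl⟩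
    have h1 : B = (RM f p x)⁻¹ * (RM f p x * B) := by
      rw [← Matrix.mul_assoc, Matrix.nonsing_inv_mul _ (by rw [RM_det]; exact isUnit_one),
        Matrix.one_mul]
    have h2 : B a = ∑ a', (RM f p x)⁻¹ a a' • (RM f p x * B) a' := by
      funext q
      conv_lhs => rw [h1]
      simp [Matrix.mul_apply (M := (RM f p x)⁻¹)]
    simp only
    rw [h2]
    exact Submodule.sum_mem _ fun a' _ => Submodule.smul_mem _ _ (Submodule.subset_span ⟨a', rfl⟩)
  have hu : (fun a => B a ⟨0, hr⟩) ≠ 0 := by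
    intro h0
    exact hσ (Matrix.det_eq_zero_of_column_eq_zero ⟨0, hr⟩ fun i => congrFun h0 (σ i))
  by_cases h2 : 2 ≤ r
  · obtain ⟨x, hx, hne⟩ := wx_exists G (v := fun a => B a ⟨1, h2⟩) hu (by
      intro c hc
      refine hσ (Matrix.exists_mulVec_eq_zero_iff.1
        ⟨Pi.single ⟨1, h2⟩ 1 - c • Pi.single ⟨0, hr⟩ 1, ?_, ?_⟩)
      · intro h
        have := congrFun h ⟨1, h2⟩
        simp [Pi.single_apply] at this
      · rw [Matrix.mulVec_sub, Matrix.mulVec_smul]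
        funext k
        have := congrFun hc (σ k)
        simpa using this) hρ hQ
    obtain ⟨τ, ht, hs⟩ := ext_minor _ (hspan x) {iF, iD 0} (by
      rw [LinearIndepOn.pair_iff _ (by simp)]
      intro a b hab
      have e0 := congrFun hab ⟨0, hr⟩
      have e1 := congrFun hab ⟨1, h2⟩
      simp only [Pi.add_apply, Pi.smul_apply, smul_eq_mul, Pi.zero_apply, RM_F, RM_D] at e0 e1
      simp only [WX] at hne
      constructor
      · refine (mul_eq_zero.1 (?_ : a * _ = 0)).resolve_right hne
        linear_combination Dx p (fun a => B a ⟨1, h2⟩) x 0 * e0 - Dx p (fun a => B a ⟨0, hr⟩) x 0 * e1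
      · refine (mul_eq_zero.1 (?_ : b * _ = 0)).resolve_right hne
        linear_combination Fx f (fun a => B a ⟨0, hr⟩) x * e1 - Fx f (fun a => B a ⟨1, h2⟩) x * e0)
    exact ⟨x, hx, τ, ht, hs (by simp), fun _ => hs (by simp)⟩
  · obtain ⟨x, hx, hne⟩ := Fnz G hu hρ hQ
    obtain ⟨τ, ht, hs⟩ := ext_minor _ (hspan x) {iF} (by
      rw [linearIndepOn_singleton_iff]
      intro h
      have := congrFun h ⟨0, hr⟩
      rw [RM_F] at this
      exact hne this)
    exact ⟨x, hx, τ, ht, hs (by simp), fun h => absurd h h2⟩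

theorem fd_lower (G : Geo f p x0 r0 L cN l κ e1) (hρ : 0 < ρ) (hQ : cb z ρ ⊆ cb x0 r0)
    {r : ℕ} (hr : 1 ≤ r) : ∃ c > 0, ∀ (B : Idx 1 m → Fin r → ℝ) (σ : Fin r → Idx 1 m),
    (∀ a q, B a q ∈ Icc (-1:ℝ) 1) → (∀ k q, B (σ k) q = if k = q then 1 else 0) →
    ∃ x ∈ cb z ρ, ∃ τ : Fin r → Idx 1 m, c ≤ |((RM f p x * Matrix.of B).submatrix τ id).det| ∧
      (∃ k, τ k = iF) ∧ (2 ≤ r → ∃ k, τ k = iD 0) := by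
  let S : Set (Idx 1 m → Fin r → ℝ) := (Set.univ.pi fun a => Set.univ.pi fun q => Icc (-1:ℝ) 1) ∩
    ⋃ σ : Fin r → Idx 1 m, {B | ∀ k q, B (σ k) q = if k = q then 1 else 0}
  have hS : IsCompact S := by
    refine (isCompact_univ_pi fun a => isCompact_univ_pi fun q => isCompact_Icc).inter_right ?_
    refine isClosed_iUnion_of_finite fun σ => ?_
    simp only [Set.ofPred_forall]
    exact isClosed_iInter fun k => isClosed_iInter fun q =>
      isClosed_eq (by fun_prop) continuous_const
  have key : ∃ c > 0, ∀ B ∈ S,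
    ∃ x ∈ cb z ρ, ∃ τ : Fin r → Idx 1 m, c ≤ |((RM f p x * Matrix.of B).submatrix τ id).det| ∧
      (∃ k, τ k = iF) ∧ (2 ≤ r → ∃ k, τ k = iD 0) := by
    refine hS.induction_on (p := fun S => ∃ c > 0, ∀ B ∈ S,
      ∃ x ∈ cb z ρ, ∃ τ : Fin r → Idx 1 m, c ≤ |((RM f p x * Matrix.of B).submatrix τ id).det| ∧
      (∃ k, τ k = iF) ∧ (2 ≤ r → ∃ k, τ k = iD 0)) ⟨1, one_pos, by simp⟩ ?_ ?_ ?_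
    · rintro s t hst ⟨c, hc, h⟩
      exact ⟨c, hc, fun B hB => h B (hst hB)⟩
    · rintro s t ⟨c, hc, h⟩ ⟨c', hc', h'⟩
      refine ⟨min c c', lt_min hc hc', ?_⟩
      rintro B (hB | hB)
      · obtain ⟨x, hx, τ, h1, h2⟩ := h B hB
        exact ⟨x, hx, τ, (min_le_left _ _).trans h1, h2⟩
      · obtain ⟨x, hx, τ, h1, h2⟩ := h' B hB
        exact ⟨x, hx, τ, (min_le_right _ _).trans h1, h2⟩
    · rintro B ⟨-, hB⟩
      obtain ⟨σ, hσ⟩ := Set.mem_iUnion.1 hB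
      have hone : (Matrix.of B).submatrix σ id = 1 := by
        ext k q
        simpa [Matrix.one_apply] using hσ k q
      obtain ⟨x, hx, τ, h1, h2⟩ := fd_exists G hρ hQ hr (Matrix.of B) σ (by rw [hone]; simp)
      set c := |((RM f p x * Matrix.of B).submatrix τ id).det| with hc
      have hc0 : 0 < c := abs_pos.2 h1
      have hcont : Continuous fun B : Idx 1 m → Fin r → ℝ =>
          |((RM f p x * Matrix.of B).submatrix τ id).det| := by
        refine Continuous.abs (Continuous.matrix_det (Continuous.matrix_submatrix ?_ _ _))
        exact Continuous.matrix_mul continuous_const continuous_id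
      have hev : ∀ᶠ B' in nhds B, c / 2 < |((RM f p x * Matrix.of B').submatrix τ id).det| :=
        hcont.continuousAt.eventually (lt_mem_nhds (by simp only [← hc]; linarith))
      exact ⟨_, mem_nhdsWithin_of_mem_nhds hev, c / 2, half_pos hc0,
        fun B' hB' => ⟨x, hx, τ, le_of_lt hB', h2⟩⟩
  obtain ⟨c, hc, h⟩ := key
  refine ⟨c, hc, fun B σ h1 h2 => h B ⟨?_, Set.mem_iUnion.2 ⟨σ, h2⟩⟩⟩
  intro a _ q _
  exact h1 a q

theorem int_lower (G : Geo f p x0 r0 L cN l κ e1) (hρ : 0 < ρ) (hQ : cb z ρ ⊆ cb x0 r0)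
    (N : ℕ) : ∃ c > 0, ∀ r, 1 ≤ r → r ≤ N → ∀ b : Matrix (Idx 1 m) (Fin r) ℤ,
    (∃ σ : Fin r → Idx 1 m, ((rm b).submatrix σ id).det ≠ 0) →
    ∃ x ∈ cb z ρ, ∃ τ : Fin r → Idx 1 m, c ≤ |((RM f p x * rm b).submatrix τ id).det| ∧
      (∃ k, τ k = iF) ∧ (2 ≤ r → ∃ k, τ k = iD 0) := by
  induction N with
  | zero => exact ⟨1, one_pos, fun r h1 h2 => by omega⟩
  | succ N ih =>
    obtain ⟨c1, hc1, h1⟩ := ih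
    obtain ⟨c2, hc2, h2⟩ := fd_lower G hρ hQ (r := N + 1) (by omega)
    refine ⟨min c1 c2, lt_min hc1 hc2, ?_⟩
    intro r hr hrN b hb
    rcases Nat.lt_or_ge N r with hlt | hle
    · have : r = N + 1 := by omega
      subst this
      obtain ⟨σ, hmax⟩ := Finite.exists_max fun σ : Fin (N + 1) → Idx 1 m =>
        |((rm b).submatrix σ id).det|
      have hσ : ((rm b).submatrix σ id).det ≠ 0 := by
        obtain ⟨τ, hτ⟩ := hb
        have := hmax τ
        intro h0
        simp only [h0, abs_zero] at this
        exact hτ (abs_eq_zero.1 (le_antisymm this (abs_nonneg _)))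
      have hge := int_abs_ge (rm_det_int b σ) hσ
      obtain ⟨x, hx, τ, h3, h4⟩ := h2 (nb (rm b) σ) σ (by
        intro a q
        have h5 := hmax (Function.update σ q a)
        rw [nb_upd hσ, abs_mul] at h5
        have : |nb (rm b) σ a q| ≤ 1 := by
          by_contra hcon
          push Not at hcon
          nlinarith
        exact abs_le.1 this) (nb_one hσ)
      refine ⟨x, hx, τ, ?_, h4⟩
      rw [nb_minor hσ, abs_mul]
      have h6 : c2 ≤ |((RM f p x * nb (rm b) σ).submatrix τ id).det| := h3
      have := min_le_right c1 c2
      nlinarith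
    · obtain ⟨x, hx, τ, h3, h4⟩ := h1 r hr hle b hb
      exact ⟨x, hx, τ, (min_le_left _ _).trans h3, h4⟩

theorem wt_fd {r : ℕ} (hr : 1 ≤ r) (hrm : r ≤ m + 1) (hA : 0 < A) (hε : 0 < ε) (hε1 : ε ≤ 1)
    (hK : K = ε ^ m * A) {c : ℝ} (h1 : 1 ≤ c * A) (h2 : ε ≤ c) (τ : Fin r → Idx 1 m)
    (hτ : Function.Injective τ) (hF : ∃ k, τ k = iF) (hD : 2 ≤ r → ∃ k, τ k = iD 0) :
    1 ≤ c * ∏ k, wt A K ε (τ k) := by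
  obtain ⟨k, hk⟩ := hF
  rw [← Finset.mul_prod_erase _ _ (Finset.mem_univ k), hk]
  change 1 ≤ c * (A * _)
  by_cases hr2 : 2 ≤ r
  · obtain ⟨k', hk'⟩ := hD hr2
    have hne : k' ≠ k := by rintro rfl; rw [hk] at hk'; simp at hk'
    rw [← Finset.mul_prod_erase _ _ (Finset.mem_erase.2 ⟨hne, Finset.mem_univ k'⟩), hk',
      Finset.prod_congr rfl (g := fun _ => ε)]
    · rw [Finset.prod_const, Finset.card_erase_of_mem (Finset.mem_erase.2 ⟨hne, Finset.mem_univ k'⟩),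
        Finset.card_erase_of_mem (Finset.mem_univ k), Finset.card_univ, Fintype.card_fin]
      change 1 ≤ c * (A * (K⁻¹ * ε ^ (r - 1 - 1)))
      have e : c * (A * (K⁻¹ * ε ^ (r - 1 - 1))) = c * ε ^ (r - 1 - 1) / ε ^ m := by
        rw [hK]; field_simp
      rw [e, one_le_div (by positivity)]
      calc ε ^ m ≤ ε ^ (r - 1 - 1 + 1) := pow_le_pow_of_le_one hε.le hε1 (by omega)
        _ = ε * ε ^ (r - 1 - 1) := by ring
        _ ≤ _ := by gcongr
    · intro q hq
      rw [Finset.mem_erase, Finset.mem_erase] at hq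
      rcases ht : τ q with a | i | j
      · exact absurd (hτ (ht.trans hk.symm)) hq.2.1
      · have : i = 0 := Subsingleton.elim _ _
        subst this
        exact absurd (hτ (ht.trans hk'.symm)) hq.1
      · rfl
  · have : Finset.univ.erase k = ∅ := by
      rw [Finset.erase_eq_empty_iff]
      right
      apply Finset.eq_singleton_iff_unique_mem.2
      refine ⟨Finset.mem_univ _, fun q _ => Fin.ext ?_⟩
      have := q.2; have := k.2; omega
    rw [this]; simpa using h1

def cB (m : ℕ) (e3 : ℝ) : ℝ := e3 / (2 * (nI 1 m : ℝ) ^ (nI 1 m))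

theorem caseB (G : Geo f p x0 r0 L cN l κ e1) {e2 : ℝ}
    (hW : ∀ y ρ, 0 < ρ → cb y ρ ⊆ cb x0 r0 → ∀ u v, ∀ xs ∈ cb y ρ,
      volume {x | x ∈ cb y ρ ∧ |WX f p u v x| < e2 * |WX f p u v xs|} ≤
        oR κ * volume (cb y ρ))
    {e3 : ℝ} (he0 : 0 < e3) (he1 : e3 ≤ e1) (he2 : e3 ≤ e2) (hρ : 0 < ρ)
    (hQ : cb z ρ ⊆ cb x0 r0) : ∃ c > 0, ∀ A K ε, 0 < A → 0 < ε → ε ≤ 1 → K = ε ^ m * A →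
    1 ≤ c * A → ε ≤ c →
    volume {x | x ∈ cb z ρ ∧ ∃ v : Idx 1 m → ℤ, v ≠ 0 ∧ (nI 1 m : ℝ) ^ (nI 1 m + 1) * 1 *
      ‖(MM f p A K ε x).mulVec (fun a => (v a : ℝ))‖ < cB m e3} ≤
      p3c 1 (nI 1 m) * oR κ * volume (cb z ρ) := by
  obtain ⟨c, hc, hlow⟩ := int_lower G hρ hQ (m + 1)
  refine ⟨c, hc, ?_⟩
  intro A K ε hA hε hε1 hK h1A hεc
  have hK0 : 0 < K := by rw [hK]; positivity
  have hn1 : (1:ℝ) ≤ nI 1 m := nI_one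
  have hp1 : (1:ℝ) ≤ (nI 1 m : ℝ) ^ (nI 1 m) := one_le_pow₀ hn1
  have hc31 : cB m e3 ≤ 1 := by
    rw [cB, div_le_one (by positivity)]; linarith [G.he1']
  refine assemble G hK0 (by rw [pow_one, hK]) hρ le_rfl hc31
    (fun y ρ W => ∃ x ∈ cb y ρ, 1 ≤ psi (MM f p A K ε x * rm (tup W))) ?_ ?_ ?_
  · intro y ρ y' W h0 hyz hy' hbot htop hB hnB
    push Not at hnB
    refine ⟨fun x hx => (hnB x hx).le, ?_⟩
    obtain ⟨xs, hxs, hpsi⟩ := hB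
    have hrk := finrank_le_nI W
    set c' : ℝ := 1 / (2 * (nI 1 m : ℝ) ^ (nI 1 m)) with hc'
    have hc'0 : 0 < c' := by positivity
    obtain ⟨σ, hσ⟩ := exists_minor_of_psi _ c' (lt_of_lt_of_le (by
      have : (nI 1 m : ℝ) ^ (Module.finrank ℚ W) ≤ (nI 1 m : ℝ) ^ (nI 1 m) :=
        pow_le_pow_right₀ hn1 hrk
      calc (nI 1 m : ℝ) ^ (Module.finrank ℚ W) * c' ≤ (nI 1 m : ℝ) ^ (nI 1 m) * c' := by gcongr
        _ = 1 / 2 := by rw [hc']; field_simp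
        _ < 1 := by norm_num) hpsi)
    refine le_trans (measure_mono ?_) (minor_good G hW he1 he2 h0 (hyz.trans hQ) (rm (tup W)) σ xs hxs)
    rintro x ⟨hx, hlt⟩
    refine ⟨hx, ?_⟩
    have h3 := (minor_le_psi _ σ).trans_lt hlt
    rw [MM_minor, abs_mul] at h3 hσ
    have hw : 0 < |∏ k, wt A K ε (σ k)| :=
      abs_pos.2 (Finset.prod_ne_zero_iff.2 fun k _ => (wt_pos hA hK0 hε _).ne')
    have h4 : cB m e3 = e3 * c' := by rw [cB, hc']; ring
    rw [h4] at h3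
    have h5 := h3.trans (mul_lt_mul_of_pos_left hσ he0)
    rw [← mul_assoc, mul_comm e3, mul_assoc] at h5
    exact lt_of_mul_lt_mul_left h5 hw.le
  · intro x hx W hbot htop hlt
    obtain ⟨s, hs, h1⟩ := H3_gen G hQ hc31 _ x hx hlt
    refine ⟨s, hs, ?_⟩
    rintro y ρ h0 hρ hxy hyz ⟨x', hx', h4⟩
    linarith [h1 y ρ h0 hρ hxy hyz x' hx']
  · intro W hbot htop
    have hpos : 0 < Module.finrank ℚ W := by
      rw [Module.finrank_pos_iff]
      exact Submodule.nontrivial_iff_ne_bot.2 hbot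
    have hlt : Module.finrank ℚ W < 1 + (1 + m) := by
      have := Submodule.finrank_lt htop
      rwa [Module.finrank_fintype_fun_eq_card, Fintype.card_sum, Fintype.card_sum, Fintype.card_unit,
        Fintype.card_fin, Fintype.card_fin] at this
    obtain ⟨x, hx, τ, h3, h4, h5⟩ := hlow _ hpos (by omega) (tup W) (tup_minor W)
    refine ⟨x, hx, le_trans ?_ (minor_le_psi _ τ)⟩
    have hinj : Function.Injective τ := inj_of_det (abs_pos.1 (hc.trans_le h3))
    have h6 := wt_fd hpos (by omega) hA hε hε1 hK h1A hεc τ hinj h4 h5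
    have hw : 0 < ∏ k, wt A K ε (τ k) := Finset.prod_pos fun k _ => wt_pos hA hK0 hε _
    rw [MM_minor, abs_mul, abs_of_pos hw]
    nlinarith

end P6d

noncomputable section P7a

variable {d m : ℕ}

def pp (f : Mp d m) (x : Rv d) (i : Fin d) (j : Fin m) : ℝ :=
  fderiv ℝ (fun y => f y j) x (Pi.single i 1)

def cf (u : Idx d m → ℝ) : Fin (d + m) → ℝ := Fin.addCases (fun i => u (iD i)) (fun j => u (iW j))

theorem fm_cast (f : Mp d m) (x : Rv d) (i : Fin d) :
    fullMap d m f x (Fin.castAdd m i) = x i := by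
  simp [fullMap]

theorem fm_nat (f : Mp d m) (x : Rv d) (j : Fin m) :
    fullMap d m f x (Fin.natAdd d j) = f x j := by
  simp [fullMap]

theorem Fx_lin (f : Mp d m) (u : Idx d m → ℝ) (x : Rv d) :
    Fx f u x = lin (fullMap d m f) (u iF) (cf u) x := by
  simp only [Fx, lin, Fin.sum_univ_add, fm_cast, fm_nat, cf, Fin.addCases_left, Fin.addCases_right]
  simp only [mul_comm]

theorem lpd {f : Mp d m} {x : Rv d}
    (h : DifferentiableAt ℝ (fullMap d m f) x) (i : Fin d) (a : Fin (d + m)) :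
    listPDeriv [i] (fullMap d m f) x a = fderiv ℝ (fun y => fullMap d m f y a) x (Pi.single i 1) := by
  simp only [listPDeriv]
  have h1 : HasFDerivAt (fun y => fullMap d m f y a) _ x := (hasFDerivAt_pi'.1 h.hasFDerivAt) a
  rw [h1.fderiv]; rfl

theorem lpd_nat {f : Mp d m} {x : Rv d}
    (h : DifferentiableAt ℝ (fullMap d m f) x) (i : Fin d) (j : Fin m) :
    listPDeriv [i] (fullMap d m f) x (Fin.natAdd d j) = pp f x i j := by
  rw [lpd h]; simp only [fm_nat]; rfl

theorem lpd_cast {f : Mp d m} {x : Rv d}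
    (h : DifferentiableAt ℝ (fullMap d m f) x) (i k : Fin d) :
    listPDeriv [i] (fullMap d m f) x (Fin.castAdd m k) = if k = i then 1 else 0 := by
  rw [lpd h]; simp only [fm_cast]
  have : HasFDerivAt (fun y : Fin d → ℝ => y k) (ContinuousLinearMap.proj (R := ℝ) k) x :=
    hasFDerivAt_apply k x
  rw [this.fderiv]; simp [Pi.single_apply]

theorem Dx_lin {f : Mp d m} {x : Rv d}
    (h : DifferentiableAt ℝ (fullMap d m f) x) (u : Idx d m → ℝ) (i : Fin d) :
    Dx (pp f) u x i = linD (fullMap d m f) (u iF) (cf u) [i] x := by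
  simp only [Dx, linD, Fin.sum_univ_add, cf, Fin.addCases_left, Fin.addCases_right, lpd_nat h,
    lpd_cast h]
  simp [mul_comm]

theorem l_ge_two (hm : 0 < m) {f : Mp d m} {x0 : Rv d} {l : ℕ}
    (h : IsLNondegenerateAt l (fullMap d m f) x0) : 2 ≤ l := by
  by_contra hcon
  have hsub : {v : Fin (d + m) → ℝ | ∃ β : List (Fin d),
    1 ≤ β.length ∧ β.length ≤ l ∧ v = listPDeriv β (fullMap d m f) x0} ⊆
      Set.range (fun i : Fin d => listPDeriv [i] (fullMap d m f) x0) := by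
    rintro v ⟨β, h1, h2, rfl⟩
    obtain ⟨i, rfl⟩ := List.length_eq_one_iff.1 (show β.length = 1 by omega)
    exact ⟨i, rfl⟩
  have h3 := finrank_range_le_card (R := ℝ) (fun i : Fin d => listPDeriv [i] (fullMap d m f) x0)
  have h4 : Submodule.span ℝ (Set.range (fun i : Fin d => listPDeriv [i] (fullMap d m f) x0)) = ⊤ :=
    top_le_iff.1 (h.2 ▸ Submodule.span_mono hsub)
  rw [Set.finrank, h4, finrank_top] at h3
  simp at h3
  omega

theorem Geo.mono {f : Mp d m} {p : (Rv d) → Fin d → Fin m → ℝ}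
    {x0 : Rv d} {r0 L cN : ℝ} {l : ℕ} {κ e1 : ℝ} (G : Geo f p x0 r0 L cN l κ e1) {r : ℝ}
    (hr : 0 < r) (hr0 : r ≤ r0) : Geo f p x0 r L cN l κ e1 := by
  have hs : cb x0 r ⊆ cb x0 r0 :=
    Metric.closedBall_subset_closedBall hr0
  exact ⟨G.hd, hr, hr0.trans G.hr1, G.hL, G.hcN, G.he1, G.he1', G.cont.mono hs,
    fun x hx => G.der x (hs hx), fun x hx x' hx' => G.lip x (hs hx) x' (hs hx'),
    fun y ρ h0 h => G.npr y ρ h0 (h.trans hs), fun y ρ h0 h => G.lg y ρ h0 (h.trans hs)⟩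

theorem geo_exists (hd : 0 < d) {f : Mp d m} {x0 : Rv d} {l : ℕ}
    {r1 c : ℝ} {Ω : Set (Rv d)} (S : Setup (fullMap d m f) x0 l r1 c Ω)
    (hl : m = 0 ∨ 2 ≤ l) (κ : ℝ) (hκ : 0 < κ) :
    ∃ r0, r0 ≤ r1 ∧ ∃ L e1, Geo f (pp f) x0 r0 L c l κ e1 := by
  obtain ⟨r0, hr0, hr01, e, he, he1, hlg⟩ := lem_LG hd S κ hκ
  have hs : cb x0 r0 ⊆ Ω :=
    (Metric.closedBall_subset_closedBall hr01).trans S.hsub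
  have hLip : ∃ L : ℝ, 1 ≤ L ∧ ∀ x ∈ cb x0 r0, ∀ x' ∈ cb x0 r0,
      ∀ i j, |pp f x i j - pp f x' i j| ≤ L * dist x x' := by
    rcases hl with rfl | hl
    · exact ⟨1, le_rfl, fun _ _ _ _ _ j => j.elim0⟩
    have hdiff : ∀ x ∈ Ω, DifferentiableAt ℝ (fullMap d m f) x := fun x hx =>
      (S.hC.contDiffAt (S.hΩ.mem_nhds hx)).differentiableAt (by simp; omega)
    have h1 : ∀ i : Fin d, ∃ C : ℝ≥0, LipschitzOnWith C (listPDeriv [i] (fullMap d m f))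
        (cb x0 r0) := by
      intro i
      have h2 := (contDiff_listPDeriv S.hΩ [i] l S.hC (by simp; omega)).mono hs
      have hne : ((l - [i].length : ℕ) : WithTop ℕ∞) ≠ 0 := by
        simp only [List.length_singleton]
        exact_mod_cast (show l - 1 ≠ 0 by omega)
      exact h2.exists_lipschitzOnWith hne (convex_closedBall x0 r0) (isCompact_closedBall x0 r0)
    choose C hC using h1
    refine ⟨1 + ∑ i, (C i : ℝ), by
      have : 0 ≤ ∑ i, (C i : ℝ) := Finset.sum_nonneg fun i _ => (C i).2
      linarith, ?_⟩
    intro x hx x' hx' i j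
    rw [← lpd_nat (hdiff x (hs hx)), ← lpd_nat (hdiff x' (hs hx')), ← Real.dist_eq]
    refine (dist_le_pi_dist _ _ _).trans (((hC i).dist_le_mul x hx x' hx').trans ?_)
    refine mul_le_mul_of_nonneg_right ?_ dist_nonneg
    have := Finset.single_le_sum (f := fun i => (C i : ℝ)) (fun i _ => (C i).2) (Finset.mem_univ i)
    linarith
  obtain ⟨L, hL, hlip⟩ := hLip
  refine ⟨r0, hr01, L, e, ⟨hd, hr0, hr01.trans S.hr1', hL, S.hc, he, he1, ?_, ?_, hlip, ?_, ?_⟩⟩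
  · rw [continuousOn_pi]
    intro j
    have := (continuousOn_pi.1 S.hC.continuousOn (Fin.natAdd d j)).mono hs
    simpa only [fm_nat] using this
  · intro x hx i j
    have hl1 : 1 ≤ l := by
      rcases hl with rfl | hl
      · exact j.elim0
      · omega
    have hdf : DifferentiableAt ℝ (fullMap d m f) x :=
      (S.hC.contDiffAt (S.hΩ.mem_nhds (hs hx))).differentiableAt (by simp; omega)
    have h1 := differentiableAt_pi.1 hdf (Fin.natAdd d j)
    simp only [fm_nat] at h1
    have h2 : HasDerivAt (fun s : ℝ => x + s • ev i) (ev i) 0 := by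
      simpa using ((hasDerivAt_id (0:ℝ)).smul_const (ev i)).const_add x
    have h3 : HasFDerivAt (fun y => f y j) (fderiv ℝ (fun y => f y j) x) (x + (0:ℝ) • ev i) := by
      simpa using h1.hasFDerivAt
    exact h3.comp_hasDerivAt 0 h2
  · intro y ρ h0 hy u
    obtain ⟨x, hx, h1⟩ := S.hN y ρ h0
      (hy.trans (Metric.closedBall_subset_closedBall hr01)) (u iF) (cf u)
    refine ⟨x, hx, fun b => ?_⟩
    rw [Fx_lin]
    refine le_trans ?_ h1
    have hb : |u (Sum.inr b)| ≤ ‖cf u‖ := by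
      rcases b with i | j
      · have := norm_le_pi_norm (cf u) (Fin.castAdd m i)
        simpa [cf] using this
      · have := norm_le_pi_norm (cf u) (Fin.natAdd d j)
        simpa [cf] using this
    have := S.hc
    gcongr
  · intro y ρ h0 hy u xs hxs
    simp only [Fx_lin]
    exact hlg y ρ h0 hy (u iF) (cf u) xs hxs

theorem hW_exists {f : Mp 1 m} {x0 : Rv 1} {l : ℕ}
    {r1 c : ℝ} {Ω : Set (Rv 1)} (S : Setup (fullMap 1 m f) x0 l r1 c Ω)
    (hl : 1 ≤ l) (κ : ℝ) (hκ : 0 < κ) :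
    ∃ r0 > 0, ∃ e2 > 0, ∀ y ρ, 0 < ρ → cb y ρ ⊆ cb x0 r0 → ∀ u v, ∀ xs ∈ cb y ρ,
      volume {x | x ∈ cb y ρ ∧ |WX f (pp f) u v x| < e2 * |WX f (pp f) u v xs|} ≤
        oR κ * volume (cb y ρ) := by
  obtain ⟨r0, hr0, hr01, e, he, he1, h⟩ := lem_LW S hl κ hκ
  refine ⟨r0, hr0, e, he, ?_⟩
  intro y ρ h0 hy u v xs hxs
  have hs : cb y ρ ⊆ Ω := hy.trans ((Metric.closedBall_subset_closedBall hr01).trans S.hsub)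
  have heq : ∀ x ∈ cb y ρ, WX f (pp f) u v x =
      wrl (fullMap 1 m f) (u iF) (cf u) (v iF) (cf v) x := by
    intro x hx
    have hdf : DifferentiableAt ℝ (fullMap 1 m f) x :=
      (S.hC.contDiffAt (S.hΩ.mem_nhds (hs hx))).differentiableAt (by simp; omega)
    rw [WX, wrl, Fx_lin, Fx_lin, Dx_lin hdf, Dx_lin hdf]
  refine le_trans (measure_mono ?_) (h y ρ h0 hy (u iF) (cf u) (v iF) (cf v) xs hxs)
  rintro x ⟨hx, hlt⟩
  refine ⟨hx, ?_⟩
  rw [← heq x hx, ← heq xs hxs]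
  exact hlt

end P7a

noncomputable section P7b

variable {d m : ℕ}

theorem K_big {A K ε M : ℝ} (hK : 0 < K) (hε : 0 < ε) (hM : 0 < M)
    (hKd : K ^ d = ε ^ m * A) (hK2 : 1 ≤ K ^ 2 * ε) (hA : 0 < A) (hAM : M ^ (d + 2 * m) ≤ A)
    (hd : 0 < d) : M ≤ K := by
  by_contra hcon
  push Not at hcon
  have h1 : 1 ≤ (K ^ 2 * ε) ^ m := one_le_pow₀ hK2
  have h2 : A ≤ K ^ (d + 2 * m) := by
    calc A = 1 * A := (one_mul A).symm
      _ ≤ (K ^ 2 * ε) ^ m * A := by gcongr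
      _ = K ^ (2 * m) * (ε ^ m * A) := by rw [mul_pow, ← pow_mul]; ring
      _ = K ^ (d + 2 * m) := by rw [← hKd]; ring
  have h3 : K ^ (d + 2 * m) < M ^ (d + 2 * m) := pow_lt_pow_left₀ hcon hK.le (by omega)
  linarith

theorem kap_exists (N : ℕ) (d : ℕ) (κ : ℝ) (hκ : 0 < κ) :
    ∃ κ1 > 0, p3c d N * oR κ1 ≤ oR κ := by
  set c := (p3c d N).toReal with hc
  have hc0 : 0 ≤ c := ENNReal.toReal_nonneg
  refine ⟨κ / (c + 1), by positivity, ?_⟩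
  rw [← ENNReal.ofReal_toReal (p3c_ne_top d N), ← hc, ← ENNReal.ofReal_mul hc0]
  apply ENNReal.ofReal_le_ofReal
  rw [mul_div_assoc', div_le_iff₀ (by positivity)]
  nlinarith

def Bad (f : Mp d m) (A K ε τ : ℝ) (z : Rv d) (r : ℝ) : Set (Rv d) :=
  {x | x ∈ cb z r ∧ ∃ v : Idx d m → ℤ, v ≠ 0 ∧
    ‖(MM f (pp f) A K ε x).mulVec (fun a => (v a : ℝ))‖ ≤ τ}

theorem coreA (hd : 0 < d) {f : Mp d m} {x0 : Rv d} {r0 L cN : ℝ} {l : ℕ}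
    {κ1 e1 κ : ℝ} (G : Geo f (pp f) x0 r0 L cN l κ1 e1)
    (hκ : p3c d (nI d m) * oR κ1 ≤ oR κ) :
    ∃ τ > 0, ∀ z r, 0 < r → cb z r ⊆ cb x0 r0 → ∃ A0 : ℝ, ∀ A K ε, A0 ≤ A → 0 < K →
      0 < ε → ε ≤ 1 → K ^ d = ε ^ m * A → 1 ≤ K ^ 2 * ε →
      volume (Bad f A K ε τ z r) ≤ oR κ * volume (cb z r) := by
  have hc3 := cc3_pos (d := d) (m := m) G.hL G.he1
  have hC2 := cC2_one (d := d) (m := m) G.hL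
  have hn : (1:ℝ) ≤ nI d m := nI_one
  set Q : ℝ := (nI d m : ℝ) ^ (nI d m + 1) * cC2 d m L with hQ
  have hQ0 : 0 < Q := by positivity
  refine ⟨cc3 d m L e1 / (2 * Q), by positivity, ?_⟩
  intro z r hr hz
  have hc : 0 < cN * r ^ l := by have := G.hcN; positivity
  set M : ℝ := max (1 / (cN * r ^ l)) (1 / r) with hM
  have hM0 : 0 < M := lt_max_of_lt_right (by positivity)
  refine ⟨M ^ (d + 2 * m), ?_⟩
  intro A K ε hA hK hε hε1 hKd hK2
  have hA0 : 0 < A := lt_of_lt_of_le (by positivity) hA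
  have hMK := K_big hK hε hM0 hKd hK2 hA0 hA hd
  have h1 : 1 ≤ K * (cN * r ^ l) := by
    have := (le_max_left _ _).trans hMK
    rwa [div_le_iff₀ hc] at this
  have h2 : 1 ≤ K * r := by
    have := (le_max_right _ _).trans hMK
    rwa [div_le_iff₀ hr] at this
  refine le_trans (measure_mono ?_) ((caseA G hA0 hK hε hε1 hKd hK2 hr hz h1 h2).trans
    (by gcongr))
  rintro x ⟨hx, v, hv, hle⟩
  refine ⟨hx, v, hv, ?_⟩
  rw [← hQ]
  calc Q * _ ≤ Q * (cc3 d m L e1 / (2 * Q)) := by gcongr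
    _ = cc3 d m L e1 / 2 := by field_simp
    _ < _ := by linarith

theorem coreB {f : Mp 1 m} {x0 : Rv 1} {r0 L cN : ℝ} {l : ℕ}
    {κ1 e1 κ : ℝ} (G : Geo f (pp f) x0 r0 L cN l κ1 e1) {e2 : ℝ} (he2 : 0 < e2)
    (hW : ∀ y ρ, 0 < ρ → cb y ρ ⊆ cb x0 r0 → ∀ u v, ∀ xs ∈ cb y ρ,
      volume {x | x ∈ cb y ρ ∧ |WX f (pp f) u v x| < e2 * |WX f (pp f) u v xs|} ≤
        oR κ1 * volume (cb y ρ))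
    (hκ : p3c 1 (nI 1 m) * oR κ1 ≤ oR κ) :
    ∃ τ > 0, ∀ z r, 0 < r → cb z r ⊆ cb x0 r0 → ∃ A0 : ℝ, ∀ A K ε, A0 ≤ A → 0 < K →
      0 < ε → ε ≤ 1 → K ^ 1 = ε ^ m * A → K ^ 2 * ε < 1 →
      volume (Bad f A K ε τ z r) ≤ oR κ * volume (cb z r) := by
  have he3 : 0 < min e1 e2 := lt_min G.he1 he2
  have hn : (1:ℝ) ≤ nI 1 m := nI_one
  set Q : ℝ := (nI 1 m : ℝ) ^ (nI 1 m + 1) * 1 with hQ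
  have hQ0 : 0 < Q := by positivity
  have hc3 : 0 < cB m (min e1 e2) := by unfold cB; positivity
  refine ⟨cB m (min e1 e2) / (2 * Q), by positivity, ?_⟩
  intro z r hr hz
  obtain ⟨c, hc, h⟩ := caseB G hW he3 (min_le_left _ _) (min_le_right _ _) hr hz
  refine ⟨max (max 1 (1 / c)) (1 / c ^ (2 * m + 1)), ?_⟩
  intro A K ε hA hK hε hε1 hKd hK2
  have hA1 : 1 ≤ A := (le_max_left _ _).trans ((le_max_left _ _).trans hA)
  have hA2 : 1 ≤ c * A := by
    have := (le_max_right _ _).trans ((le_max_left _ _).trans hA)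
    rwa [div_le_iff₀ hc, mul_comm] at this
  have hA3 : 1 ≤ A * c ^ (2 * m + 1) := by
    have := (le_max_right _ _).trans hA
    rwa [div_le_iff₀ (by positivity)] at this
  have hεc : ε ≤ c := by
    by_contra hcon
    push Not at hcon
    have h1 : c ^ (2 * m + 1) ≤ ε ^ (2 * m + 1) := pow_le_pow_left₀ hc.le hcon.le _
    have h2 : K ^ 2 * ε = A * (A * ε ^ (2 * m + 1)) := by
      rw [pow_one] at hKd
      rw [hKd]; ring
    have h3 : 1 ≤ A * ε ^ (2 * m + 1) := hA3.trans (by gcongr)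
    nlinarith
  refine le_trans (measure_mono ?_) ((h A K ε (by linarith) hε hε1 (by rw [← hKd, pow_one])
    hA2 hεc).trans (by gcongr))
  rintro x ⟨hx, v, hv, hle⟩
  refine ⟨hx, v, hv, ?_⟩
  rw [← hQ]
  calc Q * _ ≤ Q * (cB m (min e1 e2) / (2 * Q)) := by gcongr
    _ = cB m (min e1 e2) / 2 := by field_simp
    _ < _ := by linarith

theorem core (hd : 0 < d) {f : Mp d m} {x0 : Rv d} {l : ℕ}
    (hnd : IsLNondegenerateAt l (fullMap d m f) x0) (hl : m = 0 ∨ 2 ≤ l) (hl1 : 1 ≤ l)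
    (κ : ℝ) (hκ : 0 < κ) :
    ∃ r0 > 0, ∃ τ > 0, ∀ z r, 0 < r → cb z r ⊆ cb x0 r0 → ∃ A0 : ℝ, ∀ A K ε, A0 ≤ A → 0 < K →
      0 < ε → ε ≤ 1 → K ^ d = ε ^ m * A → (1 ≤ K ^ 2 * ε ∨ d = 1) →
      volume (Bad f A K ε τ z r) ≤ oR κ * volume (cb z r) := by
  obtain ⟨r1, hr1, hr1', c, hc, Ω, hΩ, hsub, hC, hN⟩ := lem_N hd hnd
  have S : Setup (fullMap d m f) x0 l r1 c Ω := ⟨hr1, hr1', hc, hΩ, hsub, hC, hN⟩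
  obtain ⟨κ1, hκ1, hκ2⟩ := kap_exists (nI d m) d κ hκ
  obtain ⟨r2, hr2, L, e1, G⟩ := geo_exists hd S hl κ1 hκ1
  obtain ⟨τ, hτ, hA⟩ := coreA hd G hκ2
  by_cases hd1 : d = 1
  · subst hd1
    obtain ⟨r3, hr3, e2, he2, hW⟩ := hW_exists S hl1 κ1 hκ1
    have hmin : 0 < min r2 r3 := lt_min G.hr0 hr3
    have hs2 : cb x0 (min r2 r3) ⊆ cb x0 r2 := Metric.closedBall_subset_closedBall (min_le_left _ _)
    have hs3 : cb x0 (min r2 r3) ⊆ cb x0 r3 := Metric.closedBall_subset_closedBall (min_le_right _ _)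
    obtain ⟨τ', hτ', hB⟩ := coreB (G.mono hmin (min_le_left _ _)) he2
      (fun y ρ h0 hy => hW y ρ h0 (hy.trans hs3)) hκ2
    refine ⟨min r2 r3, hmin, min τ τ', lt_min hτ hτ', ?_⟩
    intro z r hr hz
    obtain ⟨A1, h1⟩ := hA z r hr (hz.trans hs2)
    obtain ⟨A2, h2⟩ := hB z r hr hz
    refine ⟨max A1 A2, ?_⟩
    intro A K ε hAA hK hε hε1 hKd _
    by_cases hK2 : 1 ≤ K ^ 2 * ε
    · refine le_trans (measure_mono ?_) (h1 A K ε ((le_max_left _ _).trans hAA) hK hε hε1 hKd hK2)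
      rintro x ⟨hx, v, hv, hle⟩
      exact ⟨hx, v, hv, hle.trans (min_le_left _ _)⟩
    · refine le_trans (measure_mono ?_) (h2 A K ε ((le_max_right _ _).trans hAA) hK hε hε1 hKd
        (not_le.1 hK2))
      rintro x ⟨hx, v, hv, hle⟩
      exact ⟨hx, v, hv, hle.trans (min_le_right _ _)⟩
  · refine ⟨r2, G.hr0, τ, hτ, ?_⟩
    intro z r hr hz
    obtain ⟨A1, h1⟩ := hA z r hr hz
    exact ⟨A1, fun A K ε hAA hK hε hε1 hKd h => h1 A K ε hAA hK hε hε1 hKd (h.resolve_right hd1)⟩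

theorem minkowski {ι : Type*} [Fintype ι] [DecidableEq ι] (P : Matrix ι ι ℝ) (hP : P.det ≠ 0)
    (b : ι → ℝ) (hb : ∀ i, 0 < b i) (h : |P.det| < ∏ i, b i) :
    ∃ u : ι → ℤ, u ≠ 0 ∧ ∀ i, |P.mulVec (fun a => (u a : ℝ)) i| < b i := by
  let B := Pi.basisFun ℝ ι
  let s : Set (ι → ℝ) := (Matrix.toLin' P) ⁻¹' (Set.univ.pi fun i => Ioo (-(b i)) (b i))
  have hfund := ZSpan.isAddFundamentalDomain B (volume : Measure (ι → ℝ))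
  have hvolF : volume (ZSpan.fundamentalDomain B) = 1 := by
    rw [ZSpan.volume_fundamentalDomain]
    have : Matrix.of (⇑B) = (1 : Matrix ι ι ℝ) := by
      ext i j; simp [B, Matrix.one_apply, Pi.single_apply, eq_comm]
    rw [this]; simp
  have hdet : LinearMap.det (Matrix.toLin' P) = P.det := LinearMap.det_toLin' P
  have hvol : volume s = oR |P.det|⁻¹ * ∏ i, oR (2 * b i) := by
    rw [Measure.addHaar_preimage_linearMap _ (by rw [hdet]; exact hP), hdet, volume_pi_pi, abs_inv]
    simp only [Real.volume_Ioo]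
    congr 2; ext i; congr 1; ring
  have hlt : volume (ZSpan.fundamentalDomain B) * 2 ^ Module.finrank ℝ (ι → ℝ) < volume s := by
    rw [hvolF, hvol, one_mul, ← ENNReal.ofReal_prod_of_nonneg (fun i _ => by linarith [hb i]),
      ← ENNReal.ofReal_mul (by positivity), Finset.prod_mul_distrib]
    have h2 : (2 : ℝ≥0∞) ^ Module.finrank ℝ (ι → ℝ) = oR (2 ^ Fintype.card ι) := by
      rw [Module.finrank_fintype_fun_eq_card, ENNReal.ofReal_pow (by norm_num)]; simp
    have hp : 0 < |P.det| := abs_pos.2 hP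
    rw [h2, ENNReal.ofReal_lt_ofReal_iff_of_nonneg (by positivity), Finset.prod_const,
      Finset.card_univ, inv_mul_eq_div, lt_div_iff₀ hp]
    have : (0:ℝ) < 2 ^ Fintype.card ι := by positivity
    gcongr
  have hsym : ∀ x ∈ s, -x ∈ s := by
    intro x hx i hi
    have := hx i hi
    simp only [map_neg, Pi.neg_apply, Set.mem_Ioo] at this ⊢
    constructor <;> linarith [this.1, this.2]
  have hconv : Convex ℝ s :=
    (convex_pi fun i _ => convex_Ioo _ _).linear_preimage _
  have : Countable (Submodule.span ℤ (Set.range B)).toAddSubgroup :=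
    inferInstanceAs (Countable (Submodule.span ℤ (Set.range B)))
  obtain ⟨x, hx0, hxs⟩ := exists_ne_zero_mem_lattice_of_measure_mul_two_pow_lt_measure
    (L := (Submodule.span ℤ (Set.range B)).toAddSubgroup) hfund hsym hconv hlt
  have hmem : (x : ι → ℝ) ∈ Submodule.span ℤ (Set.range B) := x.2
  have hint : ∀ i, ∃ n : ℤ, (n : ℝ) = (x : ι → ℝ) i := by
    intro i
    have := (B.mem_span_iff_repr_mem ℤ (x : ι → ℝ)).1 hmem i
    simpa [B] using this
  choose u hu using hint
  have hux : (fun a => (u a : ℝ)) = (x : ι → ℝ) := funext hu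
  refine ⟨u, ?_, ?_⟩
  · rintro rfl
    apply hx0
    ext i
    rw [← hux]; simp
  · intro i
    rw [hux]
    have := hxs i (Set.mem_univ i)
    rw [Matrix.toLin'_apply] at this
    exact abs_lt.2 this

theorem trans_lem {ι : Type*} [Fintype ι] [DecidableEq ι] (M : Matrix ι ι ℝ) (hM : M.det = 1)
    (s : ι → ℝ) (w : ι → ℤ) (hw0 : w ≠ 0) (hw : ∀ a, ∑ i, s i * M i a = w a) {σ β : ℝ}
    (hs : ∀ i, |s i| ≤ σ) (hβ : 0 < β) (hσ : σ < β ^ (Fintype.card ι - 1)) :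
    ∃ u : ι → ℤ, u ≠ 0 ∧ ‖M.mulVec (fun a => (u a : ℝ))‖ ≤ Fintype.card ι * β := by
  have hne : Nonempty ι := by
    by_contra hcon
    rw [not_nonempty_iff] at hcon
    exact hw0 (Subsingleton.elim _ _)
  obtain ⟨k, hk⟩ := Finite.exists_max fun i => |s i|
  have hk0 : 0 < |s k| := by
    by_contra hcon
    have h0 : ∀ i, s i = 0 := fun i =>
      abs_eq_zero.1 (le_antisymm ((hk i).trans (not_lt.1 hcon)) (abs_nonneg _))
    apply hw0
    funext a
    have := hw a
    simp only [h0, zero_mul, Finset.sum_const_zero] at this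
    exact_mod_cast this.symm
  have hdet : (M.updateRow k (∑ i, s i • M i)).det = s k := by
    rw [Matrix.det_updateRow_sum, hM]; simp
  have hcard : 1 ≤ Fintype.card ι := Fintype.card_pos
  obtain ⟨u, hu0, hu⟩ := minkowski (M.updateRow k (∑ i, s i • M i))
    (by rw [hdet]; exact abs_pos.1 hk0) (fun i => if i = k then 1 else β)
    (by intro i; split_ifs <;> positivity)
    (by
      rw [hdet, ← Finset.mul_prod_erase _ _ (Finset.mem_univ k), if_pos rfl, one_mul,
        Finset.prod_congr rfl (g := fun _ => β) (fun i hi => if_neg (Finset.ne_of_mem_erase hi)),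
        Finset.prod_const, Finset.card_erase_of_mem (Finset.mem_univ k), Finset.card_univ]
      exact (hs k).trans_lt hσ)
  refine ⟨u, hu0, ?_⟩
  set y := M.mulVec (fun a => (u a : ℝ)) with hy
  have hother : ∀ i, i ≠ k → |y i| < β := by
    intro i hi
    have := hu i
    simp only [if_neg hi, Matrix.mulVec, Matrix.updateRow_ne hi] at this
    exact this
  have hT : ∑ i, s i * y i = 0 := by
    have h1 : ∑ i, s i * y i = ((∑ a, w a * u a : ℤ) : ℝ) := by
      push_cast
      simp only [← hw, hy, Matrix.mulVec, dotProduct, Finset.mul_sum, Finset.sum_mul]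
      rw [Finset.sum_comm]
      simp only [mul_assoc]
    have h2 := hu k
    simp only [if_true, Matrix.mulVec, Matrix.updateRow_self] at h2
    have h3 : (∑ i, s i • M i) ⬝ᵥ (fun a => (u a : ℝ)) = ∑ i, s i * y i := by
      rw [sum_dotProduct]
      simp [hy, Matrix.mulVec]
    rw [h3, h1] at h2
    rw [h1]
    have : |∑ a, w a * u a| < 1 := by exact_mod_cast h2
    rw [Int.abs_lt_one_iff] at this
    rw [this]; simp
  have hyk : |y k| ≤ Fintype.card ι * β := by
    rw [← Finset.add_sum_erase _ _ (Finset.mem_univ k)] at hT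
    have h1 : |s k| * |y k| ≤ |s k| * (Fintype.card ι * β) := by
      rw [← abs_mul, eq_neg_of_add_eq_zero_left hT, abs_neg]
      refine (Finset.abs_sum_le_sum_abs _ _).trans ?_
      calc ∑ i ∈ Finset.univ.erase k, |s i * y i| ≤ ∑ i ∈ Finset.univ.erase k, |s k| * β := by
            refine Finset.sum_le_sum fun i hi => ?_
            rw [abs_mul]
            exact mul_le_mul (hk i) (hother i (Finset.ne_of_mem_erase hi)).le (abs_nonneg _)
              (abs_nonneg _)
        _ ≤ ∑ i : ι, |s k| * β :=
            Finset.sum_le_sum_of_subset_of_nonneg (Finset.subset_univ _) fun _ _ _ => by positivity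
        _ = _ := by simp; ring
    exact le_of_mul_le_mul_left h1 hk0
  have hc1 : (1:ℝ) ≤ Fintype.card ι := by exact_mod_cast hcard
  rw [pi_norm_le_iff_of_nonneg (by positivity)]
  intro i
  rw [Real.norm_eq_abs]
  by_cases hi : i = k
  · rw [hi]; exact hyk
  · have := hother i hi
    nlinarith

end P7b

noncomputable section P7c

variable {d m : ℕ}

def BadW (f : Mp d m) (a b c : ℝ) (x : Rv d) : Prop :=
  ∃ w : Idx d m → ℤ, w ≠ 0 ∧ |(w iF : ℝ)| ≤ a ∧ (∀ i, |(w (iD i) : ℝ) - w iF * x i| ≤ b) ∧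
    ∀ j, |(w (iW j) : ℝ) - w iF * f x j - ∑ i, ((w (iD i) : ℝ) - w iF * x i) * pp f x i j| ≤ c

theorem coreT (hd : 0 < d) {f : Mp d m} {x0 : Rv d} {l : ℕ}
    (hnd : IsLNondegenerateAt l (fullMap d m f) x0) (hl : m = 0 ∨ 2 ≤ l) (hl1 : 1 ≤ l)
    (κ : ℝ) (hκ : 0 < κ) :
    ∃ r0 > 0, ∃ σ > 0, σ < 1 ∧ ∀ z r, 0 < r → cb z r ⊆ cb x0 r0 → ∃ A0 : ℝ, ∀ A K ε, A0 ≤ A →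
      0 < A → 0 < K → 0 < ε → ε ≤ 1 → K ^ d = ε ^ m * A → (1 ≤ K ^ 2 * ε ∨ d = 1) →
      volume {x | x ∈ cb z r ∧ BadW f (σ * A) (σ * K⁻¹) (σ * ε) x} ≤
        oR κ * volume (cb z r) := by
  obtain ⟨r0, hr0, τ, hτ, h⟩ := core hd hnd hl hl1 κ hκ
  have hn : (1:ℝ) ≤ nI d m := nI_one
  set β : ℝ := τ / nI d m with hβ
  have hβ0 : 0 < β := by positivity
  have hσ0 : 0 < min (1/2) (β ^ (nI d m - 1) / 2) := by positivity
  set σ := min (1/2) (β ^ (nI d m - 1) / 2) with hσ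
  have hσβ : σ < β ^ (nI d m - 1) := by
    have h1 : σ ≤ β ^ (nI d m - 1) / 2 := min_le_right _ _
    have : 0 < β ^ (nI d m - 1) := by positivity
    linarith
  refine ⟨r0, hr0, σ, hσ0, lt_of_le_of_lt (min_le_left _ _) (by norm_num), ?_⟩
  intro z r hr hz
  obtain ⟨A0, hA0⟩ := h z r hr hz
  refine ⟨A0, ?_⟩
  intro A K ε hAA hA hK hε hε1 hKd hc
  refine le_trans (measure_mono ?_) (hA0 A K ε hAA hK hε hε1 hKd hc)
  rintro x ⟨hx, w, hw0, hF, hD, hW⟩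
  refine ⟨hx, ?_⟩
  let s : Idx d m → ℝ := Sum.elim (fun _ => w iF / A) (Sum.elim
    (fun i => K * ((w (iD i) : ℝ) - w iF * x i))
    (fun j => ((w (iW j) : ℝ) - w iF * f x j -
      ∑ i, ((w (iD i) : ℝ) - w iF * x i) * pp f x i j) / ε))
  obtain ⟨u, hu0, hu⟩ := trans_lem (MM f (pp f) A K ε x) (MM_det f (pp f) A K ε hK hKd x) s w hw0
    (by
      intro a
      have hent : ∀ b, MM f (pp f) A K ε x b a = wt A K ε b * RM f (pp f) x b a := by
        intro b; rw [MM, Matrix.diagonal_mul]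
      simp only [hent, Fintype.sum_sum_type, wt, s, Sum.elim_inl, Sum.elim_inr]
      have e1 : ∀ i, K * ((w (iD i) : ℝ) - w iF * x i) * (K⁻¹ * RM f (pp f) x (iD i) a) =
          ((w (iD i) : ℝ) - w iF * x i) * RM f (pp f) x (iD i) a := by
        intro i; field_simp
      have e2 : ∀ (y : ℝ) j, y / ε * (ε * RM f (pp f) x (iW j) a) = y * RM f (pp f) x (iW j) a := by
        intro y j; field_simp
      have e3 : ∀ y : ℝ, (w iF : ℝ) / A * (A * y) = w iF * y := by
        intro y; field_simp
      simp only [e1, e2, e3]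
      rcases a with a | i | j
      · simp [RM, Matrix.fromBlocks]
      · simp [RM, Matrix.fromBlocks, Matrix.one_apply]
      · simp [RM, Matrix.fromBlocks, Matrix.one_apply]) (σ := σ) (β := β)
    (by
      intro b
      rcases b with b | i | j
      · simp only [s, Sum.elim_inl]
        rw [abs_div, abs_of_pos hA, div_le_iff₀ hA]
        exact hF
      · simp only [s, Sum.elim_inl, Sum.elim_inr]
        rw [abs_mul, abs_of_pos hK, mul_comm, ← le_div_iff₀ hK, div_eq_mul_inv]
        exact hD i
      · simp only [s, Sum.elim_inr]
        rw [abs_div, abs_of_pos hε, div_le_iff₀ hε]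
        exact hW j) hβ0 hσβ
  refine ⟨u, hu0, hu.trans (le_of_eq ?_)⟩
  rw [hβ]; field_simp

def eI : Idx d m → Fin (d + m + 1)
  | Sum.inl _ => ⟨d + m, by omega⟩
  | Sum.inr (Sum.inl i) => ⟨d + m - 1 - i, by omega⟩
  | Sum.inr (Sum.inr j) => ⟨m - 1 - j, by omega⟩

theorem eI_bij : Function.Bijective (eI : Idx d m → Fin (d + m + 1)) := by
  rw [Fintype.bijective_iff_injective_and_card]
  refine ⟨?_, by simp; omega⟩
  rintro (a | i | j) (a' | i' | j') h <;> simp only [eI, Fin.mk.injEq] at h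
  · rfl
  · omega
  · omega
  · omega
  · have := i.2; have := i'.2
    have : i = i' := Fin.ext (by omega)
    rw [this]
  · omega
  · omega
  · omega
  · have := j.2; have := j'.2
    have : j = j' := Fin.ext (by omega)
    rw [this]

theorem eF (d m : ℕ) : ((eI (iF : Idx d m) : Fin (d + m + 1)) : ℕ) = d + m := rfl

theorem eD (m : ℕ) (i : Fin d) :
    ((eI (iD i : Idx d m) : Fin (d + m + 1)) : ℕ) = d + m - 1 - i := rfl

theorem eW (d : ℕ) (j : Fin m) :
    ((eI (iW j : Idx d m) : Fin (d + m + 1)) : ℕ) = m - 1 - j := rfl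

theorem pd1_eq (f : Mp d m) (x : Rv d) (i : Fin d) (j : Fin m) :
    pd1 f i j x = pp f x i j := by
  rw [pd1, dif_pos ⟨i.2, j.2⟩]; rfl

theorem u1_F (f : Mp d m) (x : Rv d) (y : Fin (d + m + 1) → ℝ) :
    (u1Mat f x).mulVec y (eI iF) = y (eI iF) := by
  rw [Matrix.mulVec, dotProduct, ← eI_bij.sum_comp]
  simp only [Fintype.sum_sum_type]
  have h1 : ∀ i, u1Mat f x (eI iF) (eI (iD i)) = 0 := by
    intro i
    have hi := i.2
    unfold u1Mat
    have q0 := eF d m; have q1 := eD m i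
    rw [if_neg (by omega), if_neg (by omega), if_neg (by omega), if_neg (by omega)]
  have h2 : ∀ j, u1Mat f x (eI iF) (eI (iW j)) = 0 := by
    intro j
    have hj := j.2
    unfold u1Mat
    have q0 := eF d m; have q1 := eW d j
    rw [if_neg (by omega), if_neg (by omega), if_neg (by omega), if_neg (by omega)]
  have h3 : u1Mat f x (eI iF) (eI iF) = 1 := by simp [u1Mat]
  simp [h1, h2, h3]

theorem u1_D (f : Mp d m) (x : Rv d) (y : Fin (d + m + 1) → ℝ) (i : Fin d) :
    (u1Mat f x).mulVec y (eI (iD i)) = y (eI (iD i)) + x i * y (eI iF) := by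
  rw [Matrix.mulVec, dotProduct, ← eI_bij.sum_comp]
  simp only [Fintype.sum_sum_type]
  have hi := i.2
  have h1 : ∀ i', u1Mat f x (eI (iD i)) (eI (iD i')) = if i' = i then 1 else 0 := by
    intro i'
    have hi' := i'.2
    unfold u1Mat
    have q0 := eD m i; have q1 := eD m i'
    by_cases h : i' = i
    · rw [if_pos (by rw [h]), if_pos h]
    · have : (i' : ℕ) ≠ i := fun hh => h (Fin.ext hh)
      rw [if_neg (by omega), if_neg (by omega), if_neg (by omega), if_neg (by omega), if_neg h]
  have h2 : ∀ j, u1Mat f x (eI (iD i)) (eI (iW j)) = 0 := by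
    intro j
    have hj := j.2
    unfold u1Mat
    have q0 := eD m i; have q1 := eW d j
    rw [if_neg (by omega), if_neg (by omega), if_neg (by omega), if_neg (by omega)]
  have h3 : u1Mat f x (eI (iD i)) (eI iF) = x i := by
    unfold u1Mat
    have q0 := eD m i; have q1 := eF d m
    rw [if_neg (by omega), if_neg (by omega), if_neg (by omega), if_pos (by omega),
      dif_pos (by omega)]
    congr 1
    exact Fin.ext (by simp only; omega)
  simp [h1, h2, h3, add_comm]

theorem u1_W (f : Mp d m) (x : Rv d) (y : Fin (d + m + 1) → ℝ) (j : Fin m) :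
    (u1Mat f x).mulVec y (eI (iW j)) = y (eI (iW j)) + f x j * y (eI iF) -
      ∑ i, (y (eI (iD i)) + x i * y (eI iF)) * pp f x i j := by
  rw [Matrix.mulVec, dotProduct, ← eI_bij.sum_comp]
  simp only [Fintype.sum_sum_type]
  have hj := j.2
  have hjj : m - 1 - ((eI (iW j : Idx d m) : Fin (d + m + 1)) : ℕ) = j := by rw [eW]; omega
  have h1 : ∀ j', u1Mat f x (eI (iW j)) (eI (iW j')) = if j' = j then 1 else 0 := by
    intro j'
    have hj' := j'.2
    unfold u1Mat
    have q0 := eW d j; have q1 := eW d j'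
    by_cases h : j' = j
    · rw [if_pos (by rw [h]), if_pos h]
    · have : (j' : ℕ) ≠ j := fun hh => h (Fin.ext hh)
      rw [if_neg (by omega), if_neg (by omega), if_neg (by omega), if_neg (by omega), if_neg h]
  have h2 : ∀ i, u1Mat f x (eI (iW j)) (eI (iD i)) = - pp f x i j := by
    intro i
    have hi := i.2
    unfold u1Mat
    have q0 := eW d j; have q1 := eD m i
    rw [if_neg (by omega), if_pos (by omega), ← pd1_eq, hjj,
      show d + m - 1 - ((eI (iD i : Idx d m) : Fin (d + m + 1)) : ℕ) = i by omega]
  have h3 : u1Mat f x (eI (iW j)) (eI iF) = f x j - ∑ i, x i * pp f x i j := by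
    unfold u1Mat
    have q0 := eW d j; have q1 := eF d m
    rw [if_neg (by omega), if_neg (by omega), if_pos (by omega), dif_pos (by omega)]
    simp only [hjj, pd1_eq, Fin.eta]
  simp only [h1, h2, h3]
  simp only [Finset.univ_unique, Finset.sum_const, Finset.card_singleton, one_smul, ite_mul, one_mul,
    zero_mul, Finset.sum_ite_eq', Finset.sum_ite_eq, Finset.mem_univ, if_true, add_mul, sub_mul,
    Finset.sum_add_distrib, Finset.sum_mul, neg_mul, Finset.sum_neg_distrib, Finset.sum_singleton]
  show (f x j * y (eI iF) - ∑ i, x i * pp f x i j * y (eI iF)) +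
    (-∑ i, pp f x i j * y (eI (iD i)) + y (eI (iW j))) = _
  have e1 : ∑ i, x i * pp f x i j * y (eI iF) = ∑ i, x i * y (eI iF) * pp f x i j :=
    Finset.sum_congr rfl fun i _ => by ring
  have e2 : ∑ i, pp f x i j * y (eI (iD i)) = ∑ i, y (eI (iD i)) * pp f x i j :=
    Finset.sum_congr rfl fun i _ => by ring
  rw [e1, e2]; ring

theorem bad_of_not_G {U : Set (Rv d)} {f : Mp d m} {v t ε : ℝ}
    {x : Rv d} (hx : x ∈ U) (hv : 0 < v) (hε : 0 < ε) (h : x ∉ Gfrak U f v t ε) :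
    BadW f (v ^ (d + m + 1) * Real.exp t) ((ε ^ m * Real.exp t) ^ ((1 : ℝ) / d))⁻¹ ε x := by
  have hlt : succMin 1 (aInvMat d m ε t v * u1Mat f x) < v := by
    by_contra hcon
    exact h ⟨hx, not_lt.1 hcon⟩
  set c : Fin (d + m + 1) → ℝ := fun i => (if (i : ℕ) < m then ε⁻¹
    else if (i : ℕ) < d + m then (ε ^ m * Real.exp t) ^ ((1 : ℝ) / d)
    else (v ^ (d + m + 1) * Real.exp t)⁻¹) with hc
  have hc0 : ∀ i, 0 < c i := by
    intro i; simp only [hc]; split_ifs <;> positivity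
  have hg : ∀ y i, (aInvMat d m ε t v * u1Mat f x).mulVec y i =
      v * c i * (u1Mat f x).mulVec y i := by
    intro y i
    rw [← Matrix.mulVec_mulVec, aInvMat, Matrix.mulVec_diagonal]
  have hne : ({r : ℝ | 0 ≤ r ∧ 1 ≤ Module.finrank ℝ
    (Submodule.span ℝ {w : Fin (d + m + 1) → ℝ | (∃ y : Fin (d + m + 1) → ℤ, y ≠ 0 ∧
      w = (aInvMat d m ε t v * u1Mat f x).mulVec (fun j => (y j : ℝ))) ∧
      Real.sqrt (∑ j, w j ^ 2) ≤ r})}).Nonempty := by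
    set w0 := (aInvMat d m ε t v * u1Mat f x).mulVec
      (fun j => ((Pi.single (eI (iF : Idx d m)) 1 : Fin (d + m + 1) → ℤ) j : ℝ)) with hw0
    refine ⟨Real.sqrt (∑ j, w0 j ^ 2), Real.sqrt_nonneg _, ?_⟩
    rw [Submodule.one_le_finrank_iff]
    intro hbot
    have hmem : w0 ∈ (⊥ : Submodule ℝ (Fin (d + m + 1) → ℝ)) := by
      rw [← hbot]
      exact Submodule.subset_span ⟨⟨_, by simp, hw0⟩, le_rfl⟩
    have h1 := congrFun ((Submodule.mem_bot ℝ).1 hmem) (eI (iF : Idx d m))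
    rw [hw0, hg, u1_F] at h1
    have := hc0 (eI (iF : Idx d m))
    simp [hv.ne', this.ne'] at h1
  obtain ⟨r, ⟨hr0, hr1⟩, hrv⟩ := exists_lt_of_csInf_lt hne hlt
  have hT : ∃ w : Fin (d + m + 1) → ℝ, (∃ y : Fin (d + m + 1) → ℤ, y ≠ 0 ∧
      w = (aInvMat d m ε t v * u1Mat f x).mulVec (fun j => (y j : ℝ))) ∧
      Real.sqrt (∑ j, w j ^ 2) ≤ r := by
    by_contra hcon
    rw [Submodule.one_le_finrank_iff] at hr1
    apply hr1
    rw [Submodule.span_eq_bot]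
    intro w hw
    exact absurd ⟨w, hw⟩ hcon
  obtain ⟨w, ⟨y, hy0, hwy⟩, hw⟩ := hT
  have hb : ∀ i, |(u1Mat f x).mulVec (fun j => (y j : ℝ)) i| < (c i)⁻¹ := by
    intro i
    have h1 : |w i| < v := by
      refine lt_of_le_of_lt (le_trans ?_ hw) hrv
      apply Real.abs_le_sqrt
      exact Finset.single_le_sum (f := fun j => w j ^ 2) (fun j _ => sq_nonneg _) (Finset.mem_univ i)
    rw [hwy, hg, abs_mul, abs_of_pos (mul_pos hv (hc0 i)), mul_assoc] at h1
    have h2 : c i * |(u1Mat f x).mulVec (fun j => (y j : ℝ)) i| < 1 := by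
      by_contra hcon
      push Not at hcon
      nlinarith
    rw [inv_eq_one_div, lt_div_iff₀ (hc0 i), mul_comm]
    exact h2
  refine ⟨fun a => Sum.elim (fun _ => y (eI iF)) (fun b => - y (eI (Sum.inr b))) a, ?_, ?_, ?_, ?_⟩
  · intro h0
    apply hy0
    funext k
    obtain ⟨a, rfl⟩ := eI_bij.2 k
    have := congrFun h0 a
    rcases a with a | b
    · exact this
    · simpa using this
  · have h1 := hb (eI iF)
    rw [u1_F] at h1
    have : c (eI (iF : Idx d m)) = (v ^ (d + m + 1) * Real.exp t)⁻¹ := by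
      have q0 := eF d m
      simp only [hc]; rw [if_neg (by omega), if_neg (by omega)]
    rw [this, inv_inv] at h1
    exact h1.le
  · intro i
    have h1 := hb (eI (iD i))
    rw [u1_D] at h1
    have : c (eI (iD i : Idx d m)) = (ε ^ m * Real.exp t) ^ ((1 : ℝ) / d) := by
      have := i.2
      have q0 := eD m i
      simp only [hc]; rw [if_neg (by omega), if_pos (by omega)]
    rw [this] at h1
    refine le_trans (le_of_eq ?_) h1.le
    rw [← abs_neg]
    simp only [Sum.elim_inl, Sum.elim_inr]
    push_cast
    congr 1; ring
  · intro j
    have h1 := hb (eI (iW j))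
    rw [u1_W] at h1
    have : c (eI (iW j : Idx d m)) = ε⁻¹ := by
      have := j.2
      have q0 := eW d j
      simp only [hc]; rw [if_pos (by omega)]
    rw [this, inv_inv] at h1
    refine le_trans (le_of_eq ?_) h1.le
    rw [← abs_neg]
    simp only [Sum.elim_inl, Sum.elim_inr]
    push_cast
    congr 1
    have e : ∑ i, (-(y (eI (iD i)) : ℝ) - y (eI iF) * x i) * pp f x i j =
        - ∑ i, ((y (eI (iD i)) : ℝ) + x i * y (eI iF)) * pp f x i j := by
      rw [← Finset.sum_neg_distrib]
      exact Finset.sum_congr rfl fun i _ => by ring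
    rw [e]; ring

end P7c

noncomputable section P7d

variable {d m : ℕ}

theorem nondeg0 (x0 : Rv d) :
    IsLNondegenerateAt 1 (fullMap d 0 (fun _ => Fin.elim0)) x0 := by
  have hc : ContDiff ℝ 1 (fullMap d 0 (fun _ => Fin.elim0)) := by
    rw [contDiff_pi]
    intro i
    have : (fun x : Fin d → ℝ => fullMap d 0 (fun _ => Fin.elim0) x i) =
        fun x => x ⟨i, by have := i.2; omega⟩ := by
      funext x; rw [fullMap, dif_pos (by have := i.2; omega)]
    rw [this]
    exact contDiff_apply ℝ ℝ _
  refine ⟨⟨univ, univ_mem, hc.contDiffOn⟩, ?_⟩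
  rw [eq_top_iff, ← (Pi.basisFun ℝ (Fin (d + 0))).span_eq, Submodule.span_le]
  rintro _ ⟨i, rfl⟩
  refine Submodule.subset_span ⟨[(i : Fin d)], by simp, by simp, ?_⟩
  funext k
  have := lpd_cast (hc.differentiable (by norm_num) x0) (i : Fin d) (k : Fin d)
  refine Eq.trans ?_ this.symm
  rw [Pi.basisFun_apply, Pi.single_apply]

theorem condK {σ ε K A : ℝ} (hd2 : 2 ≤ d) (hm : 0 < m) (hσ : 0 < σ) (hσ1 : σ ≤ 1) (hε : 0 < ε)
    (hε1 : ε ≤ 1) (hK : 0 < K) (hA : 0 < A) (hKd : K ^ d = ε ^ m * A)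
    (h : 1 ≤ (σ * ε) ^ (d + m - 1) * A) : 1 ≤ (σ * K) ^ 2 * (ε / σ) := by
  have e : (σ * K) ^ 2 * (ε / σ) = σ * K ^ 2 * ε := by field_simp
  rw [e]
  by_contra hcon
  push Not at hcon
  have h0 : 0 < σ * K ^ 2 * ε := by positivity
  have h1 : (σ * K ^ 2 * ε) ^ d < 1 := pow_lt_one₀ h0.le hcon (by omega)
  have h2 : (σ * K ^ 2 * ε) ^ d = σ ^ d * ε ^ (d + 2 * m) * A ^ 2 := by
    have : (σ * K ^ 2 * ε) ^ d = σ ^ d * ε ^ d * (K ^ d) ^ 2 := by ring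
    rw [this, hKd]; ring
  have h3 : σ ^ (2 * (d + m - 1)) ≤ σ ^ d := pow_le_pow_of_le_one hσ.le hσ1 (by omega)
  have h4 : ε ^ (2 * (d + m - 1)) ≤ ε ^ (d + 2 * m) := pow_le_pow_of_le_one hε.le hε1 (by omega)
  have h5 : (1:ℝ) ≤ ((σ * ε) ^ (d + m - 1) * A) ^ 2 := one_le_pow₀ h
  have h6 : ((σ * ε) ^ (d + m - 1) * A) ^ 2 =
      σ ^ (2 * (d + m - 1)) * ε ^ (2 * (d + m - 1)) * A ^ 2 := by
    rw [mul_pow, ← pow_mul, mul_pow, mul_comm (d + m - 1) 2]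
  have h7 : σ ^ (2 * (d + m - 1)) * ε ^ (2 * (d + m - 1)) * A ^ 2 ≤
      σ ^ d * ε ^ (d + 2 * m) * A ^ 2 := by gcongr
  linarith

theorem eta_cond {σ ε t : ℝ} (hd2 : 2 ≤ d) (hm : 0 < m) (hσ : 0 < σ)
    (h : 1 / σ * Real.exp (-(etaND (d + m) d) * t) < ε) :
    1 ≤ (σ * ε) ^ (d + m - 1) * Real.exp t := by
  have h1 : Real.exp (-(etaND (d + m) d) * t) < σ * ε := by
    rw [one_div, inv_mul_lt_iff₀ hσ] at h; exact h
  have h2 : Real.exp (-(etaND (d + m) d) * t) ^ (d + m - 1) ≤ (σ * ε) ^ (d + m - 1) :=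
    pow_le_pow_left₀ (Real.exp_pos _).le h1.le _
  have h3 : Real.exp (-(etaND (d + m) d) * t) ^ (d + m - 1) = Real.exp (-t) := by
    rw [← Real.exp_nat_mul]
    congr 1
    rw [etaND, if_pos (by omega), Nat.cast_sub (by omega)]
    have hh : (((d + m : ℕ) : ℝ) - 1) ≠ 0 := by
      have : (2:ℝ) ≤ ((d + m : ℕ) : ℝ) := by exact_mod_cast (by omega : 2 ≤ d + m)
      linarith
    push_cast at hh ⊢
    field_simp
  rw [h3] at h2
  calc (1:ℝ) = Real.exp (-t) * Real.exp t := by rw [← Real.exp_add]; simp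
    _ ≤ _ := by gcongr

theorem BadW.mono {f : Mp d m} {a b c a' b' c' : ℝ} {x : Rv d}
    (h : BadW f a b c x) (ha : a ≤ a') (hb : b ≤ b') (hc : c ≤ c') : BadW f a' b' c' x := by
  obtain ⟨w, h0, h1, h2, h3⟩ := h
  exact ⟨w, h0, h1.trans ha, fun i => (h2 i).trans hb, fun j => (h3 j).trans hc⟩

theorem BadW.to0 {f : Mp d m} {a b c : ℝ} {x : Rv d} (c' : ℝ)
    (h : BadW f a b c x) (hc : c < 1) : BadW (m := 0) (fun _ => Fin.elim0) a b c' x := by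
  obtain ⟨w, h0, h1, h2, h3⟩ := h
  refine ⟨Sum.elim (fun _ => w iF) (Sum.elim (fun i => w (iD i)) Fin.elim0), ?_, h1, h2,
    fun j => j.elim0⟩
  intro hz
  apply h0
  have hF : w iF = 0 := congrFun hz iF
  have hD : ∀ i, w (iD i) = 0 := fun i => congrFun hz (iD i)
  funext a
  rcases a with a | i | j
  · exact hF
  · exact hD i
  · have := h3 j
    simp only [hF, hD, Int.cast_zero, zero_mul, sub_zero, Finset.sum_const_zero] at this
    have h5 : |((w (iW j) : ℤ) : ℝ)| < 1 := lt_of_le_of_lt this hc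
    have h6 : |w (iW j)| < 1 := by exact_mod_cast h5
    exact Int.abs_lt_one_iff.1 h6

theorem main_aux (hd : 0 < d) (hm : 0 < m)
    (U : Set (Rv d)) (hU : IsOpen U)
    (f : Mp d m) (x₀ : Rv d) (hx₀ : x₀ ∈ U)
    (hnd : IsNondegenerateAt (fullMap d m f) x₀)
    (κ : ℝ) (hκ0 : 0 < κ) :
    ∃ V : Set (Rv d), V ⊆ U ∧ IsOpen V ∧ x₀ ∈ V ∧
    ∃ v : ℝ, 0 < v ∧ v < 1 ∧ ∃ K₀ : ℝ, 0 < K₀ ∧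
      ∀ z : Rv d, ∀ r : ℝ, Metric.ball z r ⊆ V →
        ∃ t₀ : ℝ, ∀ t : ℝ, t₀ ≤ t → ∀ ε : ℝ,
          K₀ * Real.exp (-(etaND (d + m) d) * t) < ε → ε < 1 →
          volume (Metric.ball z r \ Gfrak U f v t ε) ≤
            oR κ * volume (Metric.ball z r) := by
  obtain ⟨l, hl⟩ := hnd
  have hl2 := l_ge_two hm hl
  obtain ⟨r0, hr0, σ, hσ, hσ1, H⟩ := coreT hd hl (Or.inr hl2) (by omega) κ hκ0
  obtain ⟨r1, hr1, τ, hτ, hτ1, H'⟩ := coreT hd (nondeg0 x₀) (Or.inl rfl) le_rfl κ hκ0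
  refine ⟨Metric.ball x₀ r0 ∩ Metric.ball x₀ r1 ∩ U, inter_subset_right,
    (Metric.isOpen_ball.inter Metric.isOpen_ball).inter hU,
    ⟨⟨Metric.mem_ball_self hr0, Metric.mem_ball_self hr1⟩, hx₀⟩, σ * τ / 2, by positivity,
    by nlinarith, 1 / σ, by positivity, ?_⟩
  set v := σ * τ / 2 with hv
  have hv0 : 0 < v := by positivity
  have hvσ : v ≤ σ := by rw [hv]; nlinarith
  have hvτ : v ≤ τ := by rw [hv]; nlinarith
  intro z r hB
  rcases le_or_gt r 0 with hr | hr
  · exact ⟨0, fun t _ ε _ _ => by rw [Metric.ball_eq_empty.2 hr]; simp⟩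
  have hcl : ∀ ρ, Metric.ball z r ⊆ Metric.ball x₀ ρ → cb z r ⊆ cb x₀ ρ := by
    intro ρ h
    rw [← closure_ball z hr.ne']
    exact closure_minimal (h.trans Metric.ball_subset_closedBall) Metric.isClosed_closedBall
  obtain ⟨A1, hA1⟩ := H z r hr (hcl _ fun y hy => (hB hy).1.1)
  obtain ⟨A2, hA2⟩ := H' z r hr (hcl _ fun y hy => (hB hy).1.2)
  set X := max (A1 / σ ^ (d + m)) (max A2 1 / (τ ^ d * σ ^ m)) with hX
  have hX0 : 0 < X := lt_max_of_lt_right (by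
    have : (0:ℝ) < max A2 1 := lt_max_of_lt_right one_pos
    positivity)
  refine ⟨Real.log X, ?_⟩
  intro t ht ε hε hε1
  have hXt : X ≤ Real.exp t := (Real.log_le_iff_le_exp hX0).1 ht
  have hε0 : 0 < ε := lt_trans (by positivity) hε
  set A := Real.exp t with hA
  have hA0 : 0 < A := Real.exp_pos t
  set K := (ε ^ m * A) ^ ((1:ℝ) / d) with hK
  have hK0 : 0 < K := by positivity
  have hKd : K ^ d = ε ^ m * A := by
    rw [hK, ← Real.rpow_natCast, ← Real.rpow_mul (by positivity),
      one_div_mul_cancel (by exact_mod_cast hd.ne'), Real.rpow_one]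
  haveI : Nonempty (Fin d) := ⟨⟨0, hd⟩⟩
  have hvol : volume (Metric.ball z r) = volume (cb z r) :=
    (Measure.addHaar_closedBall_eq_addHaar_ball volume z r).symm
  rw [hvol]
  have hbad : ∀ x ∈ Metric.ball z r \ Gfrak U f v t ε,
      x ∈ cb z r ∧ BadW f (v ^ (d + m + 1) * A) K⁻¹ ε x := fun x hx =>
    ⟨Metric.ball_subset_closedBall hx.1, bad_of_not_G (hB hx.1).2 hv0 hε0 hx.2⟩
  rcases lt_or_ge ε σ with hεσ | hεσ
  · have hc1 : A1 ≤ σ ^ (d + m) * A := by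
      have := (le_max_left _ _).trans hXt
      rwa [div_le_iff₀' (by positivity)] at this
    refine le_trans (measure_mono ?_) (hA1 (σ ^ (d + m) * A) (σ * K) (ε / σ) hc1 (by positivity)
      (by positivity) (by positivity) ((div_le_one hσ).2 hεσ.le) ?_ ?_)
    · intro x hx
      obtain ⟨h1, h2⟩ := hbad x hx
      refine ⟨h1, h2.mono ?_ (le_of_eq ?_) (le_of_eq ?_)⟩
      · have : v ^ (d + m + 1) ≤ σ ^ (d + m + 1) := pow_le_pow_left₀ hv0.le hvσ _
        calc v ^ (d + m + 1) * A ≤ σ ^ (d + m + 1) * A := by gcongr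
          _ = _ := by ring
      · field_simp
      · field_simp
    · rw [mul_pow, hKd, div_pow, pow_add]; field_simp
    · rcases Nat.lt_or_ge 1 d with h2 | h2
      · exact Or.inl (condK h2 hm hσ hσ1.le hε0 hε1.le hK0 hA0 hKd (eta_cond h2 hm hσ hε))
      · exact Or.inr (by omega)
  · have hc2 : max A2 1 ≤ (τ * K) ^ d := by
      have := (le_max_right _ _).trans hXt
      rw [div_le_iff₀' (by positivity)] at this
      refine this.trans ?_
      rw [mul_pow, hKd, ← mul_assoc]
      have : σ ^ m ≤ ε ^ m := pow_le_pow_left₀ hσ.le hεσ _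
      gcongr
    have hK1 : 1 ≤ τ * K := by
      by_contra hcon
      push Not at hcon
      have := pow_lt_one₀ (by positivity) hcon hd.ne'
      exact absurd ((le_max_right _ _).trans hc2) (not_le.2 this)
    refine le_trans (measure_mono ?_) (hA2 ((τ * K) ^ d) (τ * K) 1 ((le_max_left _ _).trans hc2)
      (by positivity) (by positivity) one_pos le_rfl (by simp) (Or.inl ?_))
    · intro x hx
      obtain ⟨h1, h2⟩ := hbad x hx
      refine ⟨h1, (h2.to0 (τ * 1) hε1).mono ?_ (le_of_eq ?_) le_rfl⟩
      · have e1 : v ^ (d + m + 1) ≤ τ ^ (d + 1) * ε ^ m := by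
          calc v ^ (d + m + 1) = v ^ (d + 1) * v ^ m := by ring
            _ ≤ τ ^ (d + 1) * ε ^ m := by
              have := pow_le_pow_left₀ hv0.le hvτ (d + 1)
              have := pow_le_pow_left₀ hv0.le (hvσ.trans hεσ) m
              gcongr
        calc v ^ (d + m + 1) * A ≤ τ ^ (d + 1) * ε ^ m * A := by gcongr
          _ = τ * (τ * K) ^ d := by rw [mul_pow, hKd]; ring
      · field_simp
    · rw [mul_one]; exact one_le_pow₀ hK1

end P7d

/-- **Measure of the complement of the generic set `𝔊(v,t,ε)`** (Proposition 5.2). -/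
theorem generic_set_large_measure
    {d m : ℕ} (hd : 0 < d) (hm : 0 < m)
    (U : Set (Fin d → ℝ)) (hU : IsOpen U)
    (f : (Fin d → ℝ) → Fin m → ℝ) (x₀ : Fin d → ℝ) (hx₀ : x₀ ∈ U)
    (hnd : IsNondegenerateAt (fullMap d m f) x₀)
    (κ : ℝ) (hκ0 : 0 < κ) (hκ1 : κ < 1) :
    ∃ V : Set (Fin d → ℝ), V ⊆ U ∧ IsOpen V ∧ x₀ ∈ V ∧
    ∃ v : ℝ, 0 < v ∧ v < 1 ∧ ∃ K₀ : ℝ, 0 < K₀ ∧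
      ∀ z : Fin d → ℝ, ∀ r : ℝ, Metric.ball z r ⊆ V →
        ∃ t₀ : ℝ, ∀ t : ℝ, t₀ ≤ t → ∀ ε : ℝ,
          K₀ * Real.exp (-(etaND (d + m) d) * t) < ε → ε < 1 →
          volume (Metric.ball z r \ Gfrak U f v t ε) ≤
            ENNReal.ofReal κ * volume (Metric.ball z r) := by
  exact main_aux hd hm U hU f x₀ hx₀ hnd κ hκ0
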